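/- Let (u, w, b, Π) be a smooth solution of the stationary magneto-micropolar equations on ℝ³ satisfying the potential growth hypothesis: there exist smooth Φ, Ψ, Υ : ℝ³ → ℝ^{3×3} with div Φ = u, div Ψ = b, div Υ = w, an exponent s ∈ (3, 6], and a constant C₀ > 0 such that the sum of the s-mean oscillations of Φ, Ψ, Υ over B_r is at most C₀ r^{1/3 − 1/s} for all r > 1. Then the total Dirichlet integral is finite: ∫_{ℝ³} (|∇u|² + |∇b|² + |∇w|²) dx < ∞. -/

import Mathlib

open MeasureTheory Real Filter Metric
open scoped Topology ENNReal

noncomputable section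

/-- Three-dimensional Euclidean space. -/
abbrev E3 := EuclideanSpace ℝ (Fin 3)

/-- Partial derivative in the `i`-th coordinate direction. -/
def pd (i : Fin 3) (f : E3 → ℝ) (x : E3) : ℝ := fderiv ℝ f x (EuclideanSpace.single i 1)

/-- Laplacian of a scalar function. -/
def lap (f : E3 → ℝ) (x : E3) : ℝ := ∑ i, pd i (fun y => pd i f y) x

/-- Divergence of a vector field. -/
def vdiv (v : E3 → E3) (x : E3) : ℝ := ∑ i, pd i (fun y => v y i) x

/-- Curl of a vector field on ℝ³. -/
def curl3 (v : E3 → E3) (x : E3) : Fin 3 → ℝ :=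
  ![pd 1 (fun y => v y 2) x - pd 2 (fun y => v y 1) x,
    pd 2 (fun y => v y 0) x - pd 0 (fun y => v y 2) x,
    pd 0 (fun y => v y 1) x - pd 1 (fun y => v y 0) x]

/-- Squared norm of the full gradient of a vector field: |∇v|² = Σᵢⱼ (∂ᵢ vⱼ)². -/
def gradSq (v : E3 → E3) (x : E3) : ℝ := ∑ j, ∑ i, (pd i (fun y => v y j) x) ^ 2

/-- The open ball of radius `r` centered at the origin. -/
def ball3 (r : ℝ) : Set E3 := Metric.ball (0 : E3) r

/-- `(u, w, b, Π)` is a smooth solution of the stationary magneto-micropolar equations on ℝ³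
(with all physical constants set to 1):
−Δu + (u·∇)u + ∇Π = ∇×w + (b·∇)b; −Δw + (u·∇)w = ∇(div w) + ∇×u − 2w;
−Δb + (u·∇)b = (b·∇)u; div u = 0, div b = 0. -/
structure IsMMPSolution (u w b : E3 → E3) (P : E3 → ℝ) : Prop where
  smooth_u : ContDiff ℝ (⊤ : ℕ∞) u
  smooth_w : ContDiff ℝ (⊤ : ℕ∞) w
  smooth_b : ContDiff ℝ (⊤ : ℕ∞) b
  smooth_P : ContDiff ℝ (⊤ : ℕ∞) P
  eq_u : ∀ x : E3, ∀ j : Fin 3,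
    -(lap (fun y => u y j) x) + (∑ i, u x i * pd i (fun y => u y j) x) + pd j P x
      = curl3 w x j + ∑ i, b x i * pd i (fun y => b y j) x
  eq_w : ∀ x : E3, ∀ j : Fin 3,
    -(lap (fun y => w y j) x) + (∑ i, u x i * pd i (fun y => w y j) x)
      = pd j (fun y => vdiv w y) x + curl3 u x j - 2 * w x j
  eq_b : ∀ x : E3, ∀ j : Fin 3,
    -(lap (fun y => b y j) x) + (∑ i, u x i * pd i (fun y => b y j) x)
      = ∑ i, b x i * pd i (fun y => u y j) x
  div_u : ∀ x : E3, vdiv u x = 0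
  div_b : ∀ x : E3, vdiv b x = 0

/-- Divergence of a matrix-valued function: (div Φ)ⱼ = Σᵢ ∂ᵢ Φᵢⱼ. -/
def mdiv (Φ : E3 → Fin 3 → Fin 3 → ℝ) (x : E3) (j : Fin 3) : ℝ :=
  ∑ i, pd i (fun y => Φ y i j) x

/-- Mean value of a matrix-valued function over the ball of radius `r`. -/
def mavg (Φ : E3 → Fin 3 → Fin 3 → ℝ) (r : ℝ) (i j : Fin 3) : ℝ :=
  (volume (ball3 r)).toReal⁻¹ * ∫ x in ball3 r, Φ x i j

/-- Frobenius norm of a 3×3 matrix. -/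
def frob (A : Fin 3 → Fin 3 → ℝ) : ℝ := Real.sqrt (∑ i, ∑ j, (A i j) ^ 2)

/-- The `s`-mean oscillation of `Φ` over the ball of radius `r`:
`(|B_r|⁻¹ ∫_{B_r} |Φ − Φ_{B_r}|^s dx)^(1/s)`. -/
def meanOsc (Φ : E3 → Fin 3 → Fin 3 → ℝ) (s r : ℝ) : ℝ :=
  ((volume (ball3 r)).toReal⁻¹ *
      ∫ x in ball3 r, (frob fun i j => Φ x i j - mavg Φ r i j) ^ s) ^ (1 / s)

/-- Smooth scalar functions on `E3`. -/
abbrev Smooth (f : E3 → ℝ) : Prop := ContDiff ℝ (⊤ : ℕ∞) f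

/-- The `i`-th standard basis vector. -/
abbrev basisVec (i : Fin 3) : E3 := EuclideanSpace.single i (1 : ℝ)

lemma Smooth.differentiableAt {f : E3 → ℝ} (hf : Smooth f) (x : E3) : DifferentiableAt ℝ f x :=
  hf.contDiffAt.differentiableAt (by simp)

lemma Smooth.pd {f : E3 → ℝ} (hf : Smooth f) (i : Fin 3) : Smooth (fun x => pd i f x) := by
  have h : ContDiff ℝ (⊤ : ℕ∞) (fderiv ℝ f) :=
    hf.fderiv_right (by norm_cast)
  exact h.clm_apply contDiff_const

lemma Smooth.one {f : E3 → ℝ} (hf : Smooth f) : ContDiff ℝ 1 f :=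
  hf.of_le (by exact_mod_cast le_top)

lemma ContDiff.continuous_pd {f : E3 → ℝ} (hf : ContDiff ℝ 1 f) (i : Fin 3) :
    Continuous (_root_.pd i f) :=
  (hf.continuous_fderiv (by simp)).clm_apply continuous_const

lemma Smooth.coord {u : E3 → E3} (hu : ContDiff ℝ (⊤ : ℕ∞) u) (j : Fin 3) :
    Smooth (fun x => u x j) :=
  (contDiff_euclidean.1 hu) j

lemma pd_add {f g : E3 → ℝ} (hf : Smooth f) (hg : Smooth g) (i : Fin 3) (x : E3) :
    pd i (fun y => f y + g y) x = pd i f x + pd i g x := by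
  simp only [pd]
  rw [fderiv_fun_add (hf.differentiableAt x) (hg.differentiableAt x)]; rfl

lemma pd_sub {f g : E3 → ℝ} (hf : Smooth f) (hg : Smooth g) (i : Fin 3) (x : E3) :
    pd i (fun y => f y - g y) x = pd i f x - pd i g x := by
  simp only [pd]
  rw [fderiv_fun_sub (hf.differentiableAt x) (hg.differentiableAt x)]; rfl

lemma pd_mul' {f g : E3 → ℝ} {x : E3} (hf : DifferentiableAt ℝ f x) (hg : DifferentiableAt ℝ g x)
    (i : Fin 3) : pd i (fun y => f y * g y) x = pd i f x * g x + f x * pd i g x := by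
  simp only [pd]
  rw [fderiv_fun_mul hf hg]
  simp; ring

lemma pd_mul {f g : E3 → ℝ} (hf : Smooth f) (hg : Smooth g) (i : Fin 3) (x : E3) :
    pd i (fun y => f y * g y) x = pd i f x * g x + f x * pd i g x :=
  pd_mul' (hf.differentiableAt x) (hg.differentiableAt x) i

lemma pd_const_mul {f : E3 → ℝ} (hf : Smooth f) (c : ℝ) (i : Fin 3) (x : E3) :
    pd i (fun y => c * f y) x = c * pd i f x := by
  simp only [pd]
  rw [fderiv_const_mul (hf.differentiableAt x)]; rfl

@[simp] lemma pd_const (c : ℝ) (i : Fin 3) (x : E3) : pd i (fun _ => c) x = 0 := by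
  simp [pd]

lemma pd_sum {ι : Type*} (s : Finset ι) {f : ι → E3 → ℝ} (hf : ∀ k, Smooth (f k)) (i : Fin 3)
    (x : E3) : pd i (fun y => ∑ k ∈ s, f k y) x = ∑ k ∈ s, pd i (f k) x := by
  simp only [pd]
  rw [fderiv_fun_sum (fun k _ => (hf k).differentiableAt x)]; simp

lemma pd_comm {f : E3 → ℝ} (hf : Smooth f) (i j : Fin 3) (x : E3) :
    pd i (fun y => pd j f y) x = pd j (fun y => pd i f y) x := by
  have h : ∀ (k l : Fin 3), pd k (fun y => pd l f y) x
      = fderiv ℝ (fderiv ℝ f) x (basisVec k) (basisVec l) := by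
    intro k l
    have hd : DifferentiableAt ℝ (fderiv ℝ f) x :=
      (hf.fderiv_right (m := (⊤ : ℕ∞)) (by norm_cast)).contDiffAt.differentiableAt (by simp)
    have : fderiv ℝ (fun y => fderiv ℝ f y (basisVec l)) x
        = (fderiv ℝ (fderiv ℝ f) x).flip (basisVec l) := by
      rw [fderiv_clm_apply hd (differentiableAt_const _)]
      simp
    simp only [pd]
    rw [this]; rfl
  rw [h, h]
  have hs : IsSymmSndFDerivAt ℝ f x := by
    apply ContDiffAt.isSymmSndFDerivAt (n := (⊤ : ℕ∞)) hf.contDiffAt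
    simp only [minSmoothness_of_isRCLikeNormedField]
    exact WithTop.coe_le_coe.2 (le_top : (2 : ℕ∞) ≤ ⊤)
  exact hs.eq _ _

/-- Derivative of a function of one coordinate. -/
lemma pd_comp_coord {g : ℝ → ℝ} (hg : ContDiff ℝ (⊤ : ℕ∞) g) (i j : Fin 3) (x : E3) :
    pd i (fun y : E3 => g (y j)) x = if i = j then deriv g (x j) else 0 := by
  have h1 : HasFDerivAt (fun y : E3 => y j) (EuclideanSpace.proj j : E3 →L[ℝ] ℝ) x :=
    (EuclideanSpace.proj j : E3 →L[ℝ] ℝ).hasFDerivAt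
  have h2 : HasDerivAt g (deriv g (x j)) (x j) :=
    (hg.contDiffAt.differentiableAt (by simp)).hasDerivAt
  have h3 := h2.comp_hasFDerivAt x h1
  have : pd i (fun y : E3 => g (y j)) x
      = (deriv g (x j) • (EuclideanSpace.proj j : E3 →L[ℝ] ℝ)) (basisVec i) := by
    simp only [pd]; rw [← h3.fderiv]; rfl
  rw [this]
  simp [eq_comm]

lemma smooth_comp_coord {g : ℝ → ℝ} (hg : ContDiff ℝ (⊤ : ℕ∞) g) (j : Fin 3) :
    Smooth (fun y : E3 => g (y j)) :=
  hg.comp (EuclideanSpace.proj j : E3 →L[ℝ] ℝ).contDiff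

/-- The closed cube of half side `r` centred at the origin. -/
def cube (r : ℝ) : Set E3 := {x | ∀ i, |x i| ≤ r}

lemma isClosed_cube (r : ℝ) : IsClosed (cube r) := by
  have : cube r = ⋂ i, {x : E3 | |x i| ≤ r} := by ext; simp [cube]
  rw [this]
  exact isClosed_iInter fun i => isClosed_le (by fun_prop) continuous_const

lemma norm_le_of_mem_cube {r : ℝ} {x : E3} (hx : x ∈ cube r) : ‖x‖ ≤ 2 * r := by
  have h0 : 0 ≤ r := (abs_nonneg _).trans (hx 0)
  rw [EuclideanSpace.norm_eq, Real.sqrt_le_left (by positivity), Fin.sum_univ_three]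
  have h : ∀ i, ‖x i‖ ^ 2 ≤ r ^ 2 := fun i => by
    have := hx i
    rw [Real.norm_eq_abs]; gcongr
  nlinarith [h 0, h 1, h 2, sq_nonneg r]

lemma isCompact_cube (r : ℝ) : IsCompact (cube r) := by
  refine (isCompact_closedBall (0 : E3) (2 * r)).of_isClosed_subset (isClosed_cube r) ?_
  intro x hx
  simpa using norm_le_of_mem_cube hx

lemma measurableSet_cube (r : ℝ) : MeasurableSet (cube r) := (isClosed_cube r).measurableSet

lemma cube_mono {r r' : ℝ} (h : r ≤ r') : cube r ⊆ cube r' := fun _ hx i => (hx i).trans h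

lemma Continuous.integrableOn_cube {f : E3 → ℝ} (hf : Continuous f) (r : ℝ) :
    IntegrableOn f (cube r) :=
  hf.continuousOn.integrableOn_compact (isCompact_cube r)

lemma setIntegral_cube_mono {f g : E3 → ℝ} (hf : Continuous f) (hg : Continuous g) {r : ℝ}
    (h : ∀ x ∈ cube r, f x ≤ g x) : ∫ x in cube r, f x ≤ ∫ x in cube r, g x :=
  setIntegral_mono_on (hf.integrableOn_cube r) (hg.integrableOn_cube r) (measurableSet_cube r) h

lemma setIntegral_cube_mono_radius {f : E3 → ℝ} (hf : Continuous f) (h0 : ∀ x, 0 ≤ f x)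
    {r r' : ℝ} (h : r ≤ r') : ∫ x in cube r, f x ≤ ∫ x in cube r', f x :=
  setIntegral_mono_set (hf.integrableOn_cube r') (ae_of_all _ h0)
    (LE.le.eventuallyLE (cube_mono h))

lemma hasCompactSupport_of_cube {f : E3 → ℝ} {r : ℝ} (h : ∀ x, x ∉ cube r → f x = 0) :
    HasCompactSupport f :=
  HasCompactSupport.intro (isCompact_cube r) h

lemma setIntegral_cube_eq_integral {f : E3 → ℝ} {r : ℝ} (h : ∀ x, x ∉ cube r → f x = 0) :
    ∫ x in cube r, f x = ∫ x, f x :=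
  setIntegral_eq_integral_of_forall_compl_eq_zero h

/-- The integral of a partial derivative of a compactly supported function vanishes. -/
lemma integral_pd_eq_zero {f : E3 → ℝ} (hf : ContDiff ℝ 1 f) {r : ℝ} (h : ∀ x, x ∉ cube r → f x = 0)
    (i : Fin 3) : ∫ x, pd i f x = 0 := by
  have hc := hasCompactSupport_of_cube h
  have h1 : Integrable (fun x => fderiv ℝ f x (basisVec i)) :=
    (hf.continuous_pd i).integrable_of_hasCompactSupport (hc.fderiv_apply (𝕜 := ℝ) _)
  have := integral_bilinear_fderiv_right_eq_neg_left_of_integrable (μ := (volume : Measure E3))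
    (f := fun _ : E3 => (1 : ℝ)) (g := f) (v := basisVec i) (B := ContinuousLinearMap.mul ℝ ℝ)
    (by simp) (by simpa using h1)
    (by simpa using hf.continuous.integrable_of_hasCompactSupport hc)
    (fun x _ => differentiableAt_const _) (fun x _ => hf.differentiable (by simp) x)
  simpa [pd] using this

lemma pd_eq_zero_of_notMem_cube {f : E3 → ℝ} {r : ℝ} (h : ∀ x, x ∉ cube r → f x = 0)
    (i : Fin 3) (x : E3) (hx : x ∉ cube r) : pd i f x = 0 := by
  have : f =ᶠ[𝓝 x] fun _ => 0 := by
    filter_upwards [(isClosed_cube r).isOpen_compl.mem_nhds hx] with y hy using h y hy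
  simp only [pd]
  rw [this.fderiv_eq]; simp

lemma integral_cube_pd_eq_zero {f : E3 → ℝ} (hf : ContDiff ℝ 1 f) {r : ℝ}
    (h : ∀ x, x ∉ cube r → f x = 0) (i : Fin 3) : ∫ x in cube r, pd i f x = 0 := by
  rw [setIntegral_cube_eq_integral (pd_eq_zero_of_notMem_cube h i), integral_pd_eq_zero hf h]

/-- If `f` is bounded by `g` plus the divergence of a field vanishing outside the cube, the same
holds for the integrals over the cube. -/
lemma setIntegral_cube_le_of_div {f g : E3 → ℝ} (hf : Continuous f) (hg : Continuous g)
    {Z : Fin 3 → E3 → ℝ} (hZ : ∀ i, ContDiff ℝ 1 (Z i)) {r : ℝ} (h0 : ∀ i x, x ∉ cube r → Z i x = 0)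
    (h : ∀ x ∈ cube r, f x ≤ g x + ∑ i, pd i (Z i) x) :
    ∫ x in cube r, f x ≤ ∫ x in cube r, g x := by
  have hc : ∀ i, Continuous (pd i (Z i)) := fun i => (hZ i).continuous_pd i
  calc ∫ x in cube r, f x ≤ ∫ x in cube r, (g x + ∑ i, pd i (Z i) x) :=
        setIntegral_cube_mono hf (by fun_prop) h
    _ = (∫ x in cube r, g x) + ∑ i, ∫ x in cube r, pd i (Z i) x := by
        rw [integral_add (hg.integrableOn_cube r)
          (Continuous.integrableOn_cube (by fun_prop) r),
          integral_finsetSum _ (fun i _ => (hc i).integrableOn_cube r)]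
    _ = ∫ x in cube r, g x := by
        rw [Finset.sum_eq_zero fun i _ => integral_cube_pd_eq_zero (hZ i) (h0 i) i, add_zero]

/-- Hölder's inequality for finitely many nonnegative integrable functions. -/
lemma integral_prod_rpow_le {α ι : Type*} [MeasurableSpace α] {μ : Measure α} [Fintype ι]
    {a : ι → α → ℝ} (ha : ∀ i, Integrable (a i) μ) (h0 : ∀ i x, 0 ≤ a i x) {p : ι → ℝ}
    (hp : ∀ i, 0 ≤ p i) (hp1 : ∑ i, p i = 1) :
    ∫ x, ∏ i, a i x ^ p i ∂μ ≤ ∏ i, (∫ x, a i x ∂μ) ^ p i := by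
  have hm : ∀ i, AEMeasurable (a i) μ := fun i => (ha i).aestronglyMeasurable.aemeasurable
  have hmeas : AEStronglyMeasurable (fun x => ∏ i, a i x ^ p i) μ :=
    (Finset.aemeasurable_fun_prod _ fun i _ => (hm i).pow_const (p i)).aestronglyMeasurable
  rw [integral_eq_lintegral_of_nonneg_ae
    (ae_of_all _ fun x => Finset.prod_nonneg fun i _ => rpow_nonneg (h0 i x) _) hmeas]
  have hH := ENNReal.lintegral_prod_norm_pow_le (μ := μ) Finset.univ
    (f := fun i x => ENNReal.ofReal (a i x)) (fun i _ => (hm i).ennreal_ofReal) hp1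
    (fun i _ => hp i)
  have hR : ∀ i, (∫⁻ x, ENNReal.ofReal (a i x) ∂μ) = ENNReal.ofReal (∫ x, a i x ∂μ) := fun i =>
    (ofReal_integral_eq_lintegral_ofReal (ha i) (ae_of_all _ (h0 i))).symm
  have hI : ∀ i, 0 ≤ ∫ x, a i x ∂μ := fun i => integral_nonneg (h0 i)
  have hL : ∀ x, ENNReal.ofReal (∏ i, a i x ^ p i) = ∏ i, ENNReal.ofReal (a i x) ^ p i := by
    intro x
    rw [ENNReal.ofReal_prod_of_nonneg fun i _ => rpow_nonneg (h0 i x) _]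
    exact Finset.prod_congr rfl fun i _ => (ENNReal.ofReal_rpow_of_nonneg (h0 i x) (hp i)).symm
  have hF : ∏ i, (∫⁻ x, ENNReal.ofReal (a i x) ∂μ) ^ p i
      = ENNReal.ofReal (∏ i, (∫ x, a i x ∂μ) ^ p i) := by
    rw [ENNReal.ofReal_prod_of_nonneg fun i _ => rpow_nonneg (hI i) _]
    refine Finset.prod_congr rfl fun i _ => ?_
    rw [hR, ENNReal.ofReal_rpow_of_nonneg (hI i) (hp i)]
  simp_rw [hL]
  rw [hF] at hH
  calc _ ≤ (ENNReal.ofReal (∏ i, (∫ x, a i x ∂μ) ^ p i)).toReal :=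
        ENNReal.toReal_mono ENNReal.ofReal_ne_top hH
    _ = _ := ENNReal.toReal_ofReal (Finset.prod_nonneg fun i _ => rpow_nonneg (hI i) _)

/-- Hölder's inequality for two functions and the cube. -/
lemma setIntegral_cube_mul_le {f g : E3 → ℝ} (hf : Continuous f) (hg : Continuous g)
    (hf0 : ∀ x, 0 ≤ f x) (hg0 : ∀ x, 0 ≤ g x) (r : ℝ) :
    ∫ x in cube r, f x * g x
      ≤ (∫ x in cube r, f x ^ 2) ^ (1 / 2 : ℝ) * (∫ x in cube r, g x ^ 2) ^ (1 / 2 : ℝ) := by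
  have := integral_prod_rpow_le (μ := volume.restrict (cube r))
    (a := ![fun x => f x ^ 2, fun x => g x ^ 2]) (p := ![1 / 2, 1 / 2])
    (by
      intro i
      fin_cases i
      · exact (hf.pow 2).integrableOn_cube r
      · exact (hg.pow 2).integrableOn_cube r)
    (by intro i x; fin_cases i <;> simp <;> positivity)
    (by intro i; fin_cases i <;> simp) (by simp [Fin.sum_univ_two]; norm_num)
  simp only [Fin.prod_univ_two, Matrix.cons_val_zero, Matrix.cons_val_one] at this
  have h : ∀ x, (f x ^ 2) ^ (1 / 2 : ℝ) * (g x ^ 2) ^ (1 / 2 : ℝ) = f x * g x := fun x => by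
    rw [← Real.sqrt_eq_rpow, ← Real.sqrt_eq_rpow, Real.sqrt_sq (hf0 x), Real.sqrt_sq (hg0 x)]
  simpa only [h] using this

/-- Hölder's inequality for four functions and the cube. -/
lemma setIntegral_cube_mul_rpow_le {f₁ f₂ f₃ f₄ : E3 → ℝ} (h₁ : Continuous f₁)
    (h₂ : Continuous f₂) (h₃ : Continuous f₃) (h₄ : Continuous f₄)
    (n₁ : ∀ x, 0 ≤ f₁ x) (n₂ : ∀ x, 0 ≤ f₂ x) (n₃ : ∀ x, 0 ≤ f₃ x) (n₄ : ∀ x, 0 ≤ f₄ x)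
    {p₁ p₂ p₃ p₄ : ℝ} (q₁ : 0 ≤ p₁) (q₂ : 0 ≤ p₂) (q₃ : 0 ≤ p₃) (q₄ : 0 ≤ p₄)
    (hp : p₁ + p₂ + p₃ + p₄ = 1) (r : ℝ) :
    ∫ x in cube r, f₁ x ^ p₁ * f₂ x ^ p₂ * f₃ x ^ p₃ * f₄ x ^ p₄
      ≤ (∫ x in cube r, f₁ x) ^ p₁ * (∫ x in cube r, f₂ x) ^ p₂
        * (∫ x in cube r, f₃ x) ^ p₃ * (∫ x in cube r, f₄ x) ^ p₄ := by
  have := integral_prod_rpow_le (μ := volume.restrict (cube r))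
    (a := ![f₁, f₂, f₃, f₄]) (p := ![p₁, p₂, p₃, p₄])
    (by
      intro i
      fin_cases i
      · exact h₁.integrableOn_cube r
      · exact h₂.integrableOn_cube r
      · exact h₃.integrableOn_cube r
      · exact h₄.integrableOn_cube r)
    (by
      intro i x
      fin_cases i
      · exact n₁ x
      · exact n₂ x
      · exact n₃ x
      · exact n₄ x)
    (by intro i; fin_cases i <;> simpa) (by simpa [Fin.sum_univ_four] using hp)
  simpa [Fin.prod_univ_four] using this

/-- The weighted average of `f` along a segment in the `i`-th coordinate direction. -/
def lineAvg (i : Fin 3) (a b : ℝ) (k : ℝ → ℝ) (f : E3 → ℝ) (x : E3) : ℝ :=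
  ∫ τ in a..b, k τ * f (x + τ • basisVec i)

lemma hasFDerivAt_lineIntegral {G : Type} [NormedAddCommGroup G] [NormedSpace ℝ G] {f : E3 → G} (hf : ContDiff ℝ 1 f) {k : ℝ → ℝ} (hk : Continuous k)
    (a b : ℝ) (e : E3) (x : E3) :
    HasFDerivAt (fun y => ∫ τ in a..b, k τ • f (y + τ • e))
      (∫ τ in a..b, k τ • fderiv ℝ f (x + τ • e)) x := by
  have hf' : Continuous (fderiv ℝ f) := hf.continuous_fderiv (by simp)
  have hfc : Continuous f := hf.continuous
  have hK : IsCompact (closedBall x 1 ×ˢ Set.uIcc a b) :=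
    (isCompact_closedBall x 1).prod isCompact_uIcc
  have hcont : Continuous fun z : E3 × ℝ => ‖k z.2 • fderiv ℝ f (z.1 + z.2 • e)‖ := by fun_prop
  obtain ⟨C, hC⟩ := (hK.image hcont).bddAbove
  refine intervalIntegral.hasFDerivAt_integral_of_dominated_of_fderiv_le
    (F := fun y τ => k τ • f (y + τ • e)) (F' := fun y τ => k τ • fderiv ℝ f (y + τ • e))
    (bound := fun _ => C) (ball_mem_nhds x one_pos) ?_ ?_ ?_ ?_ ?_ ?_
  · exact Eventually.of_forall fun y =>
      (Continuous.aestronglyMeasurable (by fun_prop))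
  · exact Continuous.intervalIntegrable (by fun_prop) _ _
  · exact (Continuous.aestronglyMeasurable (by fun_prop))
  · refine ae_of_all _ fun τ hτ y hy => ?_
    exact hC ⟨(y, τ), ⟨ball_subset_closedBall hy, Set.uIoc_subset_uIcc hτ⟩, rfl⟩
  · simp
  · refine ae_of_all _ fun τ hτ y hy => ?_
    have h1 : HasFDerivAt (fun y => f (y + τ • e)) (fderiv ℝ f (y + τ • e)) y :=
      (hasFDerivAt_comp_add_right _).2
        ((hf.differentiable (by simp)) (y + τ • e)).hasFDerivAt
    exact h1.const_smul (k τ)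

lemma contDiff_lineIntegral {k : ℝ → ℝ} (hk : Continuous k) (a b : ℝ) (e : E3) (n : ℕ) :
    ∀ {G : Type} [NormedAddCommGroup G] [NormedSpace ℝ G] [CompleteSpace G] {f : E3 → G},
      ContDiff ℝ n f → ContDiff ℝ n (fun y => ∫ τ in a..b, k τ • f (y + τ • e)) := by
  induction n with
  | zero =>
    intro G _ _ _ f hf
    have hfc : Continuous f := hf.continuous
    simp only [Nat.cast_zero, contDiff_zero]
    exact intervalIntegral.continuous_parametric_intervalIntegral_of_continuous' (by fun_prop) a b
  | succ n ih =>
    intro G _ _ _ f hf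
    have h1 : ContDiff ℝ 1 f := hf.of_le (by simp)
    rw [Nat.cast_succ, contDiff_succ_iff_fderiv] at hf ⊢
    refine ⟨fun x => (hasFDerivAt_lineIntegral h1 hk a b e x).differentiableAt, by simp, ?_⟩
    have : fderiv ℝ (fun y => ∫ τ in a..b, k τ • f (y + τ • e))
        = fun x => ∫ τ in a..b, k τ • fderiv ℝ f (x + τ • e) :=
      funext fun x => (hasFDerivAt_lineIntegral h1 hk a b e x).fderiv
    rw [this]
    exact ih hf.2.2

section LineAvg

variable {i j : Fin 3} {a b : ℝ} {k : ℝ → ℝ} {f g : E3 → ℝ}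

lemma Smooth.lineAvg (hf : Smooth f) (hk : Continuous k) (i : Fin 3) (a b : ℝ) :
    Smooth (lineAvg i a b k f) := by
  rw [Smooth, contDiff_infty]
  intro n
  exact contDiff_lineIntegral hk a b (basisVec i) n (contDiff_infty.1 hf n)

lemma pd_lineAvg (hf : Smooth f) (hk : Continuous k) (i j : Fin 3) (a b : ℝ) (x : E3) :
    pd j (lineAvg i a b k f) x = lineAvg i a b k (pd j f) x := by
  have h1 : ContDiff ℝ 1 f := hf.of_le (by exact_mod_cast le_top)
  have hf' : Continuous (fderiv ℝ f) := h1.continuous_fderiv (by simp)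
  have := (hasFDerivAt_lineIntegral h1 hk a b (basisVec i) x).fderiv
  have h2 : pd j (_root_.lineAvg i a b k f) x
      = (∫ τ in a..b, k τ • fderiv ℝ f (x + τ • basisVec i)) (basisVec j) := by
    rw [← this]; rfl
  rw [h2, ContinuousLinearMap.intervalIntegral_apply
    (Continuous.intervalIntegrable (by fun_prop) _ _)]
  rfl

lemma lineAvg_sum {ι : Type*} (s : Finset ι) {f : ι → E3 → ℝ} (hf : ∀ n, Continuous (f n))
    (hk : Continuous k) (i : Fin 3) (a b : ℝ) (x : E3) :
    lineAvg i a b k (fun y => ∑ n ∈ s, f n y) x = ∑ n ∈ s, lineAvg i a b k (f n) x := by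
  simp only [lineAvg]
  rw [← intervalIntegral.integral_finsetSum fun n _ => Continuous.intervalIntegrable
    (by have := hf n; fun_prop) _ _]
  simp only [Finset.mul_sum]

lemma hasDerivAt_line (hf : Smooth f) (i : Fin 3) (x : E3) (τ : ℝ) :
    HasDerivAt (fun τ : ℝ => f (x + τ • basisVec i)) (pd i f (x + τ • basisVec i)) τ := by
  have h1 : HasDerivAt (fun τ : ℝ => x + τ • basisVec i) (basisVec i) τ := by
    simpa using ((hasDerivAt_id τ).smul_const (basisVec i)).const_add x
  exact (hf.differentiableAt _).hasFDerivAt.comp_hasDerivAt τ h1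

/-- The fundamental theorem of calculus along a coordinate line. -/
lemma lineAvg_one_pd (hf : Smooth f) (i : Fin 3) (a b : ℝ) (x : E3) :
    lineAvg i a b (fun _ => 1) (pd i f) x = f (x + b • basisVec i) - f (x + a • basisVec i) := by
  have hc : Continuous (pd i f) := (hf.pd i).continuous
  simp only [lineAvg, one_mul]
  exact intervalIntegral.integral_eq_sub_of_hasDerivAt (fun τ _ => hasDerivAt_line hf i x τ)
    (Continuous.intervalIntegrable (by fun_prop) _ _)

/-- Integration by parts along a coordinate line. -/
lemma lineAvg_hat_pd (hf : Smooth f) (i : Fin 3) {l : ℝ} (hl : 0 < l) (x : E3) :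
    lineAvg i 0 l (fun τ => 1 - τ / l) (pd i f) x
      = lineAvg i 0 l (fun _ => l⁻¹) f x - f x := by
  have hc : Continuous (pd i f) := (hf.pd i).continuous
  have hfc : Continuous f := hf.continuous
  have h := intervalIntegral.integral_eq_sub_of_hasDerivAt (a := 0) (b := l)
    (f := fun τ => (1 - τ / l) * f (x + τ • basisVec i))
    (f' := fun τ => -l⁻¹ * f (x + τ • basisVec i) + (1 - τ / l) * pd i f (x + τ • basisVec i))
    (fun τ _ => by
      have h1 : HasDerivAt (fun τ : ℝ => 1 - τ / l) (-l⁻¹) τ := by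
        simpa using ((hasDerivAt_id τ).div_const l).const_sub 1
      exact h1.mul (hasDerivAt_line hf i x τ))
    (Continuous.intervalIntegrable (by fun_prop) _ _)
  rw [intervalIntegral.integral_add (Continuous.intervalIntegrable (by fun_prop) _ _)
    (Continuous.intervalIntegrable (by fun_prop) _ _)] at h
  have h2 : ∫ τ in (0:ℝ)..l, -l⁻¹ * f (x + τ • basisVec i)
      = - ∫ τ in (0:ℝ)..l, l⁻¹ * f (x + τ • basisVec i) := by
    rw [← intervalIntegral.integral_neg]; simp
  rw [h2, div_self hl.ne'] at h
  simp only [sub_self, zero_mul, zero_div, sub_zero, one_mul, zero_smul, add_zero] at h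
  simp only [lineAvg]
  linarith

lemma abs_lineAvg_rpow_le (hf : Continuous f) (hk : Continuous k) (hab : a ≤ b)
    {κ : ℝ} (hκ : ∀ τ ∈ Set.Icc a b, |k τ| ≤ κ) {t : ℝ} (ht : 1 ≤ t) (x : E3) :
    |lineAvg i a b k f x| ^ t
      ≤ κ ^ t * (b - a) ^ (t - 1) * ∫ τ in a..b, |f (x + τ • basisVec i)| ^ t := by
  have ht0 : 0 < t := by linarith
  have hκ0 : 0 ≤ κ := (abs_nonneg _).trans (hκ a ⟨le_rfl, hab⟩)
  have hct : Continuous fun τ : ℝ => |f (x + τ • basisVec i)| ^ t :=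
    Continuous.rpow_const (by fun_prop) fun _ => Or.inr ht0.le
  have h1 : |lineAvg i a b k f x| ≤ κ * ∫ τ in a..b, |f (x + τ • basisVec i)| := by
    rw [← intervalIntegral.integral_const_mul]
    refine (intervalIntegral.abs_integral_le_integral_abs hab).trans ?_
    refine intervalIntegral.integral_mono_on hab (Continuous.intervalIntegrable (by fun_prop) _ _)
      (Continuous.intervalIntegrable (by fun_prop) _ _) fun τ hτ => ?_
    rw [abs_mul]
    exact mul_le_mul_of_nonneg_right (hκ τ hτ) (abs_nonneg _)
  have h2 : ∫ τ in a..b, |f (x + τ • basisVec i)|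
      ≤ (∫ τ in a..b, |f (x + τ • basisVec i)| ^ t) ^ (1 / t) * (b - a) ^ (1 - 1 / t) := by
    have := integral_prod_rpow_le (μ := volume.restrict (Set.Ioc a b))
      (a := ![fun τ => |f (x + τ • basisVec i)| ^ t, fun _ => 1]) (p := ![1 / t, 1 - 1 / t])
      (by
        intro i
        fin_cases i
        · exact (hct.intervalIntegrable a b).1
        · simp)
      (by intro i τ; fin_cases i <;> simp; positivity)
      (by
        intro i
        fin_cases i
        · simp; positivity
        · simpa using inv_le_one_of_one_le₀ ht)
      (by simp)
    simp only [Fin.prod_univ_two, Matrix.cons_val_zero, Matrix.cons_val_one, one_rpow,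
      mul_one] at this
    rw [← intervalIntegral.integral_of_le hab, ← intervalIntegral.integral_of_le hab] at this
    have he : ∀ τ : ℝ, (|f (x + τ • basisVec i)| ^ t) ^ (1 / t) = |f (x + τ • basisVec i)| :=
      fun τ => by
        rw [← rpow_mul (abs_nonneg _), mul_one_div_cancel ht0.ne', rpow_one]
    simp only [he] at this
    simpa [hab] using this
  have hI : 0 ≤ ∫ τ in a..b, |f (x + τ • basisVec i)| ^ t :=
    intervalIntegral.integral_nonneg hab fun _ _ => by positivity
  have hba : 0 ≤ b - a := by linarith
  calc |lineAvg i a b k f x| ^ t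
      ≤ (κ * ((∫ τ in a..b, |f (x + τ • basisVec i)| ^ t) ^ (1 / t)
          * (b - a) ^ (1 - 1 / t))) ^ t := by
        refine rpow_le_rpow (abs_nonneg _) (h1.trans ?_) ht0.le
        gcongr
    _ = _ := by
        rw [mul_rpow hκ0 (by positivity), mul_rpow (by positivity) (by positivity),
          ← rpow_mul hI, one_div_mul_cancel ht0.ne', rpow_one, ← rpow_mul hba]
        have : (1 - 1 / t) * t = t - 1 := by field_simp
        rw [this]; ring

lemma setIntegral_cube_translate_le (hf : Continuous f) (h0 : ∀ x, 0 ≤ f x) (i : Fin 3)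
    {r r' τ : ℝ} (h : r + |τ| ≤ r') :
    ∫ x in cube r, f (x + τ • basisVec i) ≤ ∫ x in cube r', f x := by
  rw [← integral_indicator (measurableSet_cube r), ← integral_indicator (measurableSet_cube r'),
    ← integral_add_right_eq_self (μ := (volume : Measure E3)) ((cube r').indicator f)
      (τ • basisVec i)]
  have hc : Continuous fun x => f (x + τ • basisVec i) := by fun_prop
  refine integral_mono ((hc.integrableOn_cube r).integrable_indicator (measurableSet_cube r)) ?_ ?_
  · exact ((hf.integrableOn_cube r').integrable_indicator
      (measurableSet_cube r')).comp_add_right _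
  · intro x
    by_cases hx : x ∈ cube r
    · have hx' : x + τ • basisVec i ∈ cube r' := by
        intro j
        have h1 : |(τ • basisVec i : E3) j| ≤ |τ| := by
          by_cases hij : j = i <;> simp [hij]
        calc |(x + τ • basisVec i) j| ≤ |x j| + |(τ • basisVec i : E3) j| := abs_add_le _ _
          _ ≤ r' := by linarith [hx j]
      simp [Set.indicator_of_mem hx, Set.indicator_of_mem hx']
    · simp only [Set.indicator_of_notMem hx]
      exact Set.indicator_nonneg (fun _ _ => h0 _) _

/-- Line averages are bounded on `L^t`. -/
lemma setIntegral_cube_lineAvg_rpow_le (hf : Continuous f) (hk : Continuous k) (hab : a ≤ b)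
    {κ : ℝ} (hκ : ∀ τ ∈ Set.Icc a b, |k τ| ≤ κ) {t : ℝ} (ht : 1 ≤ t) {r r' : ℝ}
    (hr : ∀ τ ∈ Set.Icc a b, r + |τ| ≤ r') (i : Fin 3)  :
    ∫ x in cube r, |lineAvg i a b k f x| ^ t
      ≤ (κ * (b - a)) ^ t * ∫ x in cube r', |f x| ^ t := by
  have ht0 : 0 < t := by linarith
  have hba : 0 ≤ b - a := by linarith
  have hκ0 : 0 ≤ κ := (abs_nonneg _).trans (hκ a ⟨le_rfl, hab⟩)
  have hct : Continuous fun x => |f x| ^ t :=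
    Continuous.rpow_const (by fun_prop) fun _ => Or.inr ht0.le
  have hcl : Continuous (lineAvg i a b k f) :=
    intervalIntegral.continuous_parametric_intervalIntegral_of_continuous' (by fun_prop) a b
  have hci : Continuous fun x => ∫ τ in a..b, |f (x + τ • basisVec i)| ^ t :=
    intervalIntegral.continuous_parametric_intervalIntegral_of_continuous'
      (f := fun x τ => |f (x + τ • basisVec i)| ^ t)
      (hct.comp (g := fun x => |f x| ^ t) (f := fun z : E3 × ℝ => z.1 + z.2 • basisVec i)
        (by fun_prop)) a b
  have hswap : ∫ x in cube r, ∫ τ in a..b, |f (x + τ • basisVec i)| ^ t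
      = ∫ τ in a..b, ∫ x in cube r, |f (x + τ • basisVec i)| ^ t := by
    simp only [intervalIntegral.integral_of_le hab]
    refine integral_integral_swap ?_
    have : Continuous (fun z : E3 × ℝ => |f (z.1 + z.2 • basisVec i)| ^ t) :=
      hct.comp (g := fun x => |f x| ^ t) (f := fun z : E3 × ℝ => z.1 + z.2 • basisVec i)
        (by fun_prop)
    rw [Measure.prod_restrict]
    exact (this.continuousOn.integrableOn_compact
      ((isCompact_cube r).prod isCompact_Icc)).mono_set
      (Set.prod_mono_right Set.Ioc_subset_Icc_self)
  have hci2 : IntervalIntegrable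
      (fun τ => ∫ x in cube r, |f (x + τ • basisVec i)| ^ t) volume a b := by
    refine Continuous.intervalIntegrable ?_ _ _
    exact continuous_parametric_integral_of_continuous
      (f := fun (τ : ℝ) (x : E3) => |f (x + τ • basisVec i)| ^ t)
      (hct.comp (g := fun x => |f x| ^ t) (f := fun z : ℝ × E3 => z.2 + z.1 • basisVec i)
        (by fun_prop)) (isCompact_cube r)
  calc ∫ x in cube r, |lineAvg i a b k f x| ^ t
      ≤ ∫ x in cube r, κ ^ t * (b - a) ^ (t - 1) * ∫ τ in a..b, |f (x + τ • basisVec i)| ^ t :=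
        setIntegral_cube_mono (Continuous.rpow_const (by fun_prop) fun _ => Or.inr ht0.le)
          (by fun_prop) fun x _ => abs_lineAvg_rpow_le hf hk hab hκ ht x
    _ = κ ^ t * (b - a) ^ (t - 1) *
          ∫ τ in a..b, ∫ x in cube r, |f (x + τ • basisVec i)| ^ t := by
        rw [integral_const_mul, hswap]
    _ ≤ κ ^ t * (b - a) ^ (t - 1) * ∫ τ in a..b, ∫ x in cube r', |f x| ^ t := by
        refine mul_le_mul_of_nonneg_left ?_ (by positivity)
        refine intervalIntegral.integral_mono_on hab hci2 (by simp) fun τ hτ => ?_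
        exact setIntegral_cube_translate_le hct (fun _ => by positivity) i (hr τ hτ)
    _ = (κ * (b - a)) ^ t * ∫ x in cube r', |f x| ^ t := by
        rw [intervalIntegral.integral_const, smul_eq_mul, mul_rpow hκ0 hba]
        rcases hba.eq_or_lt with h | h
        · rw [← h, zero_rpow ht0.ne']; ring
        · have : (b - a) ^ t = (b - a) ^ (t - 1) * (b - a) := by
            rw [← rpow_add_one h.ne']; ring_nf
          rw [this]; ring

end LineAvg

/-- All derivatives of `f` up to order `n`, rescaled to length `δ`, are bounded by `c`. -/
def ScaleBound (δ : ℝ) : ℕ → ℝ → (E3 → ℝ) → Prop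
  | 0, c, f => ∀ x, |f x| ≤ c
  | n + 1, c, f => (∀ x, |f x| ≤ c) ∧ ∀ i, ScaleBound δ n c (fun x => δ * pd i f x)

namespace ScaleBound

variable {δ c c' : ℝ} {n : ℕ} {f g : E3 → ℝ}

lemma abs_le (h : ScaleBound δ n c f) (x : E3) : |f x| ≤ c := by
  cases n with
  | zero => exact h x
  | succ n => exact h.1 x

lemma mono_order (h : ScaleBound δ (n + 1) c f) : ScaleBound δ n c f := by
  induction n generalizing f with
  | zero => exact h.1
  | succ n ih => exact ⟨h.1, fun i => ih (h.2 i)⟩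

lemma mono (h : ScaleBound δ n c f) (hc : c ≤ c') : ScaleBound δ n c' f := by
  induction n generalizing f with
  | zero => exact fun x => (h x).trans hc
  | succ n ih => exact ⟨fun x => (h.1 x).trans hc, fun i => ih (h.2 i)⟩

lemma add (hf : Smooth f) (hg : Smooth g) (h : ScaleBound δ n c f) (h' : ScaleBound δ n c' g) :
    ScaleBound δ n (c + c') (fun x => f x + g x) := by
  induction n generalizing f g with
  | zero => exact fun x => (abs_add_le _ _).trans (add_le_add (h x) (h' x))
  | succ n ih =>
    refine ⟨fun x => (abs_add_le _ _).trans (add_le_add (h.1 x) (h'.1 x)), fun i => ?_⟩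
    have := ih (contDiff_const.mul (hf.pd i)) (contDiff_const.mul (hg.pd i)) (h.2 i) (h'.2 i)
    simpa only [pd_add hf hg, mul_add] using this

lemma mul (hf : Smooth f) (hg : Smooth g) (h : ScaleBound δ n c f) (h' : ScaleBound δ n c' g) :
    ScaleBound δ n (2 ^ n * (c * c')) (fun x => f x * g x) := by
  have h0 : 0 ≤ c := (abs_nonneg _).trans (h.abs_le 0)
  have h0' : 0 ≤ c' := (abs_nonneg _).trans (h'.abs_le 0)
  have hb : ∀ x, |f x * g x| ≤ c * c' := fun x => by
    rw [abs_mul]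
    exact mul_le_mul (h.abs_le x) (h'.abs_le x) (abs_nonneg _) h0
  induction n generalizing f g with
  | zero => exact fun x => by simpa using hb x
  | succ n ih =>
    refine ⟨fun x => (hb x).trans (le_mul_of_one_le_left (by positivity)
      (one_le_pow₀ (by norm_num))), fun i => ?_⟩
    have hf' : Smooth fun x => δ * pd i f x := contDiff_const.mul (hf.pd i)
    have hg' : Smooth fun x => δ * pd i g x := contDiff_const.mul (hg.pd i)
    have h1 := ih hf' hg (h.2 i) h'.mono_order fun x => by
      rw [abs_mul]
      exact mul_le_mul ((h.2 i).abs_le x) (h'.abs_le x) (abs_nonneg _) h0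
    have h2 := ih hf hg' h.mono_order (h'.2 i) fun x => by
      rw [abs_mul]
      exact mul_le_mul (h.abs_le x) ((h'.2 i).abs_le x) (abs_nonneg _) h0
    have := add (hf'.mul hg) (hf.mul hg') h1 h2
    rw [pow_succ]
    convert this using 2 with x
    · ring
    · rw [pd_mul hf hg]; ring

end ScaleBound

lemma scaleBound_comp_coord {h : ℝ → ℝ} (hs : ContDiff ℝ (⊤ : ℕ∞) h) {n : ℕ} {c : ℝ}
    (hb : ∀ k ≤ n, ∀ t, |iteratedDeriv k h t| ≤ c) {δ : ℝ} (hδ : 0 < δ) {ε : ℝ} (hε : |ε| = 1)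
    (ρ : ℝ) (j : Fin 3) :
    ScaleBound δ n c (fun x => h ((ρ + ε * x j) / δ)) := by
  induction n generalizing h with
  | zero => exact fun x => by simpa using hb 0 le_rfl _
  | succ n ih =>
    refine ⟨fun x => by simpa using hb 0 (by simp) _, fun i => ?_⟩
    have hg : ContDiff ℝ (⊤ : ℕ∞) (fun t : ℝ => h ((ρ + ε * t) / δ)) := by
      refine hs.comp ?_
      fun_prop
    have hd : ∀ t, deriv (fun t : ℝ => h ((ρ + ε * t) / δ)) t
        = deriv h ((ρ + ε * t) / δ) * (ε / δ) := fun t => by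
      have h1 : HasDerivAt (fun t : ℝ => (ρ + ε * t) / δ) (ε / δ) t := by
        simpa using (((hasDerivAt_id t).const_mul ε).const_add ρ).div_const δ
      exact ((hs.contDiffAt.differentiableAt (by simp)).hasDerivAt.comp t h1).deriv
    have h' : ContDiff ℝ (⊤ : ℕ∞) (fun t => ε * deriv h t) :=
      contDiff_const.mul ((contDiff_infty_iff_deriv.1 hs).2)
    have key : ∀ x, δ * pd i (fun x : E3 => h ((ρ + ε * x j) / δ)) x
        = if i = j then ε * deriv h ((ρ + ε * x j) / δ) else 0 := fun x => by
      rw [pd_comp_coord hg i j x, hd]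
      split_ifs
      · field_simp
      · simp
    simp only [key]
    by_cases hij : i = j
    · simp only [hij, if_true]
      refine ih h' fun k hk t => ?_
      rw [iteratedDeriv_const_mul_field, abs_mul, hε, one_mul, ← iteratedDeriv_succ']
      exact hb (k + 1) (by omega) t
    · have hc : 0 ≤ c := (abs_nonneg _).trans (hb 0 (by simp) 0)
      simp only [hij, if_false]
      clear ih hb h' key
      have : ∀ m : ℕ, ScaleBound δ m c (fun _ => 0) := fun m => by
        induction m with
        | zero => exact fun _ => by simpa
        | succ m ih => exact ⟨fun _ => by simpa, fun i => by simpa using ih⟩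
      exact this n

lemma exists_iteratedDeriv_smoothTransition_bound (n : ℕ) :
    ∃ c : ℝ, 1 ≤ c ∧ ∀ k ≤ n, ∀ t, |iteratedDeriv k smoothTransition t| ≤ c := by
  have hsm : ContDiff ℝ (⊤ : ℕ∞) smoothTransition := smoothTransition.contDiff
  have hone : ∀ k, ∃ c : ℝ, ∀ t, |iteratedDeriv k smoothTransition t| ≤ c := by
    intro k
    rcases k with _ | k
    · refine ⟨1, fun t => ?_⟩
      rw [iteratedDeriv_zero, abs_of_nonneg (smoothTransition.nonneg t)]
      exact smoothTransition.le_one t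
    · have hc : Continuous (iteratedDeriv (k + 1) smoothTransition) :=
        hsm.continuous_iteratedDeriv (k + 1) (by exact_mod_cast le_top)
      obtain ⟨C, hC⟩ := isCompact_Icc.exists_bound_of_continuousOn
        (s := Set.Icc (0 : ℝ) 1) hc.continuousOn
      have hev : ∀ {t a : ℝ}, smoothTransition =ᶠ[𝓝 t] (fun _ => a) →
          iteratedDeriv (k + 1) smoothTransition t = 0 := fun {t a} h => by
        rw [h.iteratedDeriv_eq, iteratedDeriv_const]; simp
      refine ⟨max C 0, fun t => ?_⟩
      rcases lt_or_ge t 0 with h | h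
      · rw [hev (a := 0) (by
          filter_upwards [Iio_mem_nhds h] with y hy using smoothTransition.zero_of_nonpos hy.le)]
        simp
      rcases lt_or_ge 1 t with h1 | h1
      · rw [hev (a := 1) (by
          filter_upwards [Ioi_mem_nhds h1] with y hy using smoothTransition.one_of_one_le hy.le)]
        simp
      · exact (hC t ⟨h, h1⟩).trans (le_max_left _ _)
  choose c hc using hone
  refine ⟨1 + ∑ k ∈ Finset.range (n + 1), |c k|, by
    have := Finset.sum_nonneg (s := Finset.range (n + 1)) fun k _ => abs_nonneg (c k)
    linarith, fun k hk t => ?_⟩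
  have := Finset.single_le_sum (s := Finset.range (n + 1)) (f := fun k => |c k|)
    (fun k _ => abs_nonneg (c k)) (Finset.mem_range.2 (by omega : k < n + 1))
  linarith [hc k t, le_abs_self (c k)]

/-- Smooth cutoff functions between concentric cubes, with scale invariant derivative bounds. -/
lemma exists_cutoff : ∃ c : ℝ, 1 ≤ c ∧ ∀ r ρ : ℝ, 0 < r → r < ρ → ∃ φ : E3 → ℝ,
    Smooth φ ∧ (∀ x, 0 ≤ φ x) ∧ (∀ x, φ x ≤ 1) ∧ (∀ x ∈ cube r, φ x = 1) ∧
    (∀ x, x ∉ cube ρ → φ x = 0) ∧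
    (∀ i x, |pd i φ x| ≤ c / (ρ - r)) ∧
    (∀ i j x, |pd i (pd j φ) x| ≤ c / (ρ - r) ^ 2) ∧
    (∀ i j k x, |pd i (pd j (pd k φ)) x| ≤ c / (ρ - r) ^ 3) := by
  obtain ⟨c, hc1, hc⟩ := exists_iteratedDeriv_smoothTransition_bound 3
  have hsm : ContDiff ℝ (⊤ : ℕ∞) smoothTransition := smoothTransition.contDiff
  refine ⟨2 ^ 3 * (2 ^ 3 * ((2 ^ 3 * (c * c)) * (2 ^ 3 * (c * c))) * (2 ^ 3 * (c * c))), ?_,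
    fun r ρ hr hρ => ?_⟩
  · have : 1 ≤ c * c := by nlinarith
    have h2 : 1 ≤ (c * c) * (c * c) := by nlinarith
    have h3 : 1 ≤ (c * c) * (c * c) * (c * c) := by nlinarith
    nlinarith
  set δ := ρ - r with hδ
  have hδ0 : 0 < δ := by linarith
  set σ := smoothTransition
  have hS : ∀ (ε : ℝ) (j : Fin 3), Smooth fun x : E3 => σ ((ρ + ε * x j) / δ) := fun ε j =>
    smooth_comp_coord (g := fun t => σ ((ρ + ε * t) / δ)) (hsm.comp (by fun_prop)) j
  have hB : ∀ (ε : ℝ) (j : Fin 3), |ε| = 1 →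
      ScaleBound δ 3 c fun x : E3 => σ ((ρ + ε * x j) / δ) := fun ε j hε =>
    scaleBound_comp_coord hsm hc hδ0 hε ρ j
  let χ : Fin 3 → E3 → ℝ := fun j x => σ ((ρ + 1 * x j) / δ) * σ ((ρ + -1 * x j) / δ)
  have hχS : ∀ j, Smooth (χ j) := fun j => (hS 1 j).mul (hS (-1) j)
  have hχB : ∀ j, ScaleBound δ 3 (2 ^ 3 * (c * c)) (χ j) := fun j =>
    (hB 1 j (by simp)).mul (hS 1 j) (hS (-1) j) (hB (-1) j (by simp))
  have hχ0 : ∀ j x, 0 ≤ χ j x := fun j x =>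
    mul_nonneg (smoothTransition.nonneg _) (smoothTransition.nonneg _)
  have hχ1 : ∀ j x, χ j x ≤ 1 := fun j x =>
    mul_le_one₀ (smoothTransition.le_one _) (smoothTransition.nonneg _) (smoothTransition.le_one _)
  have hχin : ∀ j (x : E3), |x j| ≤ r → χ j x = 1 := fun j x h => by
    have := abs_le.1 h
    simp only [χ]
    rw [show σ ((ρ + 1 * x j) / δ) = 1 from smoothTransition.one_of_one_le
      (by rw [le_div_iff₀ hδ0]; linarith), show σ ((ρ + -1 * x j) / δ) = 1 from
      smoothTransition.one_of_one_le (by rw [le_div_iff₀ hδ0]; linarith), one_mul]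
  have hχout : ∀ j (x : E3), ρ < |x j| → χ j x = 0 := fun j x h => by
    simp only [χ]
    rcases lt_abs.1 h with h | h
    · rw [show σ ((ρ + -1 * x j) / δ) = 0 from smoothTransition.zero_of_nonpos
        (div_nonpos_of_nonpos_of_nonneg (by linarith) hδ0.le), mul_zero]
    · rw [show σ ((ρ + 1 * x j) / δ) = 0 from smoothTransition.zero_of_nonpos
        (div_nonpos_of_nonpos_of_nonneg (by linarith) hδ0.le), zero_mul]
  set C := 2 ^ 3 * (2 ^ 3 * ((2 ^ 3 * (c * c)) * (2 ^ 3 * (c * c))) * (2 ^ 3 * (c * c)))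
  have hφS : Smooth fun x => χ 0 x * χ 1 x * χ 2 x := ((hχS 0).mul (hχS 1)).mul (hχS 2)
  have hφB : ScaleBound δ 3 C fun x => χ 0 x * χ 1 x * χ 2 x :=
    ((hχB 0).mul (hχS 0) (hχS 1) (hχB 1)).mul ((hχS 0).mul (hχS 1)) (hχS 2) (hχB 2)
  refine ⟨fun x => χ 0 x * χ 1 x * χ 2 x, hφS, fun x => mul_nonneg (mul_nonneg (hχ0 0 x) (hχ0 1 x))
    (hχ0 2 x), fun x => mul_le_one₀ (mul_le_one₀ (hχ1 0 x) (hχ0 1 x) (hχ1 1 x)) (hχ0 2 x)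
    (hχ1 2 x), fun x hx => ?_, fun x hx => ?_, fun i x => ?_, fun i j x => ?_,
    fun i j k x => ?_⟩
  · simp only [hχin 0 x (hx 0), hχin 1 x (hx 1), hχin 2 x (hx 2), mul_one]
  · have : ∃ j, ρ < |x j| := by simpa [cube] using hx
    obtain ⟨j, hj⟩ := this
    have := hχout j x hj
    fin_cases j
    · simp only [show χ 0 x = 0 from this, zero_mul]
    · simp only [show χ 1 x = 0 from this, zero_mul, mul_zero]
    · simp only [show χ 2 x = 0 from this, mul_zero]
  · have := (hφB.2 i).abs_le x
    rw [abs_mul, abs_of_pos hδ0] at this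
    rw [le_div_iff₀ hδ0]; linarith
  · have := ((hφB.2 j).2 i).abs_le x
    rw [pd_const_mul (hφS.pd j), abs_mul, abs_mul, abs_of_pos hδ0] at this
    rw [le_div_iff₀ (by positivity)]; nlinarith
  · have := (((hφB.2 k).2 j).2 i).abs_le x
    have e1 : ∀ x, δ * pd j (fun x => δ * pd k (fun x => χ 0 x * χ 1 x * χ 2 x) x) x
        = (δ * δ) * pd j (pd k (fun x => χ 0 x * χ 1 x * χ 2 x)) x := fun x => by
      rw [pd_const_mul (hφS.pd k)]; ring
    simp only [e1] at this
    rw [pd_const_mul ((hφS.pd k).pd j), abs_mul, abs_mul, abs_mul, abs_of_pos hδ0] at this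
    rw [le_div_iff₀ (by positivity)]; nlinarith

/-- Smooth functions vanishing outside the cube of half side `L`. -/
structure SuppSmooth (L : ℝ) (g : E3 → ℝ) : Prop where
  smooth : Smooth g
  zero : ∀ x, x ∉ cube L → g x = 0

namespace SuppSmooth

variable {L : ℝ} {f g : E3 → ℝ}

lemma pd (hg : SuppSmooth L g) (i : Fin 3) : SuppSmooth L (pd i g) :=
  ⟨hg.smooth.pd i, pd_eq_zero_of_notMem_cube hg.zero i⟩

lemma mul_left (hg : SuppSmooth L g) (hf : Smooth f) : SuppSmooth L (fun x => f x * g x) :=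
  ⟨hf.mul hg.smooth, fun x hx => by simp [hg.zero x hx]⟩

lemma add (hf : SuppSmooth L f) (hg : SuppSmooth L g) : SuppSmooth L (fun x => f x + g x) :=
  ⟨hf.smooth.add hg.smooth, fun x hx => by simp [hf.zero x hx, hg.zero x hx]⟩

lemma sub (hf : SuppSmooth L f) (hg : SuppSmooth L g) : SuppSmooth L (fun x => f x - g x) :=
  ⟨hf.smooth.sub hg.smooth, fun x hx => by simp [hf.zero x hx, hg.zero x hx]⟩

lemma sum {ι : Type*} (s : Finset ι) {f : ι → E3 → ℝ} (hf : ∀ n, SuppSmooth L (f n)) :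
    SuppSmooth L (fun x => ∑ n ∈ s, f n x) :=
  ⟨ContDiff.sum fun n _ => (hf n).smooth,
    fun x hx => Finset.sum_eq_zero fun n _ => (hf n).zero x hx⟩

lemma mono (hg : SuppSmooth L g) {L' : ℝ} (h : L ≤ L') : SuppSmooth L' g :=
  ⟨hg.smooth, fun x hx => hg.zero x fun h' => hx (cube_mono h h')⟩

end SuppSmooth

/-- A smooth step from `0` to `1` across the interval `[-L, L]`. -/
def stepFun (L t : ℝ) : ℝ := smoothTransition ((t + L) / (2 * L))

lemma contDiff_stepFun (L : ℝ) : ContDiff ℝ (⊤ : ℕ∞) (stepFun L) :=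
  (smoothTransition.contDiff (n := (⊤ : ℕ∞))).comp (by fun_prop)

lemma contDiff_deriv_stepFun (L : ℝ) : ContDiff ℝ (⊤ : ℕ∞) (deriv (stepFun L)) :=
  (contDiff_infty_iff_deriv.1 (contDiff_stepFun L)).2

lemma stepFun_of_lt_neg {L t : ℝ} (hL : 0 < L) (h : t < -L) : stepFun L t = 0 :=
  smoothTransition.zero_of_nonpos (div_nonpos_of_nonpos_of_nonneg (by linarith) (by linarith))

lemma stepFun_of_lt {L t : ℝ} (hL : 0 < L) (h : L < t) : stepFun L t = 1 :=
  smoothTransition.one_of_one_le (by rw [le_div_iff₀ (by linarith)]; linarith)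

lemma deriv_stepFun_eq_zero {L t : ℝ} (hL : 0 < L) (h : L < |t|) : deriv (stepFun L) t = 0 := by
  rcases lt_abs.1 h with h | h
  · have : stepFun L =ᶠ[𝓝 t] fun _ => 1 := by
      filter_upwards [Ioi_mem_nhds h] with y hy using stepFun_of_lt hL hy
    rw [this.deriv_eq]; simp
  · have : stepFun L =ᶠ[𝓝 t] fun _ => 0 := by
      filter_upwards [Iio_mem_nhds (lt_neg.1 h)] with y hy using stepFun_of_lt_neg hL hy
    rw [this.deriv_eq]; simp

lemma abs_stepFun_le_one (L t : ℝ) : |stepFun L t| ≤ 1 := by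
  rw [stepFun, abs_of_nonneg (smoothTransition.nonneg _)]
  exact smoothTransition.le_one _

lemma exists_deriv_stepFun_bound : ∃ c : ℝ, 1 ≤ c ∧ ∀ L : ℝ, 0 < L → ∀ t,
    |deriv (stepFun L) t| ≤ c / L ∧ |deriv (deriv (stepFun L)) t| ≤ c / L ^ 2 := by
  obtain ⟨c, hc1, hc⟩ := exists_iteratedDeriv_smoothTransition_bound 2
  have hsm : ContDiff ℝ (⊤ : ℕ∞) smoothTransition := smoothTransition.contDiff
  refine ⟨c, hc1, fun L hL t => ?_⟩
  have hlin : ∀ t, HasDerivAt (fun t : ℝ => (t + L) / (2 * L)) (1 / (2 * L)) t := fun t => by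
    simpa using ((hasDerivAt_id t).add_const L).div_const (2 * L)
  have h1 : deriv (stepFun L) = fun t => deriv smoothTransition ((t + L) / (2 * L))
      * (1 / (2 * L)) := by
    ext t
    exact ((hsm.contDiffAt.differentiableAt (by simp)).hasDerivAt.comp t (hlin t)).deriv
  have h2 : deriv (deriv (stepFun L)) t = deriv (deriv smoothTransition) ((t + L) / (2 * L))
      * (1 / (2 * L)) * (1 / (2 * L)) := by
    rw [h1]
    have hs' : ContDiff ℝ (⊤ : ℕ∞) (deriv smoothTransition) := (contDiff_infty_iff_deriv.1 hsm).2
    exact (((hs'.contDiffAt.differentiableAt (by simp)).hasDerivAt.comp t (hlin t)).mul_const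
      (1 / (2 * L))).deriv
  have b1 := hc 1 (by norm_num) ((t + L) / (2 * L))
  have b2 := hc 2 le_rfl ((t + L) / (2 * L))
  rw [iteratedDeriv_one] at b1
  rw [iteratedDeriv_succ, iteratedDeriv_one] at b2
  have hL2 : 1 / (2 * L) ≤ 1 / L := one_div_le_one_div_of_le hL (by linarith)
  constructor
  · rw [h1, abs_mul, abs_of_pos (by positivity : 0 < 1 / (2 * L)), div_eq_mul_one_div c]
    exact mul_le_mul b1 hL2 (by positivity) (by linarith)
  · rw [h2, abs_mul, abs_mul, abs_of_pos (by positivity : 0 < 1 / (2 * L)), mul_assoc,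
      show c / L ^ 2 = c * (1 / L * (1 / L)) by field_simp]
    gcongr

/-- Integration in the `i`-th direction followed by smooth redistribution. -/
def opK (L : ℝ) (i : Fin 3) (g : E3 → ℝ) (x : E3) : ℝ :=
  deriv (stepFun L) (x i) * lineAvg i (-(4 * L)) (4 * L) (fun _ => 1) g x

/-- The compactly supported primitive in the `i`-th direction of `g - opK L i g`. -/
def opD (L : ℝ) (i : Fin 3) (g : E3 → ℝ) (x : E3) : ℝ :=
  lineAvg i (-(4 * L)) 0 (fun _ => 1) g x
    - stepFun L (x i) * lineAvg i (-(4 * L)) (4 * L) (fun _ => 1) g x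

section Operators

variable {L : ℝ} {g : E3 → ℝ} {i j : Fin 3} {x : E3}

lemma lineAvg_eq_zero {a b : ℝ} {k : ℝ → ℝ} (hab : a ≤ b)
    (h : ∀ τ ∈ Set.Icc a b, g (x + τ • basisVec i) = 0) : lineAvg i a b k g x = 0 := by
  rw [lineAvg, intervalIntegral.integral_congr (g := fun _ => 0)]
  · simp
  · intro τ hτ
    rw [Set.uIcc_of_le hab] at hτ
    simp [h τ hτ]

lemma add_smul_basisVec_same (x : E3) (τ : ℝ) (i : Fin 3) :
    (x + τ • basisVec i) i = x i + τ := by simp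

lemma add_smul_basisVec_ne (x : E3) (τ : ℝ) {i j : Fin 3} (h : j ≠ i) :
    (x + τ • basisVec i) j = x j := by simp [h]

lemma notMem_cube_of_lt (h : L < |x i|) : x ∉ cube L := fun hx => absurd (hx i) (not_le.2 h)

lemma SuppSmooth.lineAvg_of_ne (hg : SuppSmooth L g) {a b : ℝ} {k : ℝ → ℝ} (hab : a ≤ b)
    (hij : j ≠ i) (h : L < |x j|) : lineAvg i a b k g x = 0 :=
  lineAvg_eq_zero hab fun τ _ => hg.zero _ <| notMem_cube_of_lt (i := j) <| by
    rwa [add_smul_basisVec_ne x τ hij]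

lemma SuppSmooth.opK (hL : 0 < L) (hg : SuppSmooth L g) (i : Fin 3) : SuppSmooth L (opK L i g) := by
  refine ⟨(smooth_comp_coord (contDiff_deriv_stepFun L) i).mul
    (hg.smooth.lineAvg continuous_const i _ _), fun x hx => ?_⟩
  have : ∃ j, L < |x j| := by simpa [cube] using hx
  obtain ⟨j, hj⟩ := this
  by_cases hij : j = i
  · subst hij
    simp [_root_.opK, deriv_stepFun_eq_zero hL hj]
  · simp [_root_.opK, hg.lineAvg_of_ne (k := fun _ => 1) (a := -(4 * L)) (b := 4 * L) (by linarith)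
      hij hj]

lemma SuppSmooth.opD (hL : 0 < L) (hg : SuppSmooth L g) (i : Fin 3) : SuppSmooth L (opD L i g) := by
  refine ⟨(hg.smooth.lineAvg continuous_const i _ _).sub
    ((smooth_comp_coord (contDiff_stepFun L) i).mul
    (hg.smooth.lineAvg continuous_const i _ _)), fun x hx => ?_⟩
  have : ∃ j, L < |x j| := by simpa [cube] using hx
  obtain ⟨j, hj⟩ := this
  by_cases hij : j = i
  · subst hij
    rcases lt_abs.1 hj with h | h
    · have hc : Continuous g := hg.smooth.continuous
      have h2 : lineAvg j 0 (4 * L) (fun _ => 1) g x = 0 :=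
        lineAvg_eq_zero (by linarith) fun τ hτ => hg.zero _ <| notMem_cube_of_lt (i := j) <| by
          rw [add_smul_basisVec_same]
          exact lt_abs.2 (Or.inl (by linarith [hτ.1]))
      have h3 : lineAvg j (-(4 * L)) (4 * L) (fun _ => 1) g x
          = lineAvg j (-(4 * L)) 0 (fun _ => 1) g x + lineAvg j 0 (4 * L) (fun _ => 1) g x :=
        (intervalIntegral.integral_add_adjacent_intervals
          (Continuous.intervalIntegrable (by fun_prop) _ _)
          (Continuous.intervalIntegrable (by fun_prop) _ _)).symm
      simp only [_root_.opD, stepFun_of_lt hL h, h3, h2]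
      ring
    · have h2 : lineAvg j (-(4 * L)) 0 (fun _ => 1) g x = 0 :=
        lineAvg_eq_zero (by linarith) fun τ hτ => hg.zero _ <| notMem_cube_of_lt (i := j) <| by
          rw [add_smul_basisVec_same]
          exact lt_abs.2 (Or.inr (by linarith [hτ.2]))
      simp only [_root_.opD, stepFun_of_lt_neg hL (lt_neg.1 h), h2]
      ring
  · simp [_root_.opD, hg.lineAvg_of_ne (k := fun _ => 1) (a := -(4 * L)) (b := 4 * L) (by linarith)
      hij hj, hg.lineAvg_of_ne (k := fun _ => 1) (a := -(4 * L)) (b := 0) (by linarith) hij hj]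

lemma pd_opK_of_ne (hg : Smooth g) (h : j ≠ i) (x : E3) :
    pd j (opK L i g) x = opK L i (pd j g) x := by
  have h1 := smooth_comp_coord (contDiff_deriv_stepFun L) i
  have h2 := hg.lineAvg (k := fun _ => 1) continuous_const i (-(4 * L)) (4 * L)
  have h3 : pd j (opK L i g) x = pd j (fun y => deriv (stepFun L) (y i)
    * lineAvg i (-(4 * L)) (4 * L) (fun _ => 1) g y) x := rfl
  rw [h3, pd_mul h1 h2, pd_comp_coord (contDiff_deriv_stepFun L), if_neg h,
    pd_lineAvg hg continuous_const, opK]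
  ring

lemma pd_opD_of_ne (hg : Smooth g) (h : j ≠ i) (x : E3) :
    pd j (opD L i g) x = opD L i (pd j g) x := by
  have h1 := smooth_comp_coord (contDiff_stepFun L) i
  have h2 := hg.lineAvg (k := fun _ => 1) continuous_const i (-(4 * L)) (4 * L)
  have h4 := hg.lineAvg (k := fun _ => 1) continuous_const i (-(4 * L)) 0
  have h3 : pd j (opD L i g) x = pd j (fun y => lineAvg i (-(4 * L)) 0 (fun _ => 1) g y
    - stepFun L (y i) * lineAvg i (-(4 * L)) (4 * L) (fun _ => 1) g y) x := rfl
  rw [h3, pd_sub h4 (h1.mul h2), pd_mul h1 h2, pd_comp_coord (contDiff_stepFun L), if_neg h,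
    pd_lineAvg hg continuous_const, pd_lineAvg hg continuous_const, opD]
  ring

lemma SuppSmooth.eq_zero_of_shift (hg : SuppSmooth L g) {τ : ℝ} (hτ : 4 * L ≤ |τ|) (hL : 0 < L)
    (h : |x i| ≤ L) : g (x + τ • basisVec i) = 0 := by
  refine hg.zero _ (notMem_cube_of_lt (i := i) ?_)
  rw [add_smul_basisVec_same]
  have := abs_sub_abs_le_abs_sub τ (-x i)
  rw [abs_neg, sub_neg_eq_add, add_comm τ] at this
  linarith

/-- `opK` annihilates derivatives in its own direction. -/
lemma opK_pd_same (hL : 0 < L) (hg : SuppSmooth L g) (i : Fin 3) (x : E3) :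
    opK L i (pd i g) x = 0 := by
  rw [opK, lineAvg_one_pd hg.smooth]
  rcases lt_or_ge L |x i| with h | h
  · rw [deriv_stepFun_eq_zero hL h, zero_mul]
  · rw [hg.eq_zero_of_shift (by rw [abs_of_pos (by linarith)]) hL h,
      hg.eq_zero_of_shift (by rw [abs_neg, abs_of_pos (by linarith)]) hL h]
    simp

lemma pd_opK_same (hL : 0 < L) (hg : SuppSmooth L g) (i : Fin 3) (x : E3) :
    pd i (opK L i g) x = deriv (deriv (stepFun L)) (x i)
      * lineAvg i (-(4 * L)) (4 * L) (fun _ => 1) g x := by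
  have h1 := smooth_comp_coord (contDiff_deriv_stepFun L) i
  have h2 := hg.smooth.lineAvg (k := fun _ => 1) continuous_const i (-(4 * L)) (4 * L)
  have h3 : pd i (opK L i g) x = pd i (fun y => deriv (stepFun L) (y i)
    * lineAvg i (-(4 * L)) (4 * L) (fun _ => 1) g y) x := rfl
  have h4 := opK_pd_same hL hg i x
  rw [opK] at h4
  rw [h3, pd_mul h1 h2, pd_comp_coord (contDiff_deriv_stepFun L), if_pos rfl,
    pd_lineAvg hg.smooth continuous_const, h4, add_zero]

lemma pd_opD_same (hL : 0 < L) (hg : SuppSmooth L g) (i : Fin 3) (x : E3) :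
    pd i (opD L i g) x = g x - opK L i g x := by
  by_cases hx : x ∈ cube L
  · have h1 := smooth_comp_coord (contDiff_stepFun L) i
    have h2 := hg.smooth.lineAvg (k := fun _ => 1) continuous_const i (-(4 * L)) (4 * L)
    have h4 := hg.smooth.lineAvg (k := fun _ => 1) continuous_const i (-(4 * L)) 0
    have h3 : pd i (opD L i g) x = pd i (fun y => lineAvg i (-(4 * L)) 0 (fun _ => 1) g y
      - stepFun L (y i) * lineAvg i (-(4 * L)) (4 * L) (fun _ => 1) g y) x := rfl
    rw [h3, pd_sub h4 (h1.mul h2), pd_mul h1 h2, pd_comp_coord (contDiff_stepFun L), if_pos rfl,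
      pd_lineAvg hg.smooth continuous_const, pd_lineAvg hg.smooth continuous_const, opK,
      lineAvg_one_pd hg.smooth, lineAvg_one_pd hg.smooth,
      hg.eq_zero_of_shift (τ := 4 * L) (by rw [abs_of_pos (by linarith)]) hL (hx i),
      hg.eq_zero_of_shift (τ := -(4 * L)) (by rw [abs_neg, abs_of_pos (by linarith)]) hL (hx i)]
    simp
  · rw [((hg.opD hL i).pd i).zero x hx, hg.zero x hx, (hg.opK hL i).zero x hx, sub_zero]

/-- A right inverse of the divergence on functions supported in a cube, modulo `opK`. -/
def opB (L : ℝ) (g : E3 → ℝ) : Fin 3 → E3 → ℝ :=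
  ![opD L 0 g, opD L 1 (opK L 0 g), opD L 2 (opK L 1 (opK L 0 g))]

lemma SuppSmooth.opB (hL : 0 < L) (hg : SuppSmooth L g) (i : Fin 3) :
    SuppSmooth L (opB L g i) := by
  fin_cases i
  · exact hg.opD hL 0
  · exact (hg.opK hL 0).opD hL 1
  · exact ((hg.opK hL 0).opK hL 1).opD hL 2

lemma opK_add {f : E3 → ℝ} (hf : Continuous f) (hg : Continuous g) (i : Fin 3) (x : E3) :
    opK L i (fun y => f y + g y) x = opK L i f x + opK L i g x := by
  have : lineAvg i (-(4 * L)) (4 * L) (fun _ => 1) (fun y => f y + g y) x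
      = lineAvg i (-(4 * L)) (4 * L) (fun _ => 1) f x
        + lineAvg i (-(4 * L)) (4 * L) (fun _ => 1) g x := by
    simp only [lineAvg]
    rw [← intervalIntegral.integral_add (Continuous.intervalIntegrable (by fun_prop) _ _)
      (Continuous.intervalIntegrable (by fun_prop) _ _)]
    simp only [mul_add]
  simp only [opK, this]
  ring

lemma sum_pd_opB (hL : 0 < L) {G : Fin 3 → E3 → ℝ} (hG : ∀ i, SuppSmooth L (G i)) (x : E3) :
    ∑ i, pd i (opB L (fun y => ∑ i, pd i (G i) y) i) x = ∑ i, pd i (G i) x := by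
  have hg : SuppSmooth L (fun y => ∑ i, pd i (G i) y) := SuppSmooth.sum _ fun i => (hG i).pd i
  have e0 : opK L 0 (fun y => ∑ i, pd i (G i) y)
      = fun x => pd 1 (opK L 0 (G 1)) x + pd 2 (opK L 0 (G 2)) x := by
    ext x
    have h0 := (hG 0).smooth.pd 0 |>.continuous
    have h1 := (hG 1).smooth.pd 1 |>.continuous
    have h2 := (hG 2).smooth.pd 2 |>.continuous
    simp only [Fin.sum_univ_three]
    rw [opK_add (f := fun y => pd 0 (G 0) y + pd 1 (G 1) y) (h0.add h1) h2, opK_add h0 h1, opK_pd_same hL (hG 0),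
      pd_opK_of_ne (hG 1).smooth (by decide), pd_opK_of_ne (hG 2).smooth (by decide), zero_add]
  have e1 : opK L 1 (opK L 0 (fun y => ∑ i, pd i (G i) y))
      = pd 2 (opK L 1 (opK L 0 (G 2))) := by
    ext x
    have h1 := ((hG 1).opK hL 0).smooth.pd 1 |>.continuous
    have h2 := ((hG 2).opK hL 0).smooth.pd 2 |>.continuous
    rw [e0, opK_add h1 h2, opK_pd_same hL ((hG 1).opK hL 0),
      pd_opK_of_ne ((hG 2).opK hL 0).smooth (by decide), zero_add]
  have e2 : opK L 2 (opK L 1 (opK L 0 (fun y => ∑ i, pd i (G i) y))) x = 0 := by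
    rw [e1, opK_pd_same hL (((hG 2).opK hL 0).opK hL 1)]
  rw [Fin.sum_univ_three]
  simp only [opB, Matrix.cons_val_zero, Matrix.cons_val_one, Matrix.cons_val]
  rw [pd_opD_same hL hg, pd_opD_same hL (hg.opK hL 0), pd_opD_same hL ((hg.opK hL 0).opK hL 1),
    e2]
  ring

/-- Scale invariant `W^{1,t}` energy on a cube. -/
def sobEnergy (t L : ℝ) (g : E3 → ℝ) : ℝ :=
  L ^ t * (∑ k, ∫ x in cube L, |pd k g x| ^ t) + ∫ x in cube L, |g x| ^ t

lemma abs_sub_rpow_le {t : ℝ} (ht : 0 ≤ t) (a b : ℝ) :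
    |a - b| ^ t ≤ 2 ^ t * (|a| ^ t + |b| ^ t) := by
  have h1 : |a - b| ≤ 2 * max |a| |b| := by
    have := abs_sub a b
    linarith [le_max_left |a| |b|, le_max_right |a| |b|]
  calc |a - b| ^ t ≤ (2 * max |a| |b|) ^ t := rpow_le_rpow (abs_nonneg _) h1 ht
    _ = 2 ^ t * (max |a| |b|) ^ t := mul_rpow (by norm_num) (by positivity)
    _ ≤ _ := by
        gcongr
        rcases le_total |a| |b| with h | h
        · rw [max_eq_right h]; linarith [rpow_nonneg (abs_nonneg a) t]
        · rw [max_eq_left h]; linarith [rpow_nonneg (abs_nonneg b) t]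

lemma Continuous.abs_rpow {f : E3 → ℝ} (hf : Continuous f) {t : ℝ} (ht : 0 ≤ t) :
    Continuous fun x => |f x| ^ t :=
  Continuous.rpow_const (by fun_prop) fun _ => Or.inr ht

lemma setIntegral_cube_abs_rpow_nonneg (f : E3 → ℝ) (t r : ℝ) :
    0 ≤ ∫ x in cube r, |f x| ^ t :=
  integral_nonneg fun _ => by positivity

lemma SuppSmooth.setIntegral_rpow_eq (hg : SuppSmooth L g) {t : ℝ} (ht : 0 < t) {r : ℝ}
    (h : L ≤ r) : ∫ x in cube r, |g x| ^ t = ∫ x in cube L, |g x| ^ t := by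
  have hz : ∀ x, x ∉ cube L → |g x| ^ t = 0 := fun x hx => by
    rw [hg.zero x hx, abs_zero, zero_rpow ht.ne']
  rw [setIntegral_cube_eq_integral hz, setIntegral_cube_eq_integral fun x hx => hz x fun h' =>
    hx (cube_mono h h')]

lemma SuppSmooth.setIntegral_lineAvg_le (hL : 0 < L) (hg : SuppSmooth L g) {t : ℝ} (ht : 1 ≤ t)
    {a b : ℝ} (ha : -(4 * L) ≤ a) (hab : a ≤ b) (hb : b ≤ 4 * L) (i : Fin 3) :
    ∫ x in cube L, |lineAvg i a b (fun _ => 1) g x| ^ t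
      ≤ (8 * L) ^ t * ∫ x in cube L, |g x| ^ t := by
  rw [← hg.setIntegral_rpow_eq (by linarith) (by linarith : L ≤ 5 * L)]
  refine (setIntegral_cube_lineAvg_rpow_le (r' := 5 * L) (κ := 1) hg.smooth.continuous
    continuous_const hab (by simp) ht (fun τ hτ => ?_) i).trans ?_
  · have : |τ| ≤ 4 * L := abs_le.2 ⟨ha.trans hτ.1, hτ.2.trans hb⟩
    linarith
  · refine mul_le_mul_of_nonneg_right ?_ (setIntegral_cube_abs_rpow_nonneg _ _ _)
    exact rpow_le_rpow (by linarith) (by linarith) (by linarith)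

lemma setIntegral_cube_mul_rpow_le_of_bound {f h : E3 → ℝ} (hf : Continuous f)
    (hh : Continuous h) {c t : ℝ} (hb : ∀ x, |h x| ≤ c) (ht : 0 ≤ t) (r : ℝ) :
    ∫ x in cube r, |h x * f x| ^ t ≤ c ^ t * ∫ x in cube r, |f x| ^ t := by
  rw [← integral_const_mul]
  refine setIntegral_cube_mono ((hh.mul hf).abs_rpow ht)
    (continuous_const.mul (hf.abs_rpow ht)) fun x _ => ?_
  change |h x * f x| ^ t ≤ c ^ t * |f x| ^ t
  rw [abs_mul, mul_rpow (abs_nonneg _) (abs_nonneg _)]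
  gcongr
  exact hb x

lemma setIntegral_cube_sub_rpow_le {f h : E3 → ℝ} (hf : Continuous f)
    (hh : Continuous h) {t : ℝ} (ht : 0 ≤ t) (r : ℝ) :
    ∫ x in cube r, |f x - h x| ^ t
      ≤ 2 ^ t * ((∫ x in cube r, |f x| ^ t) + ∫ x in cube r, |h x| ^ t) := by
  rw [← integral_add ((hf.abs_rpow ht).integrableOn_cube r) ((hh.abs_rpow ht).integrableOn_cube r),
    ← integral_const_mul]
  have h1 := hf.abs_rpow ht
  have h2 := hh.abs_rpow ht
  exact setIntegral_cube_mono ((hf.sub hh).abs_rpow ht) (by fun_prop) fun x _ =>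
    abs_sub_rpow_le ht _ _

lemma exists_op_bounds {t : ℝ} (ht : 1 ≤ t) : ∃ C : ℝ, 1 ≤ C ∧ ∀ L : ℝ, 0 < L → ∀ g,
    SuppSmooth L g → ∀ i,
      (∫ x in cube L, |opK L i g x| ^ t ≤ C * ∫ x in cube L, |g x| ^ t) ∧
      (∫ x in cube L, |pd i (opK L i g) x| ^ t ≤ C / L ^ t * ∫ x in cube L, |g x| ^ t) ∧
      (∫ x in cube L, |opD L i g x| ^ t ≤ C * L ^ t * ∫ x in cube L, |g x| ^ t) := by
  have ht0 : 0 < t := by linarith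
  obtain ⟨c, hc1, hc⟩ := exists_deriv_stepFun_bound
  have hC0 : 1 ≤ (8 * c) ^ t := one_le_rpow (by linarith) ht0.le
  have h1t : (1 : ℝ) ≤ 2 ^ t := one_le_rpow (by norm_num) ht0.le
  refine ⟨2 ^ t * (2 * (8 * c) ^ t), by nlinarith, fun L hL g hg i => ?_⟩
  have hI := setIntegral_cube_abs_rpow_nonneg g t L
  have hJ := hg.setIntegral_lineAvg_le hL ht le_rfl (by linarith : -(4 * L) ≤ 4 * L) le_rfl i
  have hP := hg.setIntegral_lineAvg_le hL ht le_rfl (by linarith : -(4 * L) ≤ 0) (by linarith) i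
  have hJc := (hg.smooth.lineAvg (k := fun _ => 1) continuous_const i (-(4 * L))
    (4 * L)).continuous
  have hPc := (hg.smooth.lineAvg (k := fun _ => 1) continuous_const i (-(4 * L)) 0).continuous
  have hψ := (smooth_comp_coord (contDiff_deriv_stepFun L) i).continuous
  have hψ' := (smooth_comp_coord ((contDiff_infty_iff_deriv.1 (contDiff_deriv_stepFun L)).2)
    i).continuous
  have hH := (smooth_comp_coord (contDiff_stepFun L) i).continuous
  have hbig : (8 * c) ^ t ≤ 2 ^ t * (2 * (8 * c) ^ t) := by nlinarith
  refine ⟨?_, ?_, ?_⟩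
  · calc _ ≤ (c / L) ^ t * ((8 * L) ^ t * ∫ x in cube L, |g x| ^ t) :=
          (setIntegral_cube_mul_rpow_le_of_bound hJc hψ (fun x => (hc L hL (x i)).1) ht0.le L).trans
            (by gcongr)
      _ = (8 * c) ^ t * ∫ x in cube L, |g x| ^ t := by
          rw [← mul_assoc, ← mul_rpow (by positivity) (by positivity)]
          congr 2; field_simp
      _ ≤ _ := by gcongr
  · simp only [pd_opK_same hL hg]
    calc _ ≤ (c / L ^ 2) ^ t * ((8 * L) ^ t * ∫ x in cube L, |g x| ^ t) :=
          (setIntegral_cube_mul_rpow_le_of_bound hJc hψ' (fun x => (hc L hL (x i)).2)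
            ht0.le L).trans (by gcongr)
      _ = (8 * c) ^ t / L ^ t * ∫ x in cube L, |g x| ^ t := by
          rw [← mul_assoc, ← mul_rpow (by positivity) (by positivity),
            ← div_rpow (by positivity) (by positivity)]
          congr 2; field_simp
      _ ≤ _ := by gcongr
  · have h1 := setIntegral_cube_mul_rpow_le_of_bound hJc hH (fun x => abs_stepFun_le_one L (x i))
      ht0.le L
    rw [one_rpow, one_mul] at h1
    calc _ ≤ 2 ^ t * ((8 * L) ^ t * (∫ x in cube L, |g x| ^ t)
            + (8 * L) ^ t * ∫ x in cube L, |g x| ^ t) :=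
          (setIntegral_cube_sub_rpow_le hPc (hH.mul hJc) ht0.le L).trans
            (by gcongr; exact h1.trans hJ)
      _ = 2 ^ t * (2 * 8 ^ t) * L ^ t * ∫ x in cube L, |g x| ^ t := by
          rw [mul_rpow (by norm_num) hL.le]; ring
      _ ≤ _ := by
          gcongr
          linarith

lemma sobEnergy_nonneg {t : ℝ} (hL : 0 < L) (g : E3 → ℝ) : 0 ≤ sobEnergy t L g :=
  add_nonneg (mul_nonneg (by positivity) (Finset.sum_nonneg fun k _ =>
    setIntegral_cube_abs_rpow_nonneg (pd k g) t L)) (setIntegral_cube_abs_rpow_nonneg g t L)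

lemma le_sobEnergy {t : ℝ} (hL : 0 < L) (g : E3 → ℝ) :
    ∫ x in cube L, |g x| ^ t ≤ sobEnergy t L g :=
  le_add_of_nonneg_left (mul_nonneg (by positivity) (Finset.sum_nonneg fun k _ =>
    setIntegral_cube_abs_rpow_nonneg (pd k g) t L))

lemma pd_le_sobEnergy {t : ℝ} (hL : 0 < L) (g : E3 → ℝ) (k : Fin 3) :
    L ^ t * ∫ x in cube L, |pd k g x| ^ t ≤ sobEnergy t L g := by
  have h1 := Finset.single_le_sum (f := fun k => ∫ x in cube L, |pd k g x| ^ t)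
    (fun k _ => setIntegral_cube_abs_rpow_nonneg (pd k g) t L) (Finset.mem_univ k)
  have := setIntegral_cube_abs_rpow_nonneg g t L
  rw [sobEnergy]
  nlinarith [rpow_pos_of_pos hL t]

lemma exists_opB_bounds {t : ℝ} (ht : 1 ≤ t) : ∃ C : ℝ, 1 ≤ C ∧ ∀ L : ℝ, 0 < L → ∀ g,
    SuppSmooth L g → ∀ i,
      (∫ x in cube L, |opB L g i x| ^ t ≤ C * L ^ t * ∫ x in cube L, |g x| ^ t) ∧
      (∀ k, ∫ x in cube L, |pd k (opB L g i) x| ^ t ≤ C * sobEnergy t L g) := by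
  have ht0 : 0 < t := by linarith
  obtain ⟨C, hC1, hC⟩ := exists_op_bounds ht
  have h1t : (1 : ℝ) ≤ 2 ^ t := one_le_rpow (by norm_num) ht0.le
  have hK : ∀ L : ℝ, 0 < L → ∀ g, SuppSmooth L g → ∀ i,
      sobEnergy t L (opK L i g) ≤ 4 * C * sobEnergy t L g := fun L hL g hg i => by
    have hLt := rpow_pos_of_pos hL t
    have hk : ∀ k, L ^ t * ∫ x in cube L, |pd k (opK L i g) x| ^ t ≤ C * sobEnergy t L g := by
      intro k
      by_cases hki : k = i
      · subst hki
        calc _ ≤ L ^ t * (C / L ^ t * ∫ x in cube L, |g x| ^ t) := by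
              gcongr; exact (hC L hL g hg k).2.1
          _ = C * ∫ x in cube L, |g x| ^ t := by field_simp
          _ ≤ _ := by gcongr; exact le_sobEnergy hL g
      · simp only [pd_opK_of_ne hg.smooth hki]
        calc _ ≤ L ^ t * (C * ∫ x in cube L, |pd k g x| ^ t) := by
              gcongr; exact (hC L hL _ (hg.pd k) i).1
          _ = C * (L ^ t * ∫ x in cube L, |pd k g x| ^ t) := by ring
          _ ≤ _ := by gcongr; exact pd_le_sobEnergy hL g k
    have h0 : ∫ x in cube L, |opK L i g x| ^ t ≤ C * sobEnergy t L g :=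
      (hC L hL g hg i).1.trans (by gcongr; exact le_sobEnergy hL g)
    rw [sobEnergy, Fin.sum_univ_three]
    linarith [hk 0, hk 1, hk 2]
  have hD : ∀ L : ℝ, 0 < L → ∀ g, SuppSmooth L g → ∀ i k,
      ∫ x in cube L, |pd k (opD L i g) x| ^ t ≤ 2 ^ t * (2 * C) * sobEnergy t L g :=
      fun L hL g hg i k => by
    have hE := sobEnergy_nonneg (t := t) hL g
    by_cases hki : k = i
    · subst hki
      simp only [pd_opD_same hL hg]
      calc _ ≤ 2 ^ t * ((∫ x in cube L, |g x| ^ t) + ∫ x in cube L, |opK L k g x| ^ t) :=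
            setIntegral_cube_sub_rpow_le hg.smooth.continuous (hg.opK hL k).smooth.continuous
              ht0.le L
        _ ≤ 2 ^ t * (C * sobEnergy t L g + C * sobEnergy t L g) := by
            have h1 := le_sobEnergy (t := t) hL g
            gcongr
            · nlinarith
            · exact (hC L hL g hg k).1.trans (by gcongr)
        _ = _ := by ring
    · simp only [pd_opD_of_ne hg.smooth hki]
      calc _ ≤ C * L ^ t * ∫ x in cube L, |pd k g x| ^ t := (hC L hL _ (hg.pd k) i).2.2
        _ = C * (L ^ t * ∫ x in cube L, |pd k g x| ^ t) := by ring
        _ ≤ C * sobEnergy t L g := by gcongr; exact pd_le_sobEnergy hL g k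
        _ ≤ _ := by
            gcongr
            nlinarith
  set A := 2 ^ t * (2 * C)
  have hA : 1 ≤ A := by
    have : 1 ≤ 2 ^ t * C := by nlinarith
    simp only [A]; nlinarith
  have hA0 : 0 ≤ A := by linarith
  have hCA : C ≤ A := by simp only [A]; nlinarith
  refine ⟨A * (4 * C) * (4 * C), by nlinarith [mul_le_mul hC1 hC1 zero_le_one (by linarith)],
    fun L hL g hg i => ?_⟩
  have hI := setIntegral_cube_abs_rpow_nonneg g t L
  have hE := sobEnergy_nonneg (t := t) hL g
  have hLt := rpow_pos_of_pos hL t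
  have hb0 := (hC L hL g hg 0).1
  have hb1 := (hC L hL _ (hg.opK hL 0) 1).1
  have he0 := hK L hL g hg 0
  have he1 := hK L hL _ (hg.opK hL 0) 1
  have c1 : 1 ≤ 4 * C := by linarith
  have c2 : 1 ≤ 4 * C * (4 * C) := by nlinarith
  have key1 : ∀ g' : E3 → ℝ, SuppSmooth L g' →
      ∫ x in cube L, |g' x| ^ t ≤ 4 * C * (4 * C) * ∫ x in cube L, |g x| ^ t → ∀ i,
      ∫ x in cube L, |opD L i g' x| ^ t
        ≤ A * (4 * C) * (4 * C) * L ^ t * ∫ x in cube L, |g x| ^ t := fun g' hg' h i => by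
    calc _ ≤ C * L ^ t * ∫ x in cube L, |g' x| ^ t := (hC L hL g' hg' i).2.2
      _ ≤ A * L ^ t * (4 * C * (4 * C) * ∫ x in cube L, |g x| ^ t) := by gcongr
      _ = _ := by ring
  have key2 : ∀ g' : E3 → ℝ, SuppSmooth L g' →
      sobEnergy t L g' ≤ 4 * C * (4 * C) * sobEnergy t L g → ∀ i k,
      ∫ x in cube L, |pd k (opD L i g') x| ^ t
        ≤ A * (4 * C) * (4 * C) * sobEnergy t L g := fun g' hg' h i k => by
    calc _ ≤ A * sobEnergy t L g' := hD L hL g' hg' i k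
      _ ≤ A * (4 * C * (4 * C) * sobEnergy t L g) := by gcongr
      _ = _ := by ring
  have i0 : ∫ x in cube L, |opK L 0 g x| ^ t ≤ 4 * C * ∫ x in cube L, |g x| ^ t :=
    hb0.trans (by gcongr; linarith)
  have i1 : ∫ x in cube L, |opK L 1 (opK L 0 g) x| ^ t
      ≤ 4 * C * (4 * C) * ∫ x in cube L, |g x| ^ t := by
    rw [mul_assoc]
    refine hb1.trans ?_
    gcongr
    linarith
  fin_cases i
  · exact ⟨key1 g hg (le_mul_of_one_le_left hI c2) 0, key2 g hg (le_mul_of_one_le_left hE c2) 0⟩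
  · exact ⟨key1 _ (hg.opK hL 0) (i0.trans (mul_le_mul_of_nonneg_right (by nlinarith) hI)) 1,
      key2 _ (hg.opK hL 0) (he0.trans (mul_le_mul_of_nonneg_right (by nlinarith) hE)) 1⟩
  · refine ⟨key1 _ ((hg.opK hL 0).opK hL 1) i1 2, key2 _ ((hg.opK hL 0).opK hL 1) ?_ 2⟩
    rw [mul_assoc]
    exact he1.trans (by gcongr)

end Operators

lemma abs_sum_rpow_le {ι : Type*} [Fintype ι] (a : ι → ℝ) {t : ℝ} (ht : 1 ≤ t) :
    |∑ n, a n| ^ t ≤ (Fintype.card ι : ℝ) ^ t * ∑ n, |a n| ^ t := by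
  rcases isEmpty_or_nonempty ι with h | h
  · simp [zero_rpow (by linarith : t ≠ 0)]
  · have h1 := Real.rpow_sum_le_const_mul_sum_rpow Finset.univ a ht
    have hc : (1 : ℝ) ≤ Fintype.card ι := by exact_mod_cast Fintype.card_pos
    calc |∑ n, a n| ^ t ≤ (∑ n, |a n|) ^ t :=
          rpow_le_rpow (abs_nonneg _) (Finset.abs_sum_le_sum_abs _ _) (by linarith)
      _ ≤ (Fintype.card ι : ℝ) ^ (t - 1) * ∑ n, |a n| ^ t := h1
      _ ≤ _ := by
          gcongr
          linarith

lemma setIntegral_cube_sum_rpow_le {ι : Type*} [Fintype ι] {f : ι → E3 → ℝ}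
    (hf : ∀ n, Continuous (f n)) {t : ℝ} (ht : 1 ≤ t) (r : ℝ) :
    ∫ x in cube r, |∑ n, f n x| ^ t
      ≤ (Fintype.card ι : ℝ) ^ t * ∑ n, ∫ x in cube r, |f n x| ^ t := by
  have ht0 : 0 ≤ t := by linarith
  rw [← integral_finsetSum _ fun n _ => ((hf n).abs_rpow ht0).integrableOn_cube r,
    ← integral_const_mul]
  exact setIntegral_cube_mono ((continuous_finsetSum _ fun n _ => hf n).abs_rpow ht0)
    (continuous_const.mul (continuous_finsetSum _ fun n _ => (hf n).abs_rpow ht0))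
    fun x _ => abs_sum_rpow_le _ ht

/-- The total `L^t` energy of a matrix field on a cube. -/
def matEnergy (t L : ℝ) (F : Fin 3 → Fin 3 → E3 → ℝ) : ℝ :=
  ∑ i, ∑ j, ∫ x in cube L, |F i j x| ^ t

/-- The total `L^t` energy of the gradient of a matrix field on a cube. -/
def matGradEnergy (t L : ℝ) (F : Fin 3 → Fin 3 → E3 → ℝ) : ℝ :=
  ∑ i, ∑ j, ∑ k, ∫ x in cube L, |pd k (F i j) x| ^ t

/-- The compactly supported corrector built from a potential `F` and a cutoff `φ`. -/
def opV (L : ℝ) (φ : E3 → ℝ) (F : Fin 3 → Fin 3 → E3 → ℝ) (i : Fin 3) (x : E3) : ℝ :=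
  (∑ j, F i j x * pd j φ x)
    - opB L (fun y => ∑ i, ∑ j, F i j y * pd i (pd j φ) y) i x

section OpV

variable {L : ℝ} {φ : E3 → ℝ} {F : Fin 3 → Fin 3 → E3 → ℝ}

lemma matEnergy_nonneg (t L : ℝ) (F : Fin 3 → Fin 3 → E3 → ℝ) : 0 ≤ matEnergy t L F :=
  Finset.sum_nonneg fun _ _ => Finset.sum_nonneg fun _ _ => setIntegral_cube_abs_rpow_nonneg _ _ _

lemma matGradEnergy_nonneg (t L : ℝ) (F : Fin 3 → Fin 3 → E3 → ℝ) : 0 ≤ matGradEnergy t L F :=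
  Finset.sum_nonneg fun _ _ => Finset.sum_nonneg fun _ _ => Finset.sum_nonneg fun _ _ =>
    setIntegral_cube_abs_rpow_nonneg _ _ _

lemma suppSmooth_hessian_term (hφ : SuppSmooth L φ) (hF : ∀ i j, Smooth (F i j)) :
    SuppSmooth L (fun y => ∑ i, ∑ j, F i j y * pd i (pd j φ) y) :=
  SuppSmooth.sum _ fun i => SuppSmooth.sum _ fun j => ((hφ.pd j).pd i).mul_left (hF i j)

lemma suppSmooth_grad_term (hφ : SuppSmooth L φ) (hF : ∀ i j, Smooth (F i j)) (i : Fin 3) :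
    SuppSmooth L (fun y => ∑ j, F i j y * pd j φ y) :=
  SuppSmooth.sum _ fun j => (hφ.pd j).mul_left (hF i j)

lemma SuppSmooth.opV (hL : 0 < L) (hφ : SuppSmooth L φ) (hF : ∀ i j, Smooth (F i j)) (i : Fin 3) :
    SuppSmooth L (opV L φ F i) :=
  (suppSmooth_grad_term hφ hF i).sub ((suppSmooth_hessian_term hφ hF).opB hL i)

/-- The divergence of the corrector. -/
lemma sum_pd_opV (hL : 0 < L) (hφ : SuppSmooth L φ) (hF : ∀ i j, Smooth (F i j))
    {f : Fin 3 → E3 → ℝ} (hf : ∀ j, Smooth (f j)) (hdiv : ∀ j x, ∑ i, pd i (F i j) x = f j x)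
    (hf0 : ∀ x, ∑ j, pd j (f j) x = 0) (x : E3) :
    ∑ i, pd i (opV L φ F i) x = ∑ j, f j x * pd j φ x := by
  let G : Fin 3 → E3 → ℝ := fun i y => (∑ j, F i j y * pd j φ y) - f i y * φ y
  have hG : ∀ i, SuppSmooth L (G i) := fun i =>
    (suppSmooth_grad_term hφ hF i).sub (hφ.mul_left (hf i))
  have hpd : ∀ i x, pd i (fun y => ∑ j, F i j y * pd j φ y) x
      = ∑ j, (pd i (F i j) x * pd j φ x + F i j x * pd i (pd j φ) x) := fun i x => by
    rw [pd_sum _ fun j => (hF i j).mul (hφ.smooth.pd j)]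
    exact Finset.sum_congr rfl fun j _ => pd_mul (hF i j) (hφ.smooth.pd j) i x
  have hsum : ∀ x, ∑ i, pd i (fun y => ∑ j, F i j y * pd j φ y) x
      = (∑ j, f j x * pd j φ x) + ∑ i, ∑ j, F i j x * pd i (pd j φ) x := fun x => by
    simp only [hpd, Finset.sum_add_distrib]
    rw [Finset.sum_comm]
    simp only [← Finset.sum_mul, hdiv]
  have hq : (fun y => ∑ i, ∑ j, F i j y * pd i (pd j φ) y) = fun y => ∑ i, pd i (G i) y := by
    ext y
    have h1 : ∀ i, pd i (G i) y = pd i (fun y => ∑ j, F i j y * pd j φ y) y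
        - (pd i (f i) y * φ y + f i y * pd i φ y) := fun i => by
      rw [← pd_mul (hf i) hφ.smooth]
      exact pd_sub (suppSmooth_grad_term hφ hF i).smooth ((hf i).mul hφ.smooth) i y
    simp only [h1, Finset.sum_sub_distrib, Finset.sum_add_distrib, hsum, ← Finset.sum_mul, hf0]
    ring
  have h2 : ∀ i, pd i (opV L φ F i) x = pd i (fun y => ∑ j, F i j y * pd j φ y) x
      - pd i (opB L (fun y => ∑ i, ∑ j, F i j y * pd i (pd j φ) y) i) x := fun i =>
    pd_sub (suppSmooth_grad_term hφ hF i).smooth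
      ((suppSmooth_hessian_term hφ hF).opB hL i).smooth i x
  simp only [h2, Finset.sum_sub_distrib, hsum]
  rw [hq, sum_pd_opB hL hG, ← congrFun hq x]
  ring

lemma exists_opV_bounds {t : ℝ} (ht : 1 ≤ t) : ∃ C : ℝ, 1 ≤ C ∧ ∀ (L m : ℝ) (φ : E3 → ℝ)
    (F : Fin 3 → Fin 3 → E3 → ℝ), 0 < L → 1 ≤ m → SuppSmooth L φ → (∀ i j, Smooth (F i j)) →
    (∀ i x, |pd i φ x| ≤ m / L) → (∀ i j x, |pd i (pd j φ) x| ≤ m ^ 2 / L ^ 2) →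
    (∀ i j k x, |pd i (pd j (pd k φ)) x| ≤ m ^ 3 / L ^ 3) → ∀ i,
      (∫ x in cube L, |opV L φ F i x| ^ t ≤ C * (m ^ 2 / L) ^ t * matEnergy t L F) ∧
      ∀ k, ∫ x in cube L, |pd k (opV L φ F i) x| ^ t
        ≤ C * (m ^ 3 / L) ^ t * (matGradEnergy t L F + (1 / L) ^ t * matEnergy t L F) := by
  have ht0 : 0 < t := by linarith
  obtain ⟨B, hB1, hB⟩ := exists_opB_bounds ht
  have h2t : (1 : ℝ) ≤ 2 ^ t := one_le_rpow (by norm_num) ht0.le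
  have h3t : (1 : ℝ) ≤ 3 ^ t := one_le_rpow (by norm_num) ht0.le
  have hA1 : (1 : ℝ) ≤ 3 ^ t * 3 ^ t * 2 ^ t := by
    have : (1 : ℝ) ≤ 3 ^ t * 3 ^ t := by nlinarith
    nlinarith
  refine ⟨2 ^ t * (3 ^ t * 3 ^ t * 2 ^ t + B * (4 * (3 ^ t * 3 ^ t * 2 ^ t))), ?_, ?_⟩
  · have : 1 ≤ B * (4 * ((3 : ℝ) ^ t * 3 ^ t * 2 ^ t)) := by nlinarith
    nlinarith
  intro L m φ F hL hm hφ hF hd1 hd2 hd3 i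
  set A : ℝ := 3 ^ t * 3 ^ t * 2 ^ t with hA
  set S0 := matEnergy t L F with hS0
  set S1 := matGradEnergy t L F with hS1
  have hS0n : 0 ≤ S0 := matEnergy_nonneg t L F
  have hS1n : 0 ≤ S1 := matGradEnergy_nonneg t L F
  have hLt : 0 < L ^ t := rpow_pos_of_pos hL t
  have hm0 : 0 < m := by linarith
  set q : E3 → ℝ := fun y => ∑ i, ∑ j, F i j y * pd i (pd j φ) y with hq
  have hqS : SuppSmooth L q := suppSmooth_hessian_term hφ hF
  have hrow : ∀ i, ∑ j, ∫ x in cube L, |F i j x| ^ t ≤ S0 := fun i =>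
    Finset.single_le_sum (f := fun i => ∑ j, ∫ x in cube L, |F i j x| ^ t)
      (fun i _ => Finset.sum_nonneg fun j _ => setIntegral_cube_abs_rpow_nonneg _ _ _)
      (Finset.mem_univ i)
  have hS1k : ∀ k, ∑ i, ∑ j, ∫ x in cube L, |pd k (F i j) x| ^ t ≤ S1 := fun k => by
    refine Finset.sum_le_sum fun i _ => Finset.sum_le_sum fun j _ => ?_
    exact Finset.single_le_sum (f := fun k => ∫ x in cube L, |pd k (F i j) x| ^ t)
      (fun k _ => setIntegral_cube_abs_rpow_nonneg _ _ _) (Finset.mem_univ k)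
  have hrow1 : ∀ i k, ∑ j, ∫ x in cube L, |pd k (F i j) x| ^ t ≤ S1 := fun i k =>
    (Finset.single_le_sum (f := fun i => ∑ j, ∫ x in cube L, |pd k (F i j) x| ^ t)
      (fun i _ => Finset.sum_nonneg fun j _ => setIntegral_cube_abs_rpow_nonneg (pd k (F i j)) t L)
      (Finset.mem_univ i)).trans (hS1k k)
  have cF : ∀ i j, Continuous (F i j) := fun i j => (hF i j).continuous
  have cF' : ∀ i j k, Continuous (pd k (F i j)) := fun i j k => ((hF i j).pd k).continuous
  have cφ1 : ∀ j, Continuous (pd j φ) := fun j => (hφ.pd j).smooth.continuous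
  have cφ2 : ∀ i j, Continuous (pd i (pd j φ)) := fun i j => ((hφ.pd j).pd i).smooth.continuous
  have cφ3 : ∀ i j k, Continuous (pd i (pd j (pd k φ))) := fun i j k =>
    (((hφ.pd k).pd j).pd i).smooth.continuous
  have term : ∀ (f h : E3 → ℝ) (c : ℝ), Continuous f → Continuous h → (∀ x, |h x| ≤ c) →
      ∫ x in cube L, |f x * h x| ^ t ≤ c ^ t * ∫ x in cube L, |f x| ^ t := fun f h c hf hh hc => by
    simp only [mul_comm (f _)]
    exact setIntegral_cube_mul_rpow_le_of_bound hf hh hc ht0.le L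
  have term2 : ∀ (f g h k : E3 → ℝ) (c d : ℝ), Continuous f → Continuous g → Continuous h →
      Continuous k → (∀ x, |h x| ≤ c) → (∀ x, |k x| ≤ d) →
      ∫ x in cube L, |f x * h x + g x * k x| ^ t
        ≤ 2 ^ t * (c ^ t * (∫ x in cube L, |f x| ^ t) + d ^ t * ∫ x in cube L, |g x| ^ t) :=
      fun f g h k c d hf hg hh hk hc hd => by
    have h1 := setIntegral_cube_sub_rpow_le (hf.mul hh) (hg.mul hk).neg ht0.le L
    simp only [Pi.neg_apply, Pi.mul_apply, sub_neg_eq_add, abs_neg] at h1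
    refine h1.trans ?_
    gcongr
    · exact term f h c hf hh hc
    · exact term g k d hg hk hd
  have card3 : (Fintype.card (Fin 3) : ℝ) = 3 := by simp
  have hqb : ∫ x in cube L, |q x| ^ t ≤ A * (m ^ 2 / L ^ 2) ^ t * S0 := by
    calc _ ≤ (3 : ℝ) ^ t * ∑ i, ∫ x in cube L, |∑ j, F i j x * pd i (pd j φ) x| ^ t := by
          have := setIntegral_cube_sum_rpow_le
            (f := fun i x => ∑ j, F i j x * pd i (pd j φ) x) (fun i => by fun_prop) ht L
          rwa [card3] at this
      _ ≤ (3 : ℝ) ^ t * ∑ i, ((3 : ℝ) ^ t * ∑ j, (m ^ 2 / L ^ 2) ^ t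
            * ∫ x in cube L, |F i j x| ^ t) := by
          gcongr with i
          have := setIntegral_cube_sum_rpow_le
            (f := fun j x => F i j x * pd i (pd j φ) x) (fun j => by fun_prop) ht L
          rw [card3] at this
          refine this.trans ?_
          gcongr with j
          exact term _ _ _ (cF i j) (cφ2 i j) (hd2 i j)
      _ = 3 ^ t * 3 ^ t * (m ^ 2 / L ^ 2) ^ t * S0 := by
          simp only [← Finset.mul_sum, hS0, matEnergy]; ring
      _ ≤ _ := by
          gcongr
          rw [hA]; exact le_mul_of_one_le_right (by positivity) h2t
  have hqd : ∀ k x, pd k q x = ∑ i, ∑ j, (pd k (F i j) x * pd i (pd j φ) x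
      + F i j x * pd k (pd i (pd j φ)) x) := fun k x => by
    rw [hq, pd_sum _ fun i => ContDiff.sum fun j _ => (hF i j).mul ((hφ.pd j).pd i).smooth]
    refine Finset.sum_congr rfl fun i _ => ?_
    rw [pd_sum _ fun j => (hF i j).mul ((hφ.pd j).pd i).smooth]
    exact Finset.sum_congr rfl fun j _ => pd_mul (hF i j) ((hφ.pd j).pd i).smooth k x
  set W := S1 + (1 / L) ^ t * S0 with hW
  have hWn : 0 ≤ W := by positivity
  have e2 : (m ^ 2 / L ^ 2) ^ t ≤ (m ^ 3 / L ^ 2) ^ t := by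
    refine rpow_le_rpow (by positivity) ?_ ht0.le
    gcongr
    norm_num
  have e3 : (m ^ 3 / L ^ 3) ^ t = (m ^ 3 / L ^ 2) ^ t * (1 / L) ^ t := by
    rw [← mul_rpow (by positivity) (by positivity)]
    congr 1; field_simp
  have hqdb : ∀ k, ∫ x in cube L, |pd k q x| ^ t ≤ A * (m ^ 3 / L ^ 2) ^ t * W := fun k => by
    simp only [hqd]
    calc _ ≤ (3 : ℝ) ^ t * ∑ i, ∫ x in cube L, |∑ j, (pd k (F i j) x * pd i (pd j φ) x
      + F i j x * pd k (pd i (pd j φ)) x)| ^ t := by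
          have := setIntegral_cube_sum_rpow_le
            (f := fun i x => ∑ j, (pd k (F i j) x * pd i (pd j φ) x
      + F i j x * pd k (pd i (pd j φ)) x)) (fun i => by fun_prop) ht L
          rwa [card3] at this
      _ ≤ (3 : ℝ) ^ t * ∑ i, ((3 : ℝ) ^ t * ∑ j, 2 ^ t * ((m ^ 2 / L ^ 2) ^ t
            * (∫ x in cube L, |pd k (F i j) x| ^ t)
            + (m ^ 3 / L ^ 3) ^ t * ∫ x in cube L, |F i j x| ^ t)) := by
          gcongr with i
          have := setIntegral_cube_sum_rpow_le
            (f := fun j x => pd k (F i j) x * pd i (pd j φ) x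
              + F i j x * pd k (pd i (pd j φ)) x) (fun j => by fun_prop) ht L
          rw [card3] at this
          refine this.trans ?_
          gcongr with j
          exact term2 _ _ _ _ _ _ (cF' i j k) (cF i j) (cφ2 i j) (cφ3 k i j) (hd2 i j)
            (hd3 k i j)
      _ = A * ((m ^ 2 / L ^ 2) ^ t * (∑ i, ∑ j, ∫ x in cube L, |pd k (F i j) x| ^ t)
            + (m ^ 3 / L ^ 3) ^ t * S0) := by
          simp only [← Finset.mul_sum, Finset.sum_add_distrib, hS0, matEnergy, hA]; ring
      _ ≤ A * ((m ^ 3 / L ^ 2) ^ t * S1 + (m ^ 3 / L ^ 2) ^ t * (1 / L) ^ t * S0) := by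
          rw [e3]
          gcongr
          exact hS1k k
      _ = _ := by rw [hW]; ring
  have hqE : sobEnergy t L q ≤ 4 * A * (m ^ 3 / L) ^ t * W := by
    have l1 : ∀ k, L ^ t * ∫ x in cube L, |pd k q x| ^ t ≤ A * (m ^ 3 / L) ^ t * W := fun k => by
      calc _ ≤ L ^ t * (A * (m ^ 3 / L ^ 2) ^ t * W) := by gcongr; exact hqdb k
        _ = A * (L ^ t * (m ^ 3 / L ^ 2) ^ t) * W := by ring
        _ = _ := by
            rw [← mul_rpow hL.le (by positivity)]
            congr 3; field_simp
    have l2 : ∫ x in cube L, |q x| ^ t ≤ A * (m ^ 3 / L) ^ t * W := by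
      calc _ ≤ A * (m ^ 2 / L ^ 2) ^ t * S0 := hqb
        _ ≤ A * (m ^ 3 / L ^ 2) ^ t * S0 := by gcongr
        _ = A * (m ^ 3 / L) ^ t * ((1 / L) ^ t * S0) := by
            have : (m ^ 3 / L ^ 2) ^ t = (m ^ 3 / L) ^ t * (1 / L) ^ t := by
              rw [← mul_rpow (by positivity) (by positivity)]
              congr 1; field_simp
            rw [this]; ring
        _ ≤ _ := by gcongr; rw [hW]; linarith
    rw [sobEnergy, Fin.sum_univ_three]
    linarith [l1 0, l1 1, l1 2]
  have cg : Continuous fun x => ∑ j, F i j x * pd j φ x := by fun_prop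
  have hBS := hqS.opB hL i
  constructor
  · have hg : ∫ x in cube L, |∑ j, F i j x * pd j φ x| ^ t ≤ A * (m ^ 2 / L) ^ t * S0 := by
      have h1 := setIntegral_cube_sum_rpow_le
            (f := fun j x => F i j x * pd j φ x) (fun j => by fun_prop) ht L
      rw [card3] at h1
      calc _ ≤ (3 : ℝ) ^ t * ∑ j, (m / L) ^ t * ∫ x in cube L, |F i j x| ^ t := by
            refine h1.trans ?_
            gcongr with j
            exact term _ _ _ (cF i j) (cφ1 j) (hd1 j)
        _ = 3 ^ t * (m / L) ^ t * ∑ j, ∫ x in cube L, |F i j x| ^ t := by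
            rw [← Finset.mul_sum]; ring
        _ ≤ A * (m ^ 2 / L) ^ t * S0 := by
            have : (3 : ℝ) ^ t ≤ A := by rw [hA, mul_assoc]; nlinarith
            have hmm : m / L ≤ m ^ 2 / L := by gcongr; nlinarith
            gcongr
            exact hrow i
    calc _ ≤ 2 ^ t * ((∫ x in cube L, |∑ j, F i j x * pd j φ x| ^ t)
            + ∫ x in cube L, |opB L q i x| ^ t) :=
          setIntegral_cube_sub_rpow_le cg hBS.smooth.continuous ht0.le L
      _ ≤ 2 ^ t * (A * (m ^ 2 / L) ^ t * S0
            + B * L ^ t * (A * (m ^ 2 / L ^ 2) ^ t * S0)) := by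
          gcongr
          exact (hB L hL q hqS i).1.trans (by gcongr)
      _ = 2 ^ t * (A + B * A) * (m ^ 2 / L) ^ t * S0 := by
          have : L ^ t * (m ^ 2 / L ^ 2) ^ t = (m ^ 2 / L) ^ t := by
            rw [← mul_rpow hL.le (by positivity)]
            congr 1; field_simp
          rw [← this]; ring
      _ ≤ _ := by
          gcongr
          linarith
  · intro k
    have hpd : ∀ x, pd k (opV L φ F i) x
        = (∑ j, (pd k (F i j) x * pd j φ x + F i j x * pd k (pd j φ) x))
          - pd k (opB L q i) x := fun x => by
      have h1 : pd k (opV L φ F i) x = pd k (fun y => ∑ j, F i j y * pd j φ y) x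
          - pd k (opB L q i) x := pd_sub (suppSmooth_grad_term hφ hF i).smooth hBS.smooth k x
      rw [h1, pd_sum _ fun j => (hF i j).mul (hφ.pd j).smooth]
      congr 1
      exact Finset.sum_congr rfl fun j _ => pd_mul (hF i j) (hφ.pd j).smooth k x
    simp only [hpd]
    have hg : ∫ x in cube L, |∑ j, (pd k (F i j) x * pd j φ x + F i j x * pd k (pd j φ) x)| ^ t
        ≤ A * (m ^ 3 / L) ^ t * W := by
      have h1 := setIntegral_cube_sum_rpow_le
            (f := fun j x => pd k (F i j) x * pd j φ x + F i j x * pd k (pd j φ) x)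
            (fun j => by fun_prop) ht L
      rw [card3] at h1
      calc _ ≤ (3 : ℝ) ^ t * ∑ j, 2 ^ t * ((m / L) ^ t * (∫ x in cube L, |pd k (F i j) x| ^ t)
              + (m ^ 2 / L ^ 2) ^ t * ∫ x in cube L, |F i j x| ^ t) := by
            refine h1.trans ?_
            gcongr with j
            exact term2 _ _ _ _ _ _ (cF' i j k) (cF i j) (cφ1 j) (cφ2 k j) (hd1 j) (hd2 k j)
        _ = 3 ^ t * 2 ^ t * ((m / L) ^ t * (∑ j, ∫ x in cube L, |pd k (F i j) x| ^ t)
              + (m ^ 2 / L ^ 2) ^ t * ∑ j, ∫ x in cube L, |F i j x| ^ t) := by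
            rw [← Finset.mul_sum, Finset.sum_add_distrib, ← Finset.mul_sum, ← Finset.mul_sum]
            ring
        _ ≤ A * ((m ^ 3 / L) ^ t * S1 + ((m ^ 3 / L) ^ t * (1 / L) ^ t) * S0) := by
            have a1 : (3 : ℝ) ^ t * 2 ^ t ≤ A := by
              rw [hA, mul_assoc]; exact le_mul_of_one_le_left (by positivity) h3t
            have hmm : m / L ≤ m ^ 3 / L := by
              gcongr; exact le_self_pow₀ hm (by norm_num)
            have hmm2 : (m ^ 2 / L ^ 2) ^ t ≤ (m ^ 3 / L) ^ t * (1 / L) ^ t := by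
              rw [← mul_rpow (by positivity) (by positivity)]
              refine rpow_le_rpow (by positivity) ?_ ht0.le
              rw [show m ^ 3 / L * (1 / L) = m ^ 3 / L ^ 2 by field_simp]
              gcongr
              norm_num
            gcongr
            · exact hrow1 i k
            · exact hrow i
        _ = _ := by rw [hW]; ring
    have cg' : Continuous fun x => ∑ j, (pd k (F i j) x * pd j φ x + F i j x * pd k (pd j φ) x) := by
      fun_prop
    calc _ ≤ 2 ^ t * ((∫ x in cube L,
              |∑ j, (pd k (F i j) x * pd j φ x + F i j x * pd k (pd j φ) x)| ^ t)
            + ∫ x in cube L, |pd k (opB L q i) x| ^ t) :=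
          setIntegral_cube_sub_rpow_le cg' (hBS.pd k).smooth.continuous ht0.le L
      _ ≤ 2 ^ t * (A * (m ^ 3 / L) ^ t * W + B * (4 * A * (m ^ 3 / L) ^ t * W)) := by
          gcongr
          exact ((hB L hL q hqS i).2 k).trans (by gcongr)
      _ = _ := by ring

end OpV

lemma norm_fderiv_sq_le (g : E3 → ℝ) (x : E3) :
    ‖fderiv ℝ g x‖ ^ 2 ≤ 3 * ∑ i, (pd i g x) ^ 2 := by
  have h1 : ‖fderiv ℝ g x‖ ≤ ∑ i, |pd i g x| := by
    refine ContinuousLinearMap.opNorm_le_bound _ (Finset.sum_nonneg fun i _ => abs_nonneg _)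
      fun v => ?_
    have hv : v = ∑ i, v i • basisVec i := by
      ext j
      simp [Finset.sum_apply, Pi.single_apply]
    have h2 : fderiv ℝ g x v = ∑ i, v i * pd i g x := by
      conv_lhs => rw [hv]
      simp [pd]
    rw [h2, Real.norm_eq_abs, Finset.sum_mul]
    refine (Finset.abs_sum_le_sum_abs _ _).trans (Finset.sum_le_sum fun i _ => ?_)
    rw [abs_mul, mul_comm]
    exact mul_le_mul_of_nonneg_left (PiLp.norm_apply_le v i) (abs_nonneg _)
  calc ‖fderiv ℝ g x‖ ^ 2 ≤ (∑ i, |pd i g x|) ^ 2 := by gcongr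
    _ ≤ 3 * ∑ i, (pd i g x) ^ 2 := by
      simp only [Fin.sum_univ_three, ← sq_abs (pd _ g x)]
      nlinarith [sq_nonneg (|pd 0 g x| - |pd 1 g x|), sq_nonneg (|pd 0 g x| - |pd 2 g x|),
        sq_nonneg (|pd 1 g x| - |pd 2 g x|)]

/-- The Sobolev inequality on `ℝ³` for smooth functions supported in a cube. -/
lemma exists_sobolev : ∃ C : ℝ, 1 ≤ C ∧ ∀ (L : ℝ) (g : E3 → ℝ), SuppSmooth L g →
    ∫ x in cube L, g x ^ 6 ≤ C * (∑ i, ∫ x in cube L, (pd i g x) ^ 2) ^ 3 := by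
  set K : ℝ := (eLpNormLESNormFDerivOfEqInnerConst (volume : Measure E3) ((2 : NNReal) : ℝ) : ℝ)
    with hK
  have hK0 : 0 ≤ K := NNReal.coe_nonneg _
  refine ⟨27 * K ^ 6 + 1, by nlinarith [pow_nonneg hK0 6], fun L g hg => ?_⟩
  have hc : HasCompactSupport g := hasCompactSupport_of_cube hg.zero
  have h1 : ContDiff ℝ 1 g := hg.smooth.one
  have hfd : Continuous (fderiv ℝ g) := h1.continuous_fderiv (by simp)
  have hsob := eLpNorm_le_eLpNorm_fderiv_of_eq_inner (μ := (volume : Measure E3)) h1 hc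
    (p := 2) (p' := 6) (by norm_num) (by simp) (by simp; norm_num)
  have hm1 : MemLp g (6 : NNReal) (volume : Measure E3) := h1.continuous.memLp_of_hasCompactSupport hc
  have hm2 : MemLp (fderiv ℝ g) (2 : NNReal) (volume : Measure E3) :=
    hfd.memLp_of_hasCompactSupport (hc.fderiv (𝕜 := ℝ))
  rw [hm1.eLpNorm_eq_integral_rpow_norm (by simp) (by simp),
    hm2.eLpNorm_eq_integral_rpow_norm (by simp) (by simp)] at hsob
  rw [← ENNReal.ofReal_coe_nnreal (p := eLpNormLESNormFDerivOfEqInnerConst _ _), ← hK, ← ENNReal.ofReal_mul hK0,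
    ENNReal.ofReal_le_ofReal_iff (by positivity)] at hsob
  have e1 : ∀ x, ‖g x‖ ^ ((6 : NNReal) : ENNReal).toReal = g x ^ 6 := by
    intro x
    have : ((6 : NNReal) : ENNReal).toReal = ((6 : ℕ) : ℝ) := by simp
    rw [this, rpow_natCast, Real.norm_eq_abs]
    exact Even.pow_abs (by decide) _
  have e2 : ∀ x, ‖fderiv ℝ g x‖ ^ ((2 : NNReal) : ENNReal).toReal = ‖fderiv ℝ g x‖ ^ 2 := by
    intro x
    have : ((2 : NNReal) : ENNReal).toReal = ((2 : ℕ) : ℝ) := by simp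
    rw [this, rpow_natCast]
  simp only [e1, e2] at hsob
  have i0 : 0 ≤ ∫ x, g x ^ 6 := integral_nonneg fun x => Even.pow_nonneg (by decide) _
  have j0 : 0 ≤ ∫ x, ‖fderiv ℝ g x‖ ^ 2 := integral_nonneg fun x => by positivity
  have h6 := pow_le_pow_left₀ (by positivity) hsob 6
  rw [mul_pow] at h6
  have e3 : ((∫ x, g x ^ 6) ^ ((6 : NNReal) : ENNReal).toReal⁻¹) ^ 6 = ∫ x, g x ^ 6 := by
    rw [← rpow_mul_natCast i0]; simp
  have e4 : ((∫ x, ‖fderiv ℝ g x‖ ^ 2) ^ ((2 : NNReal) : ENNReal).toReal⁻¹) ^ 6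
      = (∫ x, ‖fderiv ℝ g x‖ ^ 2) ^ 3 := by
    rw [← rpow_mul_natCast j0, ← rpow_natCast]; simp; norm_num
  rw [e3, e4] at h6
  have e5 : ∫ x in cube L, g x ^ 6 = ∫ x, g x ^ 6 :=
    setIntegral_cube_eq_integral fun x hx => by rw [hg.zero x hx]; simp
  have hci : ∀ i, Continuous (pd i g) := fun i => h1.continuous_pd i
  have e6 : ∫ x, ‖fderiv ℝ g x‖ ^ 2 ≤ 3 * ∑ i, ∫ x in cube L, (pd i g x) ^ 2 := by
    rw [← setIntegral_cube_eq_integral (r := L), ← integral_finsetSum _ fun i _ =>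
      Continuous.integrableOn_cube (by have := hci i; fun_prop) L, ← integral_const_mul]
    · refine setIntegral_cube_mono (by fun_prop) ?_ fun x _ => norm_fderiv_sq_le g x
      have := hci
      fun_prop
    · intro x hx
      have := norm_fderiv_sq_le g x
      simp only [pd_eq_zero_of_notMem_cube hg.zero _ x hx] at this
      simp at this
      simp [this]
  rw [e5]
  have s0 : 0 ≤ ∑ i, ∫ x in cube L, (pd i g x) ^ 2 :=
    Finset.sum_nonneg fun i _ => integral_nonneg fun x => by positivity
  calc _ ≤ _ := h6
    _ ≤ K ^ 6 * (3 * ∑ i, ∫ x in cube L, (pd i g x) ^ 2) ^ 3 := by gcongr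
    _ = 27 * K ^ 6 * (∑ i, ∫ x in cube L, (pd i g x) ^ 2) ^ 3 := by ring
    _ ≤ _ := by gcongr; linarith

/-- A scalar function `h` that is the divergence of a field `F` of controlled growth, together
with a cutoff `φ` on a cube of half side `ρ` at scale `R / m`. -/
structure PotentialData (s A R m ρ X : ℝ) (φ h : E3 → ℝ) (F : Fin 3 → E3 → ℝ) : Prop where
  one_le_R : 1 ≤ R
  one_le_m : 1 ≤ m
  one_le_X : 1 ≤ X
  supp : SuppSmooth ρ φ
  nonneg : ∀ x, 0 ≤ φ x
  le_one : ∀ x, φ x ≤ 1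
  abs_pd_le : ∀ i x, |pd i φ x| ≤ m / R
  smooth_h : Smooth h
  smooth_F : ∀ i, Smooth (F i)
  div_eq : ∀ x, ∑ i, pd i (F i) x = h x
  sq_le : ∀ i, ∫ x in cube ρ, (F i x) ^ 2 ≤ A * R ^ (10 / 3 : ℝ)
  rpow_le : ∀ i, ∫ x in cube ρ, |F i x| ^ s ≤ A * R ^ (s / 3 + 2)
  grad_le : ∀ i, ∫ x in cube ρ, (pd i h x) ^ 2 ≤ X

namespace PotentialData

variable {s A R m ρ X : ℝ} {φ h : E3 → ℝ} {F : Fin 3 → E3 → ℝ}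

lemma integral_sq_le (D : PotentialData s A R m ρ X φ h F) (hA : 1 ≤ A) :
    ∫ x in cube ρ, φ x ^ 2 * h x ^ 2 ≤ 42 * A * m ^ 2 * (R ^ (5 / 3 : ℝ) * X ^ (1 / 2 : ℝ)) := by
  have hR := D.one_le_R
  have hm := D.one_le_m
  have hX := D.one_le_X
  have hR0 : 0 < R := by linarith
  have hX0 : 0 < X := by linarith
  have cφ := D.supp.smooth.continuous
  have ch := D.smooth_h.continuous
  have cF : ∀ i, Continuous (F i) := fun i => (D.smooth_F i).continuous
  have cdh : ∀ i, Continuous (pd i h) := fun i => (D.smooth_h.pd i).continuous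
  set κ : ℝ := X ^ (1 / 2 : ℝ) * R ^ (-(5 / 3) : ℝ) with hκ
  have hκ0 : 0 < κ := by positivity
  have main : ∫ x in cube ρ, 1 / 2 * (φ x ^ 2 * h x ^ 2)
      ≤ ∫ x in cube ρ, ∑ i, ((6 * (m / R) ^ 2 + 1 / 2 * κ) * F i x ^ 2
          + 1 / 2 * κ⁻¹ * (pd i h x) ^ 2) := by
    refine setIntegral_cube_le_of_div (Z := fun i x => (φ x * φ x) * (h x * F i x)) (by fun_prop)
      (by fun_prop) (fun i => ?_) (fun i x hx => by simp [D.supp.zero x hx]) fun x _ => ?_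
    · exact Smooth.one ((D.supp.smooth.mul D.supp.smooth).mul (D.smooth_h.mul (D.smooth_F i)))
    · have e : ∀ i, pd i (fun x => (φ x * φ x) * (h x * F i x)) x
          = (pd i φ x * φ x + φ x * pd i φ x) * (h x * F i x)
            + φ x * φ x * (pd i h x * F i x + h x * pd i (F i) x) := by
        intro i
        rw [pd_mul (D.supp.smooth.mul D.supp.smooth) (D.smooth_h.mul (D.smooth_F i)),
          pd_mul D.supp.smooth D.supp.smooth, pd_mul D.smooth_h (D.smooth_F i)]
      have e2 : ∑ i, pd i (fun x => (φ x * φ x) * (h x * F i x)) x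
          = φ x ^ 2 * h x ^ 2 + ∑ i, (2 * φ x * pd i φ x * h x * F i x
            + φ x ^ 2 * pd i h x * F i x) := by
        conv_rhs => rw [show φ x ^ 2 * h x ^ 2 = ∑ i, φ x ^ 2 * h x * pd i (F i) x by
          rw [← Finset.mul_sum, D.div_eq]; ring]
        rw [← Finset.sum_add_distrib]
        exact Finset.sum_congr rfl fun i _ => by rw [e]; ring
      rw [e2]
      have key : ∀ i, -(1 / 6 * (φ x ^ 2 * h x ^ 2)) ≤
          ((6 * (m / R) ^ 2 + 1 / 2 * κ) * F i x ^ 2 + 1 / 2 * κ⁻¹ * (pd i h x) ^ 2)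
          + (2 * φ x * pd i φ x * h x * F i x + φ x ^ 2 * pd i h x * F i x) := by
        intro i
        have a1 : (pd i φ x) ^ 2 ≤ (m / R) ^ 2 := by
          rw [← sq_abs (pd i φ x)]
          exact pow_le_pow_left₀ (abs_nonneg _) (D.abs_pd_le i x) 2
        have a2 : (pd i φ x) ^ 2 * F i x ^ 2 ≤ (m / R) ^ 2 * F i x ^ 2 := by gcongr
        have a3 : φ x ^ 4 ≤ 1 := pow_le_one₀ (D.nonneg x) (D.le_one x)
        have a4 : φ x ^ 4 * (κ * F i x ^ 2) ≤ 1 * (κ * F i x ^ 2) := by gcongr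
        have a5 : 0 ≤ κ⁻¹ * (κ * φ x ^ 2 * F i x + pd i h x) ^ 2 := by positivity
        have a6 : κ⁻¹ * (κ * φ x ^ 2 * F i x + pd i h x) ^ 2
            = φ x ^ 4 * (κ * F i x ^ 2) + 2 * (φ x ^ 2 * pd i h x * F i x)
              + κ⁻¹ * (pd i h x) ^ 2 := by field_simp; ring
        nlinarith [sq_nonneg (φ x * h x + 6 * pd i φ x * F i x)]
      have := Finset.sum_le_sum fun i (_ : i ∈ Finset.univ) => key i
      rw [Finset.sum_add_distrib] at this
      simp only [Finset.sum_const, Finset.card_univ, Fintype.card_fin, nsmul_eq_mul] at this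
      push_cast at this
      linarith
  rw [integral_const_mul, integral_finsetSum _ fun i _ =>
    Continuous.integrableOn_cube (by fun_prop) _] at main
  have hi : ∀ i, ∫ x in cube ρ, ((6 * (m / R) ^ 2 + 1 / 2 * κ) * F i x ^ 2
          + 1 / 2 * κ⁻¹ * (pd i h x) ^ 2) ≤ 7 * A * m ^ 2 * (R ^ (5 / 3 : ℝ) * X ^ (1 / 2 : ℝ)) := by
    intro i
    rw [integral_add (Continuous.integrableOn_cube (by fun_prop) _)
      (Continuous.integrableOn_cube (by fun_prop) _), integral_const_mul, integral_const_mul]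
    have b1 : κ⁻¹ * X = R ^ (5 / 3 : ℝ) * X ^ (1 / 2 : ℝ) := by
      rw [hκ, mul_inv, ← rpow_neg hR0.le, ← rpow_neg hX0.le, neg_neg,
        mul_right_comm, mul_comm]
      congr 1
      nth_rw 2 [← rpow_one X]
      rw [← rpow_add hX0]; norm_num
    have b2 : κ * R ^ (10 / 3 : ℝ) = R ^ (5 / 3 : ℝ) * X ^ (1 / 2 : ℝ) := by
      rw [hκ, mul_assoc, ← rpow_add hR0]; norm_num [mul_comm]
    have b3 : (m / R) ^ 2 * R ^ (10 / 3 : ℝ) ≤ m ^ 2 * (R ^ (5 / 3 : ℝ) * X ^ (1 / 2 : ℝ)) := by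
      have c1 : (m / R) ^ 2 * R ^ (10 / 3 : ℝ) = m ^ 2 * R ^ (4 / 3 : ℝ) := by
        rw [div_pow, div_mul_eq_mul_div, mul_div_assoc, ← rpow_natCast R 2, ← rpow_sub hR0]
        norm_num
      rw [c1]
      gcongr
      calc R ^ (4 / 3 : ℝ) ≤ R ^ (5 / 3 : ℝ) := rpow_le_rpow_of_exponent_le hR (by norm_num)
        _ = R ^ (5 / 3 : ℝ) * 1 := (mul_one _).symm
        _ ≤ _ := by gcongr; exact one_le_rpow hX (by norm_num)
    set Q := R ^ (5 / 3 : ℝ) * X ^ (1 / 2 : ℝ) with hQ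
    have hQ0 : 0 ≤ Q := by positivity
    have c1 := mul_le_mul_of_nonneg_left (D.sq_le i)
      (by positivity : 0 ≤ 6 * (m / R) ^ 2 + 1 / 2 * κ)
    have c2 := mul_le_mul_of_nonneg_left (D.grad_le i) (by positivity : 0 ≤ 1 / 2 * κ⁻¹)
    have c3 : 1 * Q ≤ m ^ 2 * Q := mul_le_mul_of_nonneg_right (by nlinarith) hQ0
    have c4 : 1 * (m ^ 2 * Q) ≤ A * (m ^ 2 * Q) := by gcongr
    have c5 : A * ((m / R) ^ 2 * R ^ (10 / 3 : ℝ)) ≤ A * (m ^ 2 * Q) := by gcongr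
    have c6 : A * (1 * Q) ≤ A * (m ^ 2 * Q) := by gcongr
    have c7 : (6 * (m / R) ^ 2 + 1 / 2 * κ) * (A * R ^ (10 / 3 : ℝ))
      = 6 * (A * ((m / R) ^ 2 * R ^ (10 / 3 : ℝ))) + 1 / 2 * (A * (κ * R ^ (10 / 3 : ℝ))) := by ring
    rw [c7, b2] at c1
    have c8 : 1 / 2 * κ⁻¹ * X = 1 / 2 * Q := by rw [mul_assoc, b1]
    nlinarith
  have := Finset.sum_le_sum fun i (_ : i ∈ Finset.univ) => hi i
  simp only [Finset.sum_const, Finset.card_univ, Fintype.card_fin, nsmul_eq_mul] at this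
  push_cast at this
  linarith

lemma sq_bound (D : PotentialData s A R m ρ X φ h F) (hA : 1 ≤ A) :
    (m / R) ^ 2 * ∫ x in cube ρ, φ x ^ 2 * h x ^ 2 ≤ 42 * A * (m ^ 4 * X) := by
  have hR := D.one_le_R
  have hm := D.one_le_m
  have hX := D.one_le_X
  have hR0 : 0 < R := by linarith
  calc (m / R) ^ 2 * ∫ x in cube ρ, φ x ^ 2 * h x ^ 2
      ≤ (m / R) ^ 2 * (42 * A * m ^ 2 * (R ^ (5 / 3 : ℝ) * X ^ (1 / 2 : ℝ))) := by
        gcongr; exact D.integral_sq_le hA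
    _ ≤ (m / R) ^ 2 * (42 * A * m ^ 2 * (R ^ (2 : ℝ) * X ^ (1 : ℝ))) := by
        gcongr <;> first | assumption | norm_num
    _ = _ := by
        rw [rpow_one, rpow_two]; field_simp

lemma pd_sq_mul (D : PotentialData s A R m ρ X φ h F) (i : Fin 3) (x : E3) :
    pd i (fun x => φ x * φ x * h x) x
      = 2 * φ x * pd i φ x * h x + φ x ^ 2 * pd i h x := by
  rw [pd_mul (D.supp.smooth.mul D.supp.smooth) D.smooth_h, pd_mul D.supp.smooth D.supp.smooth]
  ring

lemma integral_gradient_le (D : PotentialData s A R m ρ X φ h F) (hA : 1 ≤ A) (i : Fin 3) :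
    ∫ x in cube ρ, (2 * φ x * |pd i φ x| * |h x| + φ x ^ 2 * |pd i h x|) ^ 2
      ≤ 338 * A * (m ^ 4 * X) := by
  have hm := D.one_le_m
  have hX := D.one_le_X
  have hR0 : 0 < R := by linarith [D.one_le_R]
  have cφ := D.supp.smooth.continuous
  have ch := D.smooth_h.continuous
  have cdφ : Continuous (pd i φ) := (D.supp.smooth.pd i).continuous
  have cdh : Continuous (pd i h) := (D.smooth_h.pd i).continuous
  calc ∫ x in cube ρ, (2 * φ x * |pd i φ x| * |h x| + φ x ^ 2 * |pd i h x|) ^ 2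
      ≤ ∫ x in cube ρ, (8 * (m / R) ^ 2 * (φ x ^ 2 * h x ^ 2) + 2 * (pd i h x) ^ 2) := by
        refine setIntegral_cube_mono (by fun_prop) (by fun_prop) fun x _ => ?_
        have a1 : |pd i φ x| ^ 2 ≤ (m / R) ^ 2 :=
          pow_le_pow_left₀ (abs_nonneg _) (D.abs_pd_le i x) 2
        have a2 : |pd i φ x| ^ 2 * (φ x ^ 2 * h x ^ 2) ≤ (m / R) ^ 2 * (φ x ^ 2 * h x ^ 2) := by
          gcongr
        have a3 : φ x ^ 4 ≤ 1 := pow_le_one₀ (D.nonneg x) (D.le_one x)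
        have a4 : φ x ^ 4 * pd i h x ^ 2 ≤ 1 * pd i h x ^ 2 := by gcongr
        rw [← sq_abs (h x)] at a2 ⊢
        rw [← sq_abs (pd i h x)] at a4 ⊢
        nlinarith [sq_nonneg (2 * φ x * |pd i φ x| * |h x| - φ x ^ 2 * |pd i h x|)]
    _ = 8 * ((m / R) ^ 2 * ∫ x in cube ρ, φ x ^ 2 * h x ^ 2)
          + 2 * ∫ x in cube ρ, (pd i h x) ^ 2 := by
        rw [integral_add (Continuous.integrableOn_cube (by fun_prop) _)
          (Continuous.integrableOn_cube (by fun_prop) _), integral_const_mul, integral_const_mul,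
          mul_assoc]
    _ ≤ 8 * (42 * A * (m ^ 4 * X)) + 2 * X := by
        have := D.sq_bound hA
        have := D.grad_le i
        linarith
    _ ≤ 338 * A * (m ^ 4 * X) := by
        have h4 : 1 ≤ m ^ 4 := one_le_pow₀ hm
        have : 1 * 1 * X ≤ A * m ^ 4 * X := by gcongr
        nlinarith

lemma _root_.exists_integral_pow_six_le (A : ℝ) (hA : 1 ≤ A) : ∃ C : ℝ, 1 ≤ C ∧
    ∀ (s R m ρ X : ℝ) (φ h : E3 → ℝ) (F : Fin 3 → E3 → ℝ), PotentialData s A R m ρ X φ h F →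
      ∫ x in cube ρ, (φ x ^ 2 * |h x|) ^ 6 ≤ C * (m ^ 4 * X) ^ 3 := by
  obtain ⟨K, hK, hsob⟩ := exists_sobolev
  refine ⟨K * (3 * (338 * A)) ^ 3, ?_, fun s R m ρ X φ h F D => ?_⟩
  · have : (1 : ℝ) ≤ (3 * (338 * A)) ^ 3 := one_le_pow₀ (by linarith)
    nlinarith
  have cφ := D.supp.smooth.continuous
  have ch := D.smooth_h.continuous
  have hX0 : 0 ≤ X := by linarith [D.one_le_X]
  have h1 := hsob ρ (fun x => φ x * φ x * h x)
    ⟨(D.supp.smooth.mul D.supp.smooth).mul D.smooth_h, fun x hx => by simp [D.supp.zero x hx]⟩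
  have e : ∀ x, (φ x ^ 2 * |h x|) ^ 6 = (φ x * φ x * h x) ^ 6 := by
    intro x
    rw [mul_pow, mul_pow, Even.pow_abs (by decide)]; ring
  simp only [e]
  refine h1.trans ?_
  have h2 : ∀ i, ∫ x in cube ρ, (pd i (fun x => φ x * φ x * h x) x) ^ 2
      ≤ 338 * A * (m ^ 4 * X) := by
    intro i
    have cdφ : Continuous (pd i φ) := (D.supp.smooth.pd i).continuous
    have cdh : Continuous (pd i h) := (D.smooth_h.pd i).continuous
    refine le_trans (setIntegral_cube_mono ?_ ?_ fun x _ => ?_) (D.integral_gradient_le hA i)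
    · simp only [D.pd_sq_mul]; fun_prop
    · fun_prop
    · rw [D.pd_sq_mul, ← sq_abs]
      gcongr
      refine (abs_add_le _ _).trans_eq ?_
      simp only [abs_mul, abs_pow, abs_of_nonneg (D.nonneg x)]
      norm_num
  have h3 := Finset.sum_le_sum fun i (_ : i ∈ Finset.univ) => h2 i
  simp only [Finset.sum_const, Finset.card_univ, Fintype.card_fin, nsmul_eq_mul] at h3
  have h4 : 0 ≤ ∑ i, ∫ x in cube ρ, (pd i (fun x => φ x * φ x * h x) x) ^ 2 :=
    Finset.sum_nonneg fun i _ => integral_nonneg fun x => by positivity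
  calc _ ≤ K * (((3 : ℕ) : ℝ) * (338 * A * (m ^ 4 * X))) ^ 3 := by gcongr
    _ = _ := by push_cast; ring

end PotentialData

lemma le_rpow_of_le_mul_rpow {Y B γ : ℝ} (hY : 0 ≤ Y) (hB : 0 ≤ B) (hγ : 0 < γ)
    (h : Y ≤ B * Y ^ (1 - γ)) : Y ≤ B ^ (1 / γ) := by
  rcases hY.eq_or_lt with rfl | hY0
  · positivity
  have h1 : Y ^ γ ≤ B := by
    have h2 : Y ^ γ * Y ^ (1 - γ) = Y := by rw [← rpow_add hY0]; norm_num
    have h3 : 0 < Y ^ (1 - γ) := by positivity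
    exact le_of_mul_le_mul_right (h2.trans_le h) h3
  calc Y = (Y ^ γ) ^ (1 / γ) := by rw [← rpow_mul hY, mul_one_div_cancel hγ.ne', rpow_one]
    _ ≤ _ := by gcongr

lemma hasDerivAt_mul_abs (t : ℝ) : HasDerivAt (fun t : ℝ => t * |t|) (2 * |t|) t := by
  rcases lt_trichotomy t 0 with h | rfl | h
  · refine ((hasDerivAt_id t).mul (hasDerivAt_abs_neg h)).congr_deriv ?_
    simp [abs_of_neg h]; ring
  · rw [hasDerivAt_iff_isLittleO]
    have h1 : (fun t : ℝ => |t|) =o[𝓝 0] (fun _ => (1 : ℝ)) := by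
      rw [Asymptotics.isLittleO_one_iff]
      exact (continuous_abs.tendsto' 0 0 abs_zero)
    simpa using (Asymptotics.isBigO_refl (fun t : ℝ => t) (𝓝 0)).mul_isLittleO h1
  · refine ((hasDerivAt_id t).mul (hasDerivAt_abs_pos h)).congr_deriv ?_
    simp [abs_of_pos h]; ring

lemma contDiff_mul_abs_self {h : E3 → ℝ} (hh : Smooth h) :
    ContDiff ℝ 1 (fun x => h x * |h x|) := by
  have : ContDiff ℝ 1 (fun t : ℝ => t * |t|) := by
    rw [contDiff_one_iff_deriv]
    refine ⟨fun t => (hasDerivAt_mul_abs t).differentiableAt, ?_⟩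
    rw [show deriv (fun t : ℝ => t * |t|) = fun t => 2 * |t| from
      funext fun t => (hasDerivAt_mul_abs t).deriv]
    fun_prop
  exact this.comp hh.one

lemma pd_mul_abs_self {h : E3 → ℝ} (hh : Smooth h) (i : Fin 3) (x : E3) :
    pd i (fun x => h x * |h x|) x = 2 * |h x| * pd i h x := by
  have := (hasDerivAt_mul_abs (h x)).comp_hasFDerivAt x (hh.differentiableAt x).hasFDerivAt
  simp only [pd]
  have h2 : (fun x => h x * |h x|) = (fun t : ℝ => t * |t|) ∘ h := rfl
  rw [h2, this.fderiv]
  rfl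

/-- The Hölder step for the cubic estimate. -/
lemma PotentialData.integral_cube_le {s A R m ρ X : ℝ} {φ h : E3 → ℝ} {F : Fin 3 → E3 → ℝ}
    (D : PotentialData s A R m ρ X φ h F) (hA : 1 ≤ A) (hs : 3 < s) (hs6 : s ≤ 6) {C : ℝ}
    (hC : 1 ≤ C) (h6 : ∫ x in cube ρ, (φ x ^ 2 * |h x|) ^ 6 ≤ C * (m ^ 4 * X) ^ 3) :
    ∫ x in cube ρ, φ x ^ 4 * |h x| ^ 3 ≤ 3 * (A ^ (1 / s) * (1352 * A) ^ (1 / 2 : ℝ)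
      * C ^ (1 / s - 1 / 6)) * (R ^ (1 / 3 + 2 / s) * (m ^ 4 * X) ^ (3 / s))
      * (∫ x in cube ρ, φ x ^ 4 * |h x| ^ 3) ^ (1 - (1 / 3 + 2 / s)) := by
  have hm := D.one_le_m
  have hX := D.one_le_X
  have hR0 : 0 < R := by linarith [D.one_le_R]
  have hs0 : 0 < s := by linarith
  have cφ := D.supp.smooth.continuous
  have ch := D.smooth_h.continuous
  have cF : ∀ i, Continuous (F i) := fun i => (D.smooth_F i).continuous
  have cdφ : ∀ i, Continuous (pd i φ) := fun i => (D.supp.smooth.pd i).continuous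
  have cdh : ∀ i, Continuous (pd i h) := fun i => (D.smooth_h.pd i).continuous
  have cG : ∀ i, Continuous fun x => 2 * φ x * |pd i φ x| * |h x| + φ x ^ 2 * |pd i h x| :=
    fun i => by fun_prop
  set G : Fin 3 → E3 → ℝ := fun i x => 2 * φ x * |pd i φ x| * |h x| + φ x ^ 2 * |pd i h x|
    with hG
  have G0 : ∀ i x, 0 ≤ G i x := fun i x => by have := D.nonneg x; positivity
  have main : ∫ x in cube ρ, φ x ^ 4 * |h x| ^ 3
      ≤ ∫ x in cube ρ, ∑ i, 2 * (|F i x| * (φ x ^ 2 * |h x|) * G i x) := by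
    have sφ := (D.supp.smooth.mul D.supp.smooth).mul (D.supp.smooth.mul D.supp.smooth)
    refine setIntegral_cube_le_of_div
      (Z := fun i x => ((φ x * φ x * (φ x * φ x)) * F i x) * (h x * |h x|)) (by fun_prop)
      (by fun_prop) (fun i => ?_) (fun i x hx => by simp [D.supp.zero x hx]) fun x _ => ?_
    · exact (Smooth.one (sφ.mul (D.smooth_F i))).mul (contDiff_mul_abs_self D.smooth_h)
    · have e : ∀ i, pd i (fun x => ((φ x * φ x * (φ x * φ x)) * F i x) * (h x * |h x|)) x
          = φ x ^ 4 * (h x * |h x|) * pd i (F i) x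
            + F i x * (4 * φ x ^ 3 * pd i φ x * (h x * |h x|)
              + φ x ^ 4 * (2 * |h x| * pd i h x)) := by
        intro i
        rw [pd_mul' ((Smooth.differentiableAt (sφ.mul (D.smooth_F i))) x)
          ((contDiff_mul_abs_self D.smooth_h).differentiable (by simp) x),
          pd_mul_abs_self D.smooth_h, pd_mul sφ (D.smooth_F i),
          pd_mul (D.supp.smooth.mul D.supp.smooth) (D.supp.smooth.mul D.supp.smooth),
          pd_mul D.supp.smooth D.supp.smooth]
        ring
      simp only [e]
      have e0 : ∑ i, φ x ^ 4 * (h x * |h x|) * pd i (F i) x = φ x ^ 4 * (h x * |h x|) * h x := by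
        rw [← D.div_eq, Finset.mul_sum]
      rw [Finset.sum_add_distrib, e0]
      have e1 : φ x ^ 4 * (h x * |h x|) * h x = φ x ^ 4 * |h x| ^ 3 := by
        rw [show |h x| ^ 3 = |h x| ^ 2 * |h x| by ring, sq_abs]; ring
      rw [e1]
      have e2 : ∀ i, -(2 * (|F i x| * (φ x ^ 2 * |h x|) * G i x))
          ≤ F i x * (4 * φ x ^ 3 * pd i φ x * (h x * |h x|)
              + φ x ^ 4 * (2 * |h x| * pd i h x)) := by
        intro i
        have a1 : -(|F i x| * (4 * φ x ^ 3 * |pd i φ x| * (|h x| * |h x|)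
              + φ x ^ 4 * (2 * |h x| * |pd i h x|)))
            ≤ F i x * (4 * φ x ^ 3 * pd i φ x * (h x * |h x|)
              + φ x ^ 4 * (2 * |h x| * pd i h x)) := by
          refine neg_le_of_neg_le ((neg_le_abs _).trans ?_)
          rw [abs_mul]
          gcongr
          refine (abs_add_le _ _).trans_eq ?_
          simp only [abs_mul, abs_pow, abs_of_nonneg (D.nonneg x), abs_abs]
          norm_num
        refine le_trans (le_of_eq ?_) a1
        simp only [hG]; ring
      have e3 := Finset.sum_le_sum fun i (_ : i ∈ Finset.univ) => e2 i
      rw [Finset.sum_neg_distrib] at e3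
      linarith
  rw [integral_finsetSum _ fun i _ =>
    Continuous.integrableOn_cube (by have := cG i; fun_prop) _] at main
  set Y := ∫ x in cube ρ, φ x ^ 4 * |h x| ^ 3 with hY
  have hY0 : 0 ≤ Y := integral_nonneg fun x => by have := D.nonneg x; positivity
  have hi : ∀ i, ∫ x in cube ρ, 2 * (|F i x| * (φ x ^ 2 * |h x|) * G i x)
      ≤ (A ^ (1 / s) * (1352 * A) ^ (1 / 2 : ℝ)
      * C ^ (1 / s - 1 / 6)) * (R ^ (1 / 3 + 2 / s) * (m ^ 4 * X) ^ (3 / s))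
      * Y ^ (1 - (1 / 3 + 2 / s)) := by
    intro i
    have hs' : 1 / s < 1 / 3 := one_div_lt_one_div_of_lt (by norm_num) hs
    have hs'' : 1 / 6 ≤ 1 / s := one_div_le_one_div_of_le hs0 hs6
    have e2s : 2 / s = 2 * (1 / s) := by ring
    have cG' := cG i
    calc ∫ x in cube ρ, 2 * (|F i x| * (φ x ^ 2 * |h x|) * G i x)
        ≤ ∫ x in cube ρ, (|F i x| ^ s) ^ (1 / s) * (4 * G i x ^ 2) ^ (1 / 2 : ℝ)
            * (φ x ^ 4 * |h x| ^ 3) ^ (1 - (1 / 3 + 2 / s))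
            * ((φ x ^ 2 * |h x|) ^ 6) ^ (1 / s - 1 / 6) := by
          refine setIntegral_cube_mono (by fun_prop) ?_ fun x _ => ?_
          · refine ((Continuous.mul ?_ ?_).mul ?_).mul ?_
            · exact (((cF i).abs.rpow_const fun _ => Or.inr hs0.le).rpow_const fun _ =>
                Or.inr (by positivity))
            · exact Continuous.rpow_const (by fun_prop) fun _ => Or.inr (by positivity)
            · exact Continuous.rpow_const (by fun_prop) fun _ => Or.inr (by linarith)
            · exact Continuous.rpow_const (by fun_prop) fun _ => Or.inr (by linarith)
          · have hφ := D.nonneg x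
            have b1 : (|F i x| ^ s) ^ (1 / s) = |F i x| := by
              rw [← rpow_mul (abs_nonneg _), mul_one_div_cancel hs0.ne', rpow_one]
            have b2 : (4 * G i x ^ 2) ^ (1 / 2 : ℝ) = 2 * G i x := by
              rw [show 4 * G i x ^ 2 = (2 * G i x) ^ 2 by ring, ← sqrt_eq_rpow,
                sqrt_sq (by have := G0 i x; positivity)]
            have b3 : φ x ^ 2 * |h x| ≤ (φ x ^ 4 * |h x| ^ 3) ^ (1 - (1 / 3 + 2 / s))
                * ((φ x ^ 2 * |h x|) ^ 6) ^ (1 / s - 1 / 6) := by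
              rcases hφ.eq_or_lt with h0 | h0
              · rw [← h0]
                simp only [ne_eq, OfNat.ofNat_ne_zero, not_false_eq_true, zero_pow, zero_mul]
                positivity
              rcases (abs_nonneg (h x)).eq_or_lt with k0 | k0
              · rw [← k0]; simp only [mul_zero]; positivity
              have c1 : (φ x ^ 4 * |h x| ^ 3) ^ (1 - (1 / 3 + 2 / s))
                * ((φ x ^ 2 * |h x|) ^ 6) ^ (1 / s - 1 / 6) = φ x ^ (2 / 3 + 4 / s) * |h x| := by
                rw [mul_pow, mul_rpow (by positivity) (by positivity),
                  mul_rpow (by positivity) (by positivity), ← pow_mul, ← rpow_natCast_mul hφ,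
                  ← rpow_natCast_mul hφ, ← rpow_natCast_mul (abs_nonneg _),
                  ← rpow_natCast_mul (abs_nonneg _), mul_mul_mul_comm, ← rpow_add h0,
                  ← rpow_add k0]
                rw [show ((3 : ℕ) : ℝ) * (1 - (1 / 3 + 2 / s)) + ((6 : ℕ) : ℝ) * (1 / s - 1 / 6) = 1
                  by push_cast; field_simp; ring, rpow_one]
                congr 2
                push_cast; field_simp; ring
              rw [c1]
              gcongr
              rw [← rpow_two]
              refine rpow_le_rpow_of_exponent_ge h0 (D.le_one x) ?_
              rw [show 4 / s = 4 * (1 / s) by ring]; linarith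
            rw [b1, b2, mul_assoc (_ * _)]
            calc _ = |F i x| * (2 * G i x) * (φ x ^ 2 * |h x|) := by ring
              _ ≤ _ := mul_le_mul_of_nonneg_left b3 (by have := G0 i x; positivity)
      _ ≤ (∫ x in cube ρ, |F i x| ^ s) ^ (1 / s) * (∫ x in cube ρ, 4 * G i x ^ 2) ^ (1 / 2 : ℝ)
            * Y ^ (1 - (1 / 3 + 2 / s))
            * (∫ x in cube ρ, (φ x ^ 2 * |h x|) ^ 6) ^ (1 / s - 1 / 6) := by
          refine setIntegral_cube_mul_rpow_le ((cF i).abs.rpow_const fun _ => Or.inr hs0.le)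
            (by fun_prop) (by fun_prop) (by fun_prop) (fun x => by positivity)
            (fun x => by positivity) (fun x => ?_) (fun x => by positivity) (by positivity)
            (by positivity) (by linarith) (by linarith) ?_ ρ
          · have := D.nonneg x
            positivity
          · rw [e2s]; ring
      _ ≤ (A * R ^ (s / 3 + 2)) ^ (1 / s) * (1352 * A * (m ^ 4 * X)) ^ (1 / 2 : ℝ)
            * Y ^ (1 - (1 / 3 + 2 / s)) * (C * (m ^ 4 * X) ^ 3) ^ (1 / s - 1 / 6) := by
          have d1 := D.rpow_le i
          have d2 : ∫ x in cube ρ, 4 * G i x ^ 2 ≤ 1352 * A * (m ^ 4 * X) := by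
            rw [integral_const_mul]
            have := D.integral_gradient_le hA i
            linarith
          have n1 : 0 ≤ ∫ x in cube ρ, |F i x| ^ s := integral_nonneg fun x => by positivity
          have n2 : 0 ≤ ∫ x in cube ρ, 4 * G i x ^ 2 := integral_nonneg fun x => by positivity
          have n3 : 0 ≤ ∫ x in cube ρ, (φ x ^ 2 * |h x|) ^ 6 :=
            integral_nonneg fun x => by positivity
          gcongr
      _ = _ := by
          set W := m ^ 4 * X with hW
          have hW0 : 0 < W := by positivity
          rw [mul_rpow (x := A) (by positivity) (by positivity),
            mul_rpow (x := 1352 * A) (by positivity) hW0.le,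
            mul_rpow (x := C) (by positivity) (by positivity), ← rpow_mul hR0.le,
            ← rpow_natCast_mul hW0.le]
          have f1 : (s / 3 + 2) * (1 / s) = 1 / 3 + 2 / s := by field_simp
          have f2 : W ^ (3 / s) = W ^ (1 / 2 : ℝ) * W ^ (((3 : ℕ) : ℝ) * (1 / s - 1 / 6)) := by
            rw [← rpow_add hW0]; congr 1; push_cast; ring
          rw [f1, f2]; ring
  have := main.trans (Finset.sum_le_sum fun i (_ : i ∈ Finset.univ) => hi i)
  simp only [Finset.sum_const, Finset.card_univ, Fintype.card_fin, nsmul_eq_mul] at this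
  push_cast at this
  linarith

/-- Local estimates for a function that is the divergence of a slowly growing field. -/
lemma exists_potential_estimates (s A : ℝ) (hs : 3 < s) (hs6 : s ≤ 6) (hA : 1 ≤ A) :
    ∃ C : ℝ, 1 ≤ C ∧ ∀ (R m ρ X : ℝ) (φ h : E3 → ℝ) (F : Fin 3 → E3 → ℝ),
      PotentialData s A R m ρ X φ h F →
      (∫ x in cube ρ, φ x ^ 2 * |h x| ^ 2
        ≤ C * m ^ 2 * (R ^ (5 / 3 : ℝ) * X ^ (1 / 2 : ℝ))) ∧
      (∫ x in cube ρ, φ x ^ 4 * |h x| ^ 3 ≤ C * R * (m ^ 4 * X) ^ (9 / (s + 6))) ∧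
      (∫ x in cube ρ, (φ x ^ 2 * |h x|) ^ 6 ≤ C * (m ^ 4 * X) ^ 3) := by
  obtain ⟨C, hC, h6⟩ := exists_integral_pow_six_le A hA
  have hs0 : 0 < s := by linarith
  set γ : ℝ := 1 / 3 + 2 / s with hγ
  have hγ0 : 0 < γ := by positivity
  set B := 3 * (A ^ (1 / s) * (1352 * A) ^ (1 / 2 : ℝ) * C ^ (1 / s - 1 / 6)) with hB
  have hB0 : 0 ≤ B := by positivity
  refine ⟨max (42 * A) (max C (B ^ (1 / γ))), ?_, fun R m ρ X φ h F D => ⟨?_, ?_, ?_⟩⟩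
  · exact le_max_of_le_left (by linarith)
  · simp only [sq_abs]
    refine (D.integral_sq_le hA).trans ?_
    have := D.one_le_R
    have := D.one_le_X
    gcongr
    exact le_max_left _ _
  · have hR : 0 < R := by linarith [D.one_le_R]
    have hX : 0 < X := by linarith [D.one_le_X]
    have hm : 0 < m := by linarith [D.one_le_m]
    have hY0 : 0 ≤ ∫ x in cube ρ, φ x ^ 4 * |h x| ^ 3 :=
      integral_nonneg fun x => by have := D.nonneg x; positivity
    refine (le_rpow_of_le_mul_rpow hY0 (by positivity) hγ0
      (D.integral_cube_le hA hs hs6 hC (h6 s R m ρ X φ h F D))).trans ?_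
    rw [← hB, mul_rpow hB0 (by positivity),
      mul_rpow (x := R ^ _) (by positivity) (by positivity),
      ← rpow_mul hR.le, ← rpow_mul (by positivity), ← hγ, mul_one_div_cancel hγ0.ne', rpow_one,
      mul_assoc]
    have e : 3 / s * (1 / γ) = 9 / (s + 6) := by rw [hγ]; field_simp; ring
    rw [e]
    gcongr
    exact (le_max_right _ _).trans (le_max_right _ _)
  · refine (h6 s R m ρ X φ h F D).trans ?_
    have := D.one_le_X
    gcongr
    exact (le_max_left _ _).trans (le_max_right _ _)

/-- The moving average of `f` over segments of length `l` in direction `i`. -/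
def movAvg (l : ℝ) (i : Fin 3) (f : E3 → ℝ) : E3 → ℝ := lineAvg i 0 l (fun _ => l⁻¹) f

/-- The weighted line integral whose derivative is the error of the moving average. -/
def movHat (l : ℝ) (i : Fin 3) (f : E3 → ℝ) : E3 → ℝ := lineAvg i 0 l (fun τ => 1 - τ / l) f

section MovingAverage

variable {l t r r' : ℝ} {f : E3 → ℝ}

lemma Smooth.movAvg (hf : Smooth f) (l : ℝ) (i : Fin 3) : Smooth (movAvg l i f) :=
  hf.lineAvg (by fun_prop) i 0 l

lemma Smooth.movHat (hf : Smooth f) (l : ℝ) (i : Fin 3) : Smooth (movHat l i f) :=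
  hf.lineAvg (by fun_prop) i 0 l

lemma pd_movAvg (hf : Smooth f) (l : ℝ) (i j : Fin 3) :
    pd j (movAvg l i f) = movAvg l i (pd j f) :=
  funext fun x => pd_lineAvg hf (by fun_prop) i j 0 l x

lemma pd_movHat (hf : Smooth f) (l : ℝ) (i j : Fin 3) :
    pd j (movHat l i f) = movHat l i (pd j f) :=
  funext fun x => pd_lineAvg hf (by fun_prop) i j 0 l x

lemma pd_movHat_self (hf : Smooth f) (hl : 0 < l) (i : Fin 3) (x : E3) :
    pd i (movHat l i f) x = movAvg l i f x - f x := by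
  rw [pd_movHat hf]
  exact lineAvg_hat_pd hf i hl x

lemma movAvg_sum {g : Fin 3 → E3 → ℝ} (hg : ∀ n, Continuous (g n)) (l : ℝ) (i : Fin 3) (x : E3) :
    ∑ n, movAvg l i (g n) x = movAvg l i (fun y => ∑ n, g n y) x :=
  (lineAvg_sum Finset.univ hg (by fun_prop) i 0 l x).symm

lemma setIntegral_cube_movAvg_le (hf : Continuous f) (hl : 0 < l) (ht : 1 ≤ t) (h : r + l ≤ r')
    (i : Fin 3) : ∫ x in cube r, |movAvg l i f x| ^ t ≤ ∫ x in cube r', |f x| ^ t := by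
  have := setIntegral_cube_lineAvg_rpow_le (κ := l⁻¹) hf (k := fun _ => l⁻¹) (by fun_prop) hl.le
    (fun τ _ => (abs_of_pos (inv_pos.2 hl)).le) ht (r := r) (r' := r')
    (fun τ hτ => by rw [abs_of_nonneg hτ.1]; linarith [hτ.2]) i
  rwa [sub_zero, inv_mul_cancel₀ hl.ne', one_rpow, one_mul] at this

lemma setIntegral_cube_movHat_le (hf : Continuous f) (hl : 0 < l) (ht : 1 ≤ t) (h : r + l ≤ r')
    (i : Fin 3) : ∫ x in cube r, |movHat l i f x| ^ t ≤ l ^ t * ∫ x in cube r', |f x| ^ t := by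
  have := setIntegral_cube_lineAvg_rpow_le (κ := 1) hf (k := fun τ => 1 - τ / l) (by fun_prop)
    hl.le (fun τ hτ => by
      have h1 : τ / l ≤ 1 := div_le_one_of_le₀ hτ.2 hl.le
      have h2 : 0 ≤ τ / l := div_nonneg hτ.1 hl.le
      rw [abs_le]; constructor <;> linarith) ht (r := r) (r' := r')
    (fun τ hτ => by rw [abs_of_nonneg hτ.1]; linarith [hτ.2]) i
  rwa [sub_zero, one_mul] at this

lemma setIntegral_cube_pd_movAvg_le (hf : Smooth f) (hl : 0 < l) (ht : 1 ≤ t) (h : r + l ≤ r')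
    (i : Fin 3) : ∫ x in cube r, |pd i (movAvg l i f) x| ^ t
      ≤ 2 ^ (t + 1) * ((1 / l) ^ t * ∫ x in cube r', |f x| ^ t) := by
  have ht0 : 0 ≤ t := by linarith
  have hfc := hf.continuous
  have e : ∀ x, |pd i (movAvg l i f) x| ^ t
      = (1 / l) ^ t * |f (x + l • basisVec i) - f (x + (0 : ℝ) • basisVec i)| ^ t := by
    intro x
    rw [← lineAvg_one_pd hf i 0 l x, pd_movAvg hf, ← mul_rpow (by positivity) (abs_nonneg _)]
    congr 1
    rw [← abs_of_pos (by positivity : 0 < 1 / l), ← abs_mul]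
    simp [movAvg, lineAvg]
  simp only [e]
  rw [integral_const_mul]
  have h1 := setIntegral_cube_sub_rpow_le (f := fun x => f (x + l • basisVec i))
    (h := fun x => f (x + (0 : ℝ) • basisVec i)) (by fun_prop) (by fun_prop) ht0 r
  have h2 := setIntegral_cube_translate_le (f := fun x => |f x| ^ t) (hfc.abs_rpow ht0)
    (fun x => by positivity) i (r := r) (r' := r') (τ := l) (by rw [abs_of_pos hl]; exact h)
  have h3 := setIntegral_cube_translate_le (f := fun x => |f x| ^ t) (hfc.abs_rpow ht0)
    (fun x => by positivity) i (r := r) (r' := r') (τ := 0) (by rw [abs_zero]; linarith)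
  calc _ ≤ (1 / l) ^ t * (2 ^ t * ((∫ x in cube r', |f x| ^ t) + ∫ x in cube r', |f x| ^ t)) := by
        gcongr
        refine h1.trans ?_
        gcongr
    _ = _ := by rw [rpow_add (by norm_num), rpow_one]; ring

end MovingAverage

/-- The mollified potential. -/
def mollPot (l : ℝ) (F : Fin 3 → Fin 3 → E3 → ℝ) (i j : Fin 3) : E3 → ℝ :=
  movAvg l 2 (movAvg l 1 (movAvg l 0 (F i j)))

/-- A potential for the mollification error of `f`. -/
def errPot (l : ℝ) (f : Fin 3 → E3 → ℝ) (i j : Fin 3) : E3 → ℝ :=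
  ![movHat l 0 (f j), movHat l 1 (movAvg l 0 (f j)), movHat l 2 (movAvg l 1 (movAvg l 0 (f j)))] i

section Mollified

variable {l t r ρ : ℝ} {F : Fin 3 → Fin 3 → E3 → ℝ} {f : Fin 3 → E3 → ℝ}

lemma smooth_mollPot (hF : ∀ i j, Smooth (F i j)) (l : ℝ) (i j : Fin 3) :
    Smooth (mollPot l F i j) :=
  (((hF i j).movAvg l 0).movAvg l 1).movAvg l 2

lemma smooth_errPot (hf : ∀ j, Smooth (f j)) (l : ℝ) (i j : Fin 3) : Smooth (errPot l f i j) := by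
  fin_cases i
  · exact (hf j).movHat l 0
  · exact ((hf j).movAvg l 0).movHat l 1
  · exact (((hf j).movAvg l 0).movAvg l 1).movHat l 2

lemma sum_pd_mollPot (hF : ∀ i j, Smooth (F i j))
    (hdiv : ∀ j x, ∑ i, pd i (F i j) x = f j x) (l : ℝ) (j : Fin 3) (x : E3) :
    ∑ i, pd i (mollPot l F i j) x = movAvg l 2 (movAvg l 1 (movAvg l 0 (f j))) x := by
  have e : ∀ i, pd i (mollPot l F i j) = movAvg l 2 (movAvg l 1 (movAvg l 0 (pd i (F i j)))) := by
    intro i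
    rw [mollPot, pd_movAvg (((hF i j).movAvg l 0).movAvg l 1), pd_movAvg ((hF i j).movAvg l 0),
      pd_movAvg (hF i j)]
  have s0 : ∀ i, Smooth (pd i (F i j)) := fun i => (hF i j).pd i
  simp only [e]
  rw [movAvg_sum fun i => (((s0 i).movAvg l 0).movAvg l 1).continuous]
  congr 1
  funext y
  rw [movAvg_sum fun i => ((s0 i).movAvg l 0).continuous]
  congr 1
  funext z
  rw [movAvg_sum fun i => (s0 i).continuous]
  congr 1
  funext w
  exact hdiv j w

lemma sum_pd_errPot (hf : ∀ j, Smooth (f j)) (hl : 0 < l) (j : Fin 3) (x : E3) :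
    ∑ i, pd i (errPot l f i j) x
      = movAvg l 2 (movAvg l 1 (movAvg l 0 (f j))) x - f j x := by
  rw [Fin.sum_univ_three]
  have e0 : errPot l f 0 j = movHat l 0 (f j) := rfl
  have e1 : errPot l f 1 j = movHat l 1 (movAvg l 0 (f j)) := rfl
  have e2 : errPot l f 2 j = movHat l 2 (movAvg l 1 (movAvg l 0 (f j))) := rfl
  rw [e0, e1, e2, pd_movHat_self (hf j) hl, pd_movHat_self ((hf j).movAvg l 0) hl,
    pd_movHat_self (((hf j).movAvg l 0).movAvg l 1) hl]
  ring

lemma matEnergy_mollPot_le (hF : ∀ i j, Smooth (F i j)) (hl : 0 < l) (ht : 1 ≤ t)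
    (h : r + 3 * l ≤ ρ) : matEnergy t r (mollPot l F) ≤ matEnergy t ρ F := by
  refine Finset.sum_le_sum fun i _ => Finset.sum_le_sum fun j _ => ?_
  refine (setIntegral_cube_movAvg_le (((hF i j).movAvg l 0).movAvg l 1).continuous hl ht
    (le_refl (r + l)) 2).trans ?_
  refine (setIntegral_cube_movAvg_le ((hF i j).movAvg l 0).continuous hl ht
    (le_refl (r + l + l)) 1).trans ?_
  exact setIntegral_cube_movAvg_le (hF i j).continuous hl ht (by linarith) 0

lemma matGradEnergy_mollPot_le (hF : ∀ i j, Smooth (F i j)) (hl : 0 < l) (ht : 1 ≤ t)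
    (h : r + 3 * l ≤ ρ) :
    matGradEnergy t r (mollPot l F) ≤ 3 * 2 ^ (t + 1) * ((1 / l) ^ t * matEnergy t ρ F) := by
  have key : ∀ i j k, ∫ x in cube r, |pd k (mollPot l F i j) x| ^ t
      ≤ 2 ^ (t + 1) * ((1 / l) ^ t * ∫ x in cube ρ, |F i j x| ^ t) := by
    intro i j k
    have s0 := hF i j
    have s1 := s0.movAvg l 0
    have s2 := s1.movAvg l 1
    rw [mollPot]
    fin_cases k
    · simp only [Fin.zero_eta, Fin.isValue]
      rw [pd_movAvg s2, pd_movAvg s1]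
      refine (setIntegral_cube_movAvg_le ((s1.pd 0).movAvg l 1).continuous hl ht
        (le_refl (r + l)) 2).trans ?_
      refine (setIntegral_cube_movAvg_le (s1.pd 0).continuous hl ht
        (le_refl (r + l + l)) 1).trans ?_
      exact setIntegral_cube_pd_movAvg_le s0 hl ht (by linarith) 0
    · simp only [Fin.mk_one, Fin.isValue]
      rw [pd_movAvg s2]
      refine (setIntegral_cube_movAvg_le (s2.pd 1).continuous hl ht
        (le_refl (r + l)) 2).trans ?_
      refine (setIntegral_cube_pd_movAvg_le s1 hl ht (le_refl (r + l + l)) 1).trans ?_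
      gcongr
      exact setIntegral_cube_movAvg_le s0.continuous hl ht (by linarith) 0
    · simp only [Fin.reduceFinMk, Fin.isValue]
      refine (setIntegral_cube_pd_movAvg_le s2 hl ht (le_refl (r + l)) 2).trans ?_
      gcongr
      refine (setIntegral_cube_movAvg_le s1.continuous hl ht (le_refl (r + l + l)) 1).trans ?_
      exact setIntegral_cube_movAvg_le s0.continuous hl ht (by linarith) 0
  calc matGradEnergy t r (mollPot l F)
      ≤ ∑ i, ∑ j, ∑ _k : Fin 3, 2 ^ (t + 1) * ((1 / l) ^ t * ∫ x in cube ρ, |F i j x| ^ t) :=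
        Finset.sum_le_sum fun i _ => Finset.sum_le_sum fun j _ => Finset.sum_le_sum fun k _ =>
          key i j k
    _ = _ := by
        simp only [matEnergy, Finset.mul_sum, Finset.sum_const, Finset.card_univ,
          Fintype.card_fin, nsmul_eq_mul]
        refine Finset.sum_congr rfl fun i _ => Finset.sum_congr rfl fun j _ => ?_
        push_cast; ring

lemma setIntegral_cube_errPot_le (hf : ∀ j, Smooth (f j)) (hl : 0 < l) (ht : 1 ≤ t)
    (h : r + 3 * l ≤ ρ) (i j : Fin 3) :
    ∫ x in cube r, |errPot l f i j x| ^ t ≤ l ^ t * ∫ x in cube ρ, |f j x| ^ t := by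
  have s0 := hf j
  have s1 := s0.movAvg l 0
  have s2 := s1.movAvg l 1
  fin_cases i
  · exact setIntegral_cube_movHat_le s0.continuous hl ht (by linarith) 0
  · refine (setIntegral_cube_movHat_le s1.continuous hl ht (le_refl (r + l)) 1).trans ?_
    gcongr
    exact setIntegral_cube_movAvg_le s0.continuous hl ht (by linarith) 0
  · refine (setIntegral_cube_movHat_le s2.continuous hl ht (le_refl (r + l)) 2).trans ?_
    gcongr
    refine (setIntegral_cube_movAvg_le s1.continuous hl ht (le_refl (r + l + l)) 1).trans ?_
    exact setIntegral_cube_movAvg_le s0.continuous hl ht (by linarith) 0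

lemma matEnergy_errPot_le (hf : ∀ j, Smooth (f j)) (hl : 0 < l) (ht : 1 ≤ t)
    (h : r + 3 * l ≤ ρ) :
    matEnergy t r (errPot l f) ≤ 3 * (l ^ t * ∑ j, ∫ x in cube ρ, |f j x| ^ t) := by
  calc matEnergy t r (errPot l f)
      ≤ ∑ _i : Fin 3, ∑ j, l ^ t * ∫ x in cube ρ, |f j x| ^ t :=
        Finset.sum_le_sum fun i _ => Finset.sum_le_sum fun j _ =>
          setIntegral_cube_errPot_le hf hl ht h i j
    _ = _ := by
        simp only [Finset.mul_sum, Finset.sum_const, Finset.card_univ,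
          Fintype.card_fin, nsmul_eq_mul]
        push_cast; ring

lemma pd_errPot (hf : ∀ j, Smooth (f j)) (l : ℝ) (i j k : Fin 3) :
    pd k (errPot l f i j) = errPot l (fun j => pd k (f j)) i j := by
  fin_cases i
  · exact pd_movHat (hf j) l 0 k
  · change pd k (movHat l 1 _) = movHat l 1 _
    rw [pd_movHat ((hf j).movAvg l 0), pd_movAvg (hf j)]
  · change pd k (movHat l 2 _) = movHat l 2 _
    rw [pd_movHat (((hf j).movAvg l 0).movAvg l 1), pd_movAvg ((hf j).movAvg l 0),
      pd_movAvg (hf j)]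

lemma matGradEnergy_errPot_le (hf : ∀ j, Smooth (f j)) (hl : 0 < l) (ht : 1 ≤ t)
    (h : r + 3 * l ≤ ρ) :
    matGradEnergy t r (errPot l f) ≤ 3 * (l ^ t * ∑ j, ∑ k, ∫ x in cube ρ, |pd k (f j) x| ^ t) := by
  calc matGradEnergy t r (errPot l f)
      ≤ ∑ _i : Fin 3, ∑ j, ∑ k, l ^ t * ∫ x in cube ρ, |pd k (f j) x| ^ t :=
        Finset.sum_le_sum fun i _ => Finset.sum_le_sum fun j _ => Finset.sum_le_sum fun k _ => by
          rw [pd_errPot hf]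
          exact setIntegral_cube_errPot_le (fun j => (hf j).pd k) hl ht h i j
    _ = _ := by
        simp only [Finset.mul_sum, Finset.sum_const, Finset.card_univ,
          Fintype.card_fin, nsmul_eq_mul]
        push_cast; rfl

lemma sum_pd_movAvg_eq_zero (hf : ∀ j, Smooth (f j)) (hf0 : ∀ x, ∑ j, pd j (f j) x = 0) (l : ℝ)
    (i : Fin 3) (x : E3) : ∑ j, pd j (movAvg l i (f j)) x = 0 := by
  have e : ∀ j, pd j (movAvg l i (f j)) = movAvg l i (pd j (f j)) := fun j => pd_movAvg (hf j) l i j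
  simp only [e]
  rw [movAvg_sum fun j => ((hf j).pd j).continuous]
  simp [movAvg, lineAvg, hf0]

end Mollified

/-- A solenoidal-corrector pair `VA - VN` solving `div v = f · ∇φ`, with quantitative bounds. -/
lemma exists_corrector (s : ℝ) (hs : 1 ≤ s) : ∃ C : ℝ, 1 ≤ C ∧
    ∀ (L ρ m l : ℝ) (φ : E3 → ℝ) (F : Fin 3 → Fin 3 → E3 → ℝ) (f : Fin 3 → E3 → ℝ),
      0 < L → 1 ≤ m → 0 < l → L + 3 * l ≤ ρ → SuppSmooth L φ →
      (∀ i x, |pd i φ x| ≤ m / L) → (∀ i j x, |pd i (pd j φ) x| ≤ m ^ 2 / L ^ 2) →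
      (∀ i j k x, |pd i (pd j (pd k φ)) x| ≤ m ^ 3 / L ^ 3) →
      (∀ i j, Smooth (F i j)) → (∀ j, Smooth (f j)) →
      (∀ j x, ∑ i, pd i (F i j) x = f j x) → (∀ x, ∑ j, pd j (f j) x = 0) →
      ∃ VA VN : Fin 3 → E3 → ℝ, (∀ i, SuppSmooth L (VA i)) ∧ (∀ i, SuppSmooth L (VN i)) ∧
        (∀ x, (∑ i, pd i (VA i) x) - ∑ i, pd i (VN i) x = ∑ j, f j x * pd j φ x) ∧
        ∀ i,
        (∫ x in cube L, |VA i x| ^ s ≤ C * (m ^ 2 / L) ^ s * matEnergy s ρ F) ∧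
        (∀ k, ∫ x in cube L, |pd k (VA i) x| ^ (2 : ℝ) ≤ C * (m ^ 3 / L) ^ (2 : ℝ)
          * (((1 / l) ^ (2 : ℝ) + (1 / L) ^ (2 : ℝ)) * matEnergy 2 ρ F)) ∧
        (∫ x in cube L, |VN i x| ^ (4 : ℝ) ≤ C * (m ^ 2 / L) ^ (4 : ℝ)
          * (l ^ (4 : ℝ) * ∑ j, ∫ x in cube ρ, |f j x| ^ (4 : ℝ))) ∧
        (∀ k, ∫ x in cube L, |pd k (VN i) x| ^ (2 : ℝ) ≤ C * (m ^ 3 / L) ^ (2 : ℝ)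
          * (l ^ (2 : ℝ) * ((∑ j, ∑ k, ∫ x in cube ρ, |pd k (f j) x| ^ (2 : ℝ))
            + (1 / L) ^ (2 : ℝ) * ∑ j, ∫ x in cube ρ, |f j x| ^ (2 : ℝ)))) := by
  obtain ⟨B1, hB1, b1⟩ := exists_opV_bounds hs
  obtain ⟨B2, hB2, b2⟩ := exists_opV_bounds (t := 2) (by norm_num)
  obtain ⟨B3, hB3, b3⟩ := exists_opV_bounds (t := 4) (by norm_num)
  refine ⟨B1 + 24 * B2 + 3 * B3, by linarith, ?_⟩
  intro L ρ m l φ F f hL hm hl hρ hφ h1 h2 h3 hF hf hdiv hf0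
  have sA := smooth_mollPot hF l
  have sN := smooth_errPot hf l
  have sf : ∀ j, Smooth (movAvg l 2 (movAvg l 1 (movAvg l 0 (f j)))) :=
    fun j => (((hf j).movAvg l 0).movAvg l 1).movAvg l 2
  have sf0 : ∀ x, ∑ j, pd j (movAvg l 2 (movAvg l 1 (movAvg l 0 (f j)))) x = 0 :=
    sum_pd_movAvg_eq_zero (fun j => ((hf j).movAvg l 0).movAvg l 1)
      (sum_pd_movAvg_eq_zero (fun j => (hf j).movAvg l 0) (sum_pd_movAvg_eq_zero hf hf0 l 0) l 1)
      l 2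
  refine ⟨opV L φ (mollPot l F), opV L φ (errPot l f), fun i => hφ.opV hL sA i,
    fun i => hφ.opV hL sN i, fun x => ?_, fun i => ⟨?_, fun k => ?_, ?_, fun k => ?_⟩⟩
  · rw [sum_pd_opV hL hφ sA sf (sum_pd_mollPot hF hdiv l) sf0,
      sum_pd_opV hL hφ sN (f := fun j x => movAvg l 2 (movAvg l 1 (movAvg l 0 (f j))) x - f j x)
        (fun j => (sf j).sub (hf j)) (sum_pd_errPot hf hl) (fun x => ?_),
      ← Finset.sum_sub_distrib]
    · exact Finset.sum_congr rfl fun j _ => by ring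
    · have e : ∀ j, pd j (fun x => movAvg l 2 (movAvg l 1 (movAvg l 0 (f j))) x - f j x) x
          = pd j (movAvg l 2 (movAvg l 1 (movAvg l 0 (f j)))) x - pd j (f j) x :=
        fun j => pd_sub (sf j) (hf j) j x
      simp only [e]
      rw [Finset.sum_sub_distrib, sf0, hf0, sub_zero]
  · have E0 := matEnergy_nonneg s ρ F
    refine (b1 L m φ _ hL hm hφ sA h1 h2 h3 i).1.trans ?_
    have e1 := matEnergy_mollPot_le hF hl hs hρ
    calc B1 * (m ^ 2 / L) ^ s * matEnergy s L (mollPot l F)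
        ≤ B1 * (m ^ 2 / L) ^ s * matEnergy s ρ F := mul_le_mul_of_nonneg_left e1 (by positivity)
      _ ≤ _ := by gcongr; linarith
  · have E0 := matEnergy_nonneg 2 ρ F
    refine ((b2 L m φ _ hL hm hφ sA h1 h2 h3 i).2 k).trans ?_
    have e1 := matEnergy_mollPot_le hF hl (t := 2) (by norm_num) hρ
    have e2 := matGradEnergy_mollPot_le hF hl (t := 2) (by norm_num) hρ
    have e3 : (2 : ℝ) ^ ((2 : ℝ) + 1) = 8 := by
      rw [show (2 : ℝ) + 1 = ((3 : ℕ) : ℝ) by norm_num, rpow_natCast]; norm_num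
    rw [e3] at e2
    calc B2 * (m ^ 3 / L) ^ (2 : ℝ) * (matGradEnergy 2 L (mollPot l F)
          + (1 / L) ^ (2 : ℝ) * matEnergy 2 L (mollPot l F))
        ≤ B2 * (m ^ 3 / L) ^ (2 : ℝ) * (24 * (((1 / l) ^ (2 : ℝ) + (1 / L) ^ (2 : ℝ))
            * matEnergy 2 ρ F)) := by
          gcongr
          have : (1 / L) ^ (2 : ℝ) * matEnergy 2 L (mollPot l F)
            ≤ (1 / L) ^ (2 : ℝ) * matEnergy 2 ρ F := by gcongr
          have : 0 ≤ (1 / L) ^ (2 : ℝ) * matEnergy 2 ρ F := by positivity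
          nlinarith
      _ = 24 * B2 * (m ^ 3 / L) ^ (2 : ℝ) * (((1 / l) ^ (2 : ℝ) + (1 / L) ^ (2 : ℝ))
            * matEnergy 2 ρ F) := by ring
      _ ≤ _ := by gcongr; linarith
  · have E0 : 0 ≤ ∑ j, ∫ x in cube ρ, |f j x| ^ (4 : ℝ) :=
      Finset.sum_nonneg fun j _ => setIntegral_cube_abs_rpow_nonneg _ _ _
    refine (b3 L m φ _ hL hm hφ sN h1 h2 h3 i).1.trans ?_
    have e1 := matEnergy_errPot_le hf hl (t := 4) (by norm_num) hρ
    calc _ ≤ B3 * (m ^ 2 / L) ^ (4 : ℝ)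
          * (3 * (l ^ (4 : ℝ) * ∑ j, ∫ x in cube ρ, |f j x| ^ (4 : ℝ))) := by gcongr
      _ = 3 * B3 * (m ^ 2 / L) ^ (4 : ℝ)
          * (l ^ (4 : ℝ) * ∑ j, ∫ x in cube ρ, |f j x| ^ (4 : ℝ)) := by ring
      _ ≤ _ := by gcongr; linarith
  · have E0 : 0 ≤ ∑ j, ∫ x in cube ρ, |f j x| ^ (2 : ℝ) :=
      Finset.sum_nonneg fun j _ => setIntegral_cube_abs_rpow_nonneg _ _ _
    have E1 : 0 ≤ ∑ j, ∑ k, ∫ x in cube ρ, |pd k (f j) x| ^ (2 : ℝ) :=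
      Finset.sum_nonneg fun j _ => Finset.sum_nonneg fun k _ =>
        setIntegral_cube_abs_rpow_nonneg _ _ _
    refine ((b2 L m φ _ hL hm hφ sN h1 h2 h3 i).2 k).trans ?_
    have e1 := matEnergy_errPot_le hf hl (t := 2) (by norm_num) hρ
    have e2 := matGradEnergy_errPot_le hf hl (t := 2) (by norm_num) hρ
    calc _ ≤ B2 * (m ^ 3 / L) ^ (2 : ℝ)
          * (3 * (l ^ (2 : ℝ) * ∑ j, ∑ k, ∫ x in cube ρ, |pd k (f j) x| ^ (2 : ℝ))
            + (1 / L) ^ (2 : ℝ) * (3 * (l ^ (2 : ℝ) * ∑ j, ∫ x in cube ρ, |f j x| ^ (2 : ℝ)))) := by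
          gcongr
      _ = 3 * B2 * (m ^ 3 / L) ^ (2 : ℝ)
          * (l ^ (2 : ℝ) * ((∑ j, ∑ k, ∫ x in cube ρ, |pd k (f j) x| ^ (2 : ℝ))
            + (1 / L) ^ (2 : ℝ) * ∑ j, ∫ x in cube ρ, |f j x| ^ (2 : ℝ))) := by ring
      _ ≤ _ := by gcongr; linarith

/-- `f` is the divergence of a smooth field supported in the cube of half-width `L`. -/
def IsSuppDiv (L : ℝ) (f : E3 → ℝ) : Prop :=
  ∃ Z : Fin 3 → E3 → ℝ, (∀ i, SuppSmooth L (Z i)) ∧ ∀ x, f x = ∑ i, pd i (Z i) x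

namespace IsSuppDiv

variable {L : ℝ} {f g φ : E3 → ℝ}

lemma add (hf : IsSuppDiv L f) (hg : IsSuppDiv L g) : IsSuppDiv L (fun x => f x + g x) := by
  obtain ⟨Z, hZ, e⟩ := hf
  obtain ⟨Y, hY, e'⟩ := hg
  refine ⟨fun i x => Z i x + Y i x, fun i => (hZ i).add (hY i), fun x => ?_⟩
  beta_reduce
  rw [e, e', ← Finset.sum_add_distrib]
  exact Finset.sum_congr rfl fun i _ => (pd_add (hZ i).smooth (hY i).smooth i x).symm

lemma const_mul (hf : IsSuppDiv L f) (c : ℝ) : IsSuppDiv L (fun x => c * f x) := by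
  obtain ⟨Z, hZ, e⟩ := hf
  refine ⟨fun i x => c * Z i x, fun i => (hZ i).mul_left contDiff_const, fun x => ?_⟩
  beta_reduce
  rw [e, Finset.mul_sum]
  exact Finset.sum_congr rfl fun i _ => (pd_const_mul (hZ i).smooth c i x).symm

lemma sum {F : Fin 3 → E3 → ℝ} (hF : ∀ j, IsSuppDiv L (F j)) :
    IsSuppDiv L (fun x => ∑ j, F j x) := by
  have h := ((hF 0).add (hF 1)).add (hF 2)
  simpa only [Fin.sum_univ_three] using h

lemma laplacian_mul (hf : Smooth f) (hg : SuppSmooth L g) :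
    IsSuppDiv L (fun x => ∑ i, pd i (pd i f) x * g x + ∑ i, pd i f x * pd i g x) :=
  ⟨fun i x => pd i f x * g x, fun i => hg.mul_left (hf.pd i), fun x => by
    beta_reduce
    rw [← Finset.sum_add_distrib]
    exact Finset.sum_congr rfl fun i _ => (pd_mul (hf.pd i) hg.smooth i x).symm⟩

/-- Transport by a solenoidal field. -/
lemma transport (hφ : SuppSmooth L φ) (hf : Smooth f) (hg : Smooth g) {b : Fin 3 → E3 → ℝ}
    (hb : ∀ i, Smooth (b i)) (hb0 : ∀ x, ∑ i, pd i (b i) x = 0) :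
    IsSuppDiv L (fun x => (∑ i, b i x * pd i g x) * (φ x * f x)
      + (∑ i, b i x * pd i f x) * (φ x * g x) + f x * g x * ∑ i, b i x * pd i φ x) := by
  refine ⟨fun i x => f x * g x * b i x * φ x,
    fun i => hφ.mul_left ((hf.mul hg).mul (hb i)), fun x => ?_⟩
  have e : ∀ i, pd i (fun x => f x * g x * b i x * φ x) x
      = ((pd i f x * g x + f x * pd i g x) * b i x + f x * g x * pd i (b i) x) * φ x
        + f x * g x * b i x * pd i φ x := by
    intro i
    rw [pd_mul ((hf.mul hg).mul (hb i)) hφ.smooth, pd_mul (hf.mul hg) (hb i), pd_mul hf hg]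
  have h0 := hb0 x
  simp only [e, Fin.sum_univ_three] at h0 ⊢
  linear_combination (-(f x * g x * φ x)) * h0

lemma gradient_mul (hf : Smooth f) {ζ : Fin 3 → E3 → ℝ} (hζ : ∀ i, SuppSmooth L (ζ i)) :
    IsSuppDiv L (fun x => ∑ i, pd i f x * ζ i x + f x * ∑ i, pd i (ζ i) x) :=
  ⟨fun i x => f x * ζ i x, fun i => (hζ i).mul_left hf, fun x => by
    beta_reduce
    rw [Finset.mul_sum, ← Finset.sum_add_distrib]
    exact Finset.sum_congr rfl fun i _ => (pd_mul hf (hζ i).smooth i x).symm⟩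

lemma cross {w ζ : Fin 3 → E3 → ℝ} (hw : ∀ i, Smooth (w i)) (hζ : ∀ i, SuppSmooth L (ζ i)) :
    IsSuppDiv L (fun x => ∑ i, ζ i x * (pd (i + 1) (w (i + 2)) x - pd (i + 2) (w (i + 1)) x)
      - ∑ i, w i x * (pd (i + 1) (ζ (i + 2)) x - pd (i + 2) (ζ (i + 1)) x)) := by
  refine ⟨fun i x => w (i + 1) x * ζ (i + 2) x - w (i + 2) x * ζ (i + 1) x, fun i =>
    ((hζ _).mul_left (hw _)).sub ((hζ _).mul_left (hw _)), fun x => ?_⟩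
  have e : ∀ i, pd i (fun x => w (i + 1) x * ζ (i + 2) x - w (i + 2) x * ζ (i + 1) x) x
      = pd i (w (i + 1)) x * ζ (i + 2) x + w (i + 1) x * pd i (ζ (i + 2)) x
        - (pd i (w (i + 2)) x * ζ (i + 1) x + w (i + 2) x * pd i (ζ (i + 1)) x) := by
    intro i
    rw [pd_sub ((hw _).mul (hζ _).smooth) ((hw _).mul (hζ _).smooth), pd_mul (hw _) (hζ _).smooth,
      pd_mul (hw _) (hζ _).smooth]
  simp only [e, Fin.sum_univ_three, Fin.isValue, Fin.reduceAdd, zero_add]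
  ring

lemma gradient_swap (hφ : SuppSmooth L φ) {u : Fin 3 → E3 → ℝ} (hu : ∀ i, Smooth (u i))
    (hu0 : ∀ x, ∑ i, pd i (u i) x = 0) :
    IsSuppDiv L (fun x => φ x * (∑ j, ∑ i, pd i (u j) x * pd j (u i) x)
      + ∑ j, ∑ i, pd i φ x * u j x * pd j (u i) x) := by
  have h := IsSuppDiv.sum fun j : Fin 3 => (⟨fun i x => u j x * pd j (u i) x * φ x,
    fun i => hφ.mul_left ((hu j).mul ((hu i).pd j)), fun _ => rfl⟩ :
    IsSuppDiv L (fun x => ∑ i, pd i (fun x => u j x * pd j (u i) x * φ x) x))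
  convert h using 2 with x
  have e : ∀ i j, pd i (fun x => u j x * pd j (u i) x * φ x) x
      = (pd i (u j) x * pd j (u i) x + u j x * pd j (pd i (u i)) x) * φ x
        + u j x * pd j (u i) x * pd i φ x := by
    intro i j
    rw [pd_mul ((hu j).mul ((hu i).pd j)) hφ.smooth, pd_mul (hu j) ((hu i).pd j)]
    rw [show pd i (pd j (u i)) x = pd j (pd i (u i)) x from pd_comm (hu i) i j x]
  have e0 : ∀ j, ∑ i, pd j (pd i (u i)) x = 0 := by
    intro j
    rw [← pd_sum Finset.univ (fun i => (hu i).pd i)]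
    simp only [hu0, pd_const]
  have h0 := e0 0
  have h1 := e0 1
  have h2 := e0 2
  simp only [e, Fin.sum_univ_three] at h0 h1 h2 ⊢
  linear_combination (-(u 0 x * φ x)) * h0 - u 1 x * φ x * h1 - u 2 x * φ x * h2

end IsSuppDiv

/-- The pointwise energy identity, as an algebraic statement about the values of the fields and
their derivatives. -/
lemma energy_algebra (φ : ℝ) (p u w b v lu lw lb q d : Fin 3 → ℝ) (U W B V : Fin 3 → Fin 3 → ℝ)
    (hφ : 0 ≤ φ)
    (hu : ∀ j, -lu j + (∑ i, u i * U i j) + q j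
      = (W (j + 1) (j + 2) - W (j + 2) (j + 1)) + ∑ i, b i * B i j)
    (hw : ∀ j, -lw j + (∑ i, u i * W i j)
      = d j + (U (j + 1) (j + 2) - U (j + 2) (j + 1)) - 2 * w j)
    (hb : ∀ j, -lb j + (∑ i, u i * B i j) = ∑ i, b i * U i j) :
    φ * (1 / 3 * (∑ j, ∑ i, U i j ^ 2) + (∑ j, ∑ i, B i j ^ 2) + (∑ j, ∑ i, W i j ^ 2)
        + 1 / 2 * ∑ j, w j ^ 2)
      ≤ (∑ j, (lu j * (φ * u j - v j) + ∑ i, U i j * (p i * u j + φ * U i j - V i j)))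
        + (∑ j, (lw j * (φ * w j) + ∑ i, W i j * (p i * w j + φ * W i j)))
        + (∑ j, (lb j * (φ * b j) + ∑ i, B i j * (p i * b j + φ * B i j)))
        - (∑ j, ((∑ i, u i * U i j) * (φ * u j) + 1 / 2 * (u j ^ 2 * ∑ i, u i * p i)))
        - (∑ j, ((∑ i, u i * W i j) * (φ * w j) + 1 / 2 * (w j ^ 2 * ∑ i, u i * p i)))
        - (∑ j, ((∑ i, u i * B i j) * (φ * b j) + 1 / 2 * (b j ^ 2 * ∑ i, u i * p i)))
        - (∑ j, q j * (φ * u j - v j))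
        + (∑ j, ((∑ i, b i * B i j) * (φ * u j) + (∑ i, b i * U i j) * (φ * b j)
            + u j * b j * ∑ i, b i * p i))
        + ((∑ j, d j * (φ * w j)) + (∑ i, W i i) * ∑ j, (p j * w j + φ * W j j))
        + ((∑ j, (φ * u j - v j) * (W (j + 1) (j + 2) - W (j + 2) (j + 1)))
            - ∑ j, w j * ((p (j + 1) * u (j + 2) + φ * U (j + 1) (j + 2) - V (j + 1) (j + 2))
              - (p (j + 2) * u (j + 1) + φ * U (j + 2) (j + 1) - V (j + 2) (j + 1))))
        - 2 / 3 * (φ * (∑ j, ∑ i, U i j * U j i) + ∑ j, ∑ i, p i * u j * U j i)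
        + (2 / 3 * (∑ j, ∑ i, p i * u j * U j i)
          - (∑ j, ∑ i, p i * u j * U i j) - (∑ j, ∑ i, p i * w j * W i j)
          - (∑ j, ∑ i, p i * b j * B i j) + (∑ j, ∑ i, U i j * V i j)
          + (∑ j, ∑ i, u i * U i j * v j) - (∑ j, ∑ i, b i * B i j * v j)
          + 1 / 2 * (∑ j, ∑ i, (u j ^ 2 + w j ^ 2 + b j ^ 2) * u i * p i)
          - (∑ j, ∑ i, u j * b j * b i * p i)
          - (∑ j, ∑ i, p j * w j * W i i)
          + (∑ j, w j * (p (j + 1) * u (j + 2) - p (j + 2) * u (j + 1)))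
          - ∑ j, w j * (V (j + 1) (j + 2) - V (j + 2) (j + 1))) := by
  have key : 0 ≤ φ * ((∑ i, W i i) ^ 2 + 3 / 2 * ∑ j,
      (w j - 2 / 3 * (U (j + 1) (j + 2) - U (j + 2) (j + 1))) ^ 2) :=
    mul_nonneg hφ (by positivity)
  have u0 := hu 0
  have u1 := hu 1
  have u2 := hu 2
  have w0 := hw 0
  have w1 := hw 1
  have w2 := hw 2
  have b0 := hb 0
  have b1 := hb 1
  have b2 := hb 2
  simp only [Fin.sum_univ_three, Fin.isValue, Fin.reduceAdd, zero_add] at *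
  linear_combination key + (φ * u 0 - v 0) * u0 + (φ * u 1 - v 1) * u1 + (φ * u 2 - v 2) * u2
    + φ * w 0 * w0 + φ * w 1 * w1 + φ * w 2 * w2
    + φ * b 0 * b0 + φ * b 1 * b1 + φ * b 2 * b2

lemma abs_sum_fin_three_le {f : Fin 3 → ℝ} {c : ℝ} (h : ∀ i, |f i| ≤ c) : |∑ i, f i| ≤ 3 * c := by
  refine (Finset.abs_sum_le_sum_abs _ _).trans ((Finset.sum_le_sum fun i _ => h i).trans ?_)
  simp

lemma abs_mul_mul_le {x y z a b c : ℝ} (hx : |x| ≤ a) (hy : |y| ≤ b) (hz : |z| ≤ c) :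
    |x * y * z| ≤ a * b * c := by
  have := abs_nonneg x
  have := abs_nonneg y
  have := abs_nonneg z
  rw [abs_mul, abs_mul]
  gcongr
  · exact mul_nonneg (by linarith) (by linarith)
  · linarith

lemma energy_remainder_le (p u w b v : Fin 3 → ℝ) (U W B V : Fin 3 → Fin 3 → ℝ)
    {D a g dv va : ℝ} (hp : ∀ i, |p i| ≤ D) (hu : ∀ i, |u i| ≤ a) (hb : ∀ i, |b i| ≤ a)
    (hw : ∀ i, |w i| ≤ a) (hwg : ∀ i, |w i| ≤ g) (hU : ∀ i j, |U i j| ≤ g)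
    (hW : ∀ i j, |W i j| ≤ g) (hB : ∀ i j, |B i j| ≤ g) (hV : ∀ i j, |V i j| ≤ dv)
    (hv : ∀ i, |v i| ≤ va) :
    2 / 3 * (∑ j, ∑ i, p i * u j * U j i)
          - (∑ j, ∑ i, p i * u j * U i j) - (∑ j, ∑ i, p i * w j * W i j)
          - (∑ j, ∑ i, p i * b j * B i j) + (∑ j, ∑ i, U i j * V i j)
          + (∑ j, ∑ i, u i * U i j * v j) - (∑ j, ∑ i, b i * B i j * v j)
          + 1 / 2 * (∑ j, ∑ i, (u j ^ 2 + w j ^ 2 + b j ^ 2) * u i * p i)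
          - (∑ j, ∑ i, u j * b j * b i * p i)
          - (∑ j, ∑ i, p j * w j * W i i)
          + (∑ j, w j * (p (j + 1) * u (j + 2) - p (j + 2) * u (j + 1)))
          - ∑ j, w j * (V (j + 1) (j + 2) - V (j + 2) (j + 1))
      ≤ 60 * (D * a * g + D * a ^ 3 + g * dv + a * g * va) := by
  have D0 := (abs_nonneg _).trans (hp 0)
  have a0 := (abs_nonneg _).trans (hu 0)
  have g0 := (abs_nonneg _).trans (hwg 0)
  have d0 := (abs_nonneg _).trans (hV 0 0)
  have v0 := (abs_nonneg _).trans (hv 0)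
  have two : ∀ {f : Fin 3 → Fin 3 → ℝ} {c : ℝ}, (∀ j i, |f j i| ≤ c) →
      |∑ j, ∑ i, f j i| ≤ 3 * (3 * c) :=
    fun h => abs_sum_fin_three_le fun j => abs_sum_fin_three_le fun i => h j i
  have sq : ∀ {x : ℝ}, |x| ≤ a → x ^ 2 ≤ a ^ 2 := fun h => sq_le_sq' (by linarith [neg_le_of_abs_le h])
    (le_of_abs_le h)
  have t1 := abs_le.1 (two fun j i => abs_mul_mul_le (hp i) (hu j) (hU j i))
  have t2 := abs_le.1 (two fun j i => abs_mul_mul_le (hp i) (hu j) (hU i j))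
  have t3 := abs_le.1 (two fun j i => abs_mul_mul_le (hp i) (hw j) (hW i j))
  have t4 := abs_le.1 (two fun j i => abs_mul_mul_le (hp i) (hb j) (hB i j))
  have t5 := abs_le.1 (two (f := fun j i => U i j * V i j) fun j i => by
    rw [abs_mul]; exact mul_le_mul (hU i j) (hV i j) (abs_nonneg _) g0)
  have t6 := abs_le.1 (two fun j i => abs_mul_mul_le (hu i) (hU i j) (hv j))
  have t7 := abs_le.1 (two fun j i => abs_mul_mul_le (hb i) (hB i j) (hv j))
  have t8 := abs_le.1 (two (f := fun j i => (u j ^ 2 + w j ^ 2 + b j ^ 2) * u i * p i) fun j i =>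
    abs_mul_mul_le (a := 3 * a ^ 2) (by
      rw [abs_of_nonneg (by positivity)]
      linarith [sq (hu j), sq (hw j), sq (hb j)]) (hu i) (hp i))
  have t9 := abs_le.1 (two (f := fun j i => u j * b j * b i * p i) fun j i =>
    abs_mul_mul_le (a := a * a) (by
      rw [abs_mul]; exact mul_le_mul (hu j) (hb j) (abs_nonneg _) a0) (hb i) (hp i))
  have t10 := abs_le.1 (two (f := fun j i => p j * w j * W i i) fun j i =>
    abs_mul_mul_le (hp j) (hw j) (hW i i))
  have t11 := abs_le.1 (abs_sum_fin_three_le (f := fun j => w j * (p (j + 1) * u (j + 2)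
    - p (j + 2) * u (j + 1))) (c := g * (2 * (D * a))) fun j => by
      rw [abs_mul]
      refine mul_le_mul (hwg j) ((abs_sub _ _).trans ?_) (abs_nonneg _) g0
      rw [abs_mul, abs_mul]
      have := mul_le_mul (hp (j + 1)) (hu (j + 2)) (abs_nonneg _) D0
      have := mul_le_mul (hp (j + 2)) (hu (j + 1)) (abs_nonneg _) D0
      linarith)
  have t12 := abs_le.1 (abs_sum_fin_three_le (f := fun j => w j * (V (j + 1) (j + 2)
    - V (j + 2) (j + 1))) (c := g * (2 * dv)) fun j => by
      rw [abs_mul]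
      refine mul_le_mul (hwg j) ((abs_sub _ _).trans ?_) (abs_nonneg _) g0
      linarith [hV (j + 1) (j + 2), hV (j + 2) (j + 1)])
  have := mul_nonneg (mul_nonneg D0 a0) g0
  have := mul_nonneg D0 (pow_nonneg a0 3)
  have := mul_nonneg g0 d0
  have := mul_nonneg (mul_nonneg a0 g0) v0
  linarith [t1, t2, t3, t4, t5, t6, t7, t8, t9, t10, t11, t12]

/-- The stationary magneto-micropolar system for the components of the fields. -/
structure MMPComponents (u w b : Fin 3 → E3 → ℝ) (P : E3 → ℝ) : Prop where
  smooth_u : ∀ j, Smooth (u j)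
  smooth_w : ∀ j, Smooth (w j)
  smooth_b : ∀ j, Smooth (b j)
  smooth_P : Smooth P
  eq_u : ∀ x j, -(∑ i, pd i (pd i (u j)) x) + (∑ i, u i x * pd i (u j) x) + pd j P x
    = (pd (j + 1) (w (j + 2)) x - pd (j + 2) (w (j + 1)) x) + ∑ i, b i x * pd i (b j) x
  eq_w : ∀ x j, -(∑ i, pd i (pd i (w j)) x) + (∑ i, u i x * pd i (w j) x)
    = pd j (fun y => ∑ i, pd i (w i) y) x
      + (pd (j + 1) (u (j + 2)) x - pd (j + 2) (u (j + 1)) x) - 2 * w j x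
  eq_b : ∀ x j, -(∑ i, pd i (pd i (b j)) x) + (∑ i, u i x * pd i (b j) x)
    = ∑ i, b i x * pd i (u j) x
  div_u : ∀ x, ∑ i, pd i (u i) x = 0
  div_b : ∀ x, ∑ i, pd i (b i) x = 0

/-- Sum of the absolute values of the components. -/
def vecSize (v : Fin 3 → E3 → ℝ) (x : E3) : ℝ := ∑ j, |v j x|

/-- Sum of the absolute values of the first derivatives of the components. -/
def vecGradSize (v : Fin 3 → E3 → ℝ) (x : E3) : ℝ := ∑ j, ∑ i, |pd i (v j) x|

/-- Squared gradient of a triple of component functions. -/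
def vecGradSq (v : Fin 3 → E3 → ℝ) (x : E3) : ℝ := ∑ j, ∑ i, pd i (v j) x ^ 2

section Sizes

variable {v : Fin 3 → E3 → ℝ}

lemma le_vecSize (v : Fin 3 → E3 → ℝ) (j : Fin 3) (x : E3) : |v j x| ≤ vecSize v x :=
  Finset.single_le_sum (f := fun j => |v j x|) (fun _ _ => abs_nonneg _) (Finset.mem_univ j)

lemma vecSize_nonneg (v : Fin 3 → E3 → ℝ) (x : E3) : 0 ≤ vecSize v x :=
  Finset.sum_nonneg fun _ _ => abs_nonneg _

lemma vecGradSize_nonneg (v : Fin 3 → E3 → ℝ) (x : E3) : 0 ≤ vecGradSize v x :=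
  Finset.sum_nonneg fun _ _ => Finset.sum_nonneg fun _ _ => abs_nonneg _

lemma vecGradSq_nonneg (v : Fin 3 → E3 → ℝ) (x : E3) : 0 ≤ vecGradSq v x :=
  Finset.sum_nonneg fun _ _ => Finset.sum_nonneg fun _ _ => sq_nonneg _

lemma le_vecGradSize (v : Fin 3 → E3 → ℝ) (i j : Fin 3) (x : E3) :
    |pd i (v j) x| ≤ vecGradSize v x :=
  (Finset.single_le_sum (f := fun i => |pd i (v j) x|) (fun _ _ => abs_nonneg _)
    (Finset.mem_univ i)).trans (Finset.single_le_sum (f := fun j => ∑ i, |pd i (v j) x|)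
      (fun _ _ => Finset.sum_nonneg fun _ _ => abs_nonneg _) (Finset.mem_univ j))

lemma continuous_vecSize (hv : ∀ j, Smooth (v j)) : Continuous (vecSize v) :=
  continuous_finsetSum _ fun j _ => (hv j).continuous.abs

lemma continuous_vecGradSize (hv : ∀ j, Smooth (v j)) : Continuous (vecGradSize v) :=
  continuous_finsetSum _ fun j _ => continuous_finsetSum _ fun i _ =>
    ((hv j).pd i).continuous.abs

lemma continuous_vecGradSq (hv : ∀ j, Smooth (v j)) : Continuous (vecGradSq v) :=
  continuous_finsetSum _ fun j _ => continuous_finsetSum _ fun i _ =>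
    ((hv j).pd i).continuous.pow 2

end Sizes

namespace MMPComponents

variable {u w b : Fin 3 → E3 → ℝ} {P φ : E3 → ℝ} {v : Fin 3 → E3 → ℝ} {L D : ℝ}

/-- The local energy inequality obtained by testing the momentum equation with the solenoidal
field `φ u - v` and the other two equations with `φ w` and `φ b`. -/
lemma energy_le (S : MMPComponents u w b P) (hφ : SuppSmooth L φ) (h0 : ∀ x, 0 ≤ φ x)
    (hD : ∀ i x, |pd i φ x| ≤ D) (hv : ∀ i, SuppSmooth L (v i))
    (hdiv : ∀ x, ∑ i, pd i (v i) x = ∑ j, u j x * pd j φ x) :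
    ∫ x in cube L, φ x * (1 / 3 * vecGradSq u x + vecGradSq b x + vecGradSq w x
        + 1 / 2 * ∑ j, w j x ^ 2)
      ≤ ∫ x in cube L, 60 * (D * (vecSize u x + vecSize b x + vecSize w x)
          * (vecSize w x + vecGradSize u x + vecGradSize b x + vecGradSize w x)
        + D * (vecSize u x + vecSize b x + vecSize w x) ^ 3
        + (vecSize w x + vecGradSize u x + vecGradSize b x + vecGradSize w x) * vecGradSize v x
        + (vecSize u x + vecSize b x + vecSize w x)
          * (vecSize w x + vecGradSize u x + vecGradSize b x + vecGradSize w x) * vecSize v x) := by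
  have hu := S.smooth_u
  have hw := S.smooth_w
  have hb := S.smooth_b
  have hζ : ∀ j, SuppSmooth L (fun x => φ x * u j x - v j x) := fun j => by
    have : SuppSmooth L (fun x => u j x * φ x - v j x) := (hφ.mul_left (hu j)).sub (hv j)
    simpa only [mul_comm] using this
  have hm : ∀ {f}, Smooth f → SuppSmooth L (fun x => φ x * f x) := fun hf => by
    have := hφ.mul_left hf
    simpa only [mul_comm] using this
  have hd : Smooth (fun y => ∑ i, pd i (w i) y) := ContDiff.sum fun i _ => (hw i).pd i
  have N := (((((((((IsSuppDiv.sum fun j => IsSuppDiv.laplacian_mul (hu j) (hζ j)).add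
    (IsSuppDiv.sum fun j => IsSuppDiv.laplacian_mul (hw j) (hm (hw j)))).add
    (IsSuppDiv.sum fun j => IsSuppDiv.laplacian_mul (hb j) (hm (hb j)))).add
    ((IsSuppDiv.sum fun j => IsSuppDiv.transport hφ (hu j) (hu j) hu S.div_u).const_mul
      (-(1 / 2)))).add
    ((IsSuppDiv.sum fun j => IsSuppDiv.transport hφ (hw j) (hw j) hu S.div_u).const_mul
      (-(1 / 2)))).add
    ((IsSuppDiv.sum fun j => IsSuppDiv.transport hφ (hb j) (hb j) hu S.div_u).const_mul
      (-(1 / 2)))).add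
    ((IsSuppDiv.gradient_mul S.smooth_P hζ).const_mul (-1))).add
    (IsSuppDiv.sum fun j => IsSuppDiv.transport hφ (hu j) (hb j) hb S.div_b)).add
    (IsSuppDiv.gradient_mul hd fun j => hm (hw j))).add
    ((IsSuppDiv.cross hw hζ).add ((IsSuppDiv.gradient_swap hφ hu S.div_u).const_mul (-(2 / 3))))
  obtain ⟨Z, hZ, e⟩ := N
  have cu := continuous_vecSize hu
  have cw := continuous_vecSize hw
  have cb := continuous_vecSize hb
  have cv := continuous_vecSize fun j => (hv j).smooth
  have gu := continuous_vecGradSize hu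
  have gw := continuous_vecGradSize hw
  have gb := continuous_vecGradSize hb
  have gv := continuous_vecGradSize fun j => (hv j).smooth
  have su := continuous_vecGradSq hu
  have sw := continuous_vecGradSq hw
  have sb := continuous_vecGradSq hb
  have cφ := hφ.smooth.continuous
  have cwj := fun j => (hw j).continuous
  refine setIntegral_cube_le_of_div (by fun_prop) (by fun_prop) (fun i => (hZ i).smooth.one)
    (fun i => (hZ i).zero) fun x _ => ?_
  rw [← e x]
  have pζ : ∀ i j, pd i (fun x => φ x * u j x - v j x) x
      = pd i φ x * u j x + φ x * pd i (u j) x - pd i (v j) x := fun i j => by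
    rw [pd_sub (hφ.smooth.mul (hu j)) (hv j).smooth, pd_mul hφ.smooth (hu j)]
  have pw : ∀ i j, pd i (fun x => φ x * w j x) x = pd i φ x * w j x + φ x * pd i (w j) x :=
    fun i j => pd_mul hφ.smooth (hw j) i x
  have pb : ∀ i j, pd i (fun x => φ x * b j x) x = pd i φ x * b j x + φ x * pd i (b j) x :=
    fun i j => pd_mul hφ.smooth (hb j) i x
  have pd0 : ∑ j, (pd j φ x * u j x + φ x * pd j (u j) x - pd j (v j) x) = 0 := by
    rw [Finset.sum_sub_distrib, Finset.sum_add_distrib, ← Finset.mul_sum, S.div_u, hdiv]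
    simp [mul_comm]
  have A := energy_algebra (φ x) (fun i => pd i φ x) (fun i => u i x) (fun i => w i x)
    (fun i => b i x) (fun i => v i x) _ _ _ _ _ (fun i j => pd i (u j) x) (fun i j => pd i (w j) x)
    (fun i j => pd i (b j) x) (fun i j => pd i (v j) x) (h0 x) (S.eq_u x) (S.eq_w x) (S.eq_b x)
  have n0 := vecSize_nonneg u x
  have n1 := vecSize_nonneg w x
  have n2 := vecSize_nonneg b x
  have n3 := vecGradSize_nonneg u x
  have n4 := vecGradSize_nonneg w x
  have n5 := vecGradSize_nonneg b x
  have Rm := energy_remainder_le (fun i => pd i φ x) (fun i => u i x) (fun i => w i x)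
    (fun i => b i x) (fun i => v i x) (fun i j => pd i (u j) x) (fun i j => pd i (w j) x)
    (fun i j => pd i (b j) x) (fun i j => pd i (v j) x) (D := D)
    (a := vecSize u x + vecSize b x + vecSize w x)
    (g := vecSize w x + vecGradSize u x + vecGradSize b x + vecGradSize w x)
    (dv := vecGradSize v x) (va := vecSize v x) (fun i => hD i x)
    (fun i => by linarith [le_vecSize u i x]) (fun i => by linarith [le_vecSize b i x])
    (fun i => by linarith [le_vecSize w i x]) (fun i => by linarith [le_vecSize w i x])
    (fun i j => by linarith [le_vecGradSize u i j x])
    (fun i j => by linarith [le_vecGradSize w i j x])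
    (fun i j => by linarith [le_vecGradSize b i j x])
    (fun i j => le_vecGradSize v i j x) (fun i => le_vecSize v i x)
  refine A.trans ?_
  rw [add_comm]
  refine add_le_add Rm (le_of_eq ?_)
  simp only [pζ, pw, pb, pd0]
  simp only [Fin.sum_univ_three, Fin.isValue, Fin.reduceAdd, zero_add]
  ring

end MMPComponents

/-- Integral bounds on the factors of the remainder in the local energy inequality. -/
structure RemainderData (s B L R m X : ℝ) (a g α ν d : E3 → ℝ) : Prop where
  one_le_B : 1 ≤ B
  one_le_R : 1 ≤ R
  one_le_m : 1 ≤ m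
  one_le_X : 1 ≤ X
  cont_a : Continuous a
  cont_g : Continuous g
  cont_α : Continuous α
  cont_ν : Continuous ν
  cont_d : Continuous d
  a_nonneg : ∀ x, 0 ≤ a x
  g_nonneg : ∀ x, 0 ≤ g x
  α_nonneg : ∀ x, 0 ≤ α x
  ν_nonneg : ∀ x, 0 ≤ ν x
  d_nonneg : ∀ x, 0 ≤ d x
  a_sq : ∫ x in cube L, a x ^ 2 ≤ B * (m ^ 2 * (R ^ (5 / 3 : ℝ) * X ^ (1 / 2 : ℝ)))
  a_cube : ∫ x in cube L, a x ^ 3 ≤ B * (R * (m ^ 4 * X) ^ (9 / (s + 6)))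
  a_six : ∫ x in cube L, a x ^ 6 ≤ B * (m ^ 4 * X) ^ 3
  g_sq : ∫ x in cube L, g x ^ 2 ≤ B * X
  d_sq : ∫ x in cube L, d x ^ 2 ≤ B * (m ^ 8 * X ^ (5 / 6 : ℝ))
  α_rpow : ∫ x in cube L, α x ^ s ≤ B * ((m ^ 2 / R) ^ s * R ^ (s / 3 + 2))
  ν_four : ∫ x in cube L, ν x ^ 4 ≤ B * (m ^ 8 * (R ^ (-2 / 3 : ℝ) * X ^ (-5 / 3 : ℝ)
    * (m ^ 4 * X) ^ (1 + 2 / 3 * (9 / (s + 6)))))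

lemma rpow_le_mul_rpow {I B Y p : ℝ} (hI : 0 ≤ I) (hB : 1 ≤ B) (hY : 0 ≤ Y) (hp : 0 ≤ p)
    (hp1 : p ≤ 1) (h : I ≤ B * Y) : I ^ p ≤ B * Y ^ p := by
  calc I ^ p ≤ (B * Y) ^ p := rpow_le_rpow hI h hp
    _ = B ^ p * Y ^ p := mul_rpow (by linarith) hY
    _ ≤ B ^ (1 : ℝ) * Y ^ p := by gcongr
    _ = B * Y ^ p := by rw [rpow_one]

/-- The exponent of the local energy growth estimate. -/
def growthExp (s : ℝ) : ℝ := max (11 / 12) (9 / (s + 6))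

lemma setIntegral_cube_nonneg {f : E3 → ℝ} (h : ∀ x, 0 ≤ f x) (r : ℝ) : 0 ≤ ∫ x in cube r, f x :=
  integral_nonneg h

namespace RemainderData

variable {s B L R m X : ℝ} {a g α ν d : E3 → ℝ}

lemma integral_a_mul_g (H : RemainderData s B L R m X a g α ν d) :
    ∫ x in cube L, m / R * a x * g x ≤ B ^ 2 * (m ^ 8 * X ^ growthExp s) := by
  have hB := H.one_le_B
  have hR := H.one_le_R
  have hm := H.one_le_m
  have hX := H.one_le_X
  have h := setIntegral_cube_mul_le H.cont_a H.cont_g H.a_nonneg H.g_nonneg L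
  have h1 := rpow_le_mul_rpow (p := 1 / 2) (setIntegral_cube_nonneg (fun x => by positivity) L)
    hB (by positivity) (by norm_num) (by norm_num) H.a_sq
  have h2 := rpow_le_mul_rpow (p := 1 / 2) (setIntegral_cube_nonneg (fun x => by positivity) L)
    hB (by positivity) (by norm_num) (by norm_num) H.g_sq
  have e : ∫ x in cube L, m / R * a x * g x = m / R * ∫ x in cube L, a x * g x := by
    rw [← integral_const_mul]; simp only [mul_assoc]
  have hθ : 11 / 12 ≤ growthExp s := le_max_left _ _
  calc ∫ x in cube L, m / R * a x * g x
      ≤ m / R * ((B * (m ^ 2 * (R ^ (5 / 3 : ℝ) * X ^ (1 / 2 : ℝ))) ^ (1 / 2 : ℝ))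
          * (B * X ^ (1 / 2 : ℝ))) := by
        rw [e]
        refine mul_le_mul_of_nonneg_left (h.trans (mul_le_mul h1 h2 ?_ ?_)) (by positivity)
        · exact rpow_nonneg (setIntegral_cube_nonneg (fun x => by positivity) L) _
        · positivity
    _ = B ^ 2 * (m / R * (m ^ 2 * (R ^ (5 / 3 : ℝ) * X ^ (1 / 2 : ℝ))) ^ (1 / 2 : ℝ)
          * X ^ (1 / 2 : ℝ)) := by ring
    _ ≤ B ^ 2 * (m ^ 8 * X ^ growthExp s) := by
        refine mul_le_mul_of_nonneg_left ?_ (by positivity)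
        obtain ⟨ρ, rfl⟩ : ∃ ρ, R = exp ρ := ⟨log R, (exp_log (by linarith)).symm⟩
        obtain ⟨μ, rfl⟩ : ∃ μ, m = exp μ := ⟨log m, (exp_log (by linarith)).symm⟩
        obtain ⟨ξ, rfl⟩ : ∃ ξ, X = exp ξ := ⟨log X, (exp_log (by linarith)).symm⟩
        rw [one_le_exp_iff] at hR hm hX
        simp only [← exp_mul, ← exp_nat_mul, ← exp_add, ← exp_sub, exp_le_exp]
        push_cast
        nlinarith [mul_le_mul_of_nonneg_left hθ hX]

lemma integral_a_cube (H : RemainderData s B L R m X a g α ν d) (hs : 3 < s) :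
    ∫ x in cube L, m / R * a x ^ 3 ≤ B ^ 2 * (m ^ 8 * X ^ growthExp s) := by
  have hB := H.one_le_B
  have hR := H.one_le_R
  have hm := H.one_le_m
  have hX := H.one_le_X
  have hθ : 9 / (s + 6) ≤ growthExp s := le_max_right _ _
  have ha1 : 9 / (s + 6) ≤ 1 := by rw [div_le_one (by linarith)]; linarith
  have ha0 : 0 < 9 / (s + 6) := by have : 0 < s + 6 := by linarith
                                   positivity
  calc ∫ x in cube L, m / R * a x ^ 3
      ≤ m / R * (B * (R * (m ^ 4 * X) ^ (9 / (s + 6)))) := by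
        rw [integral_const_mul]
        exact mul_le_mul_of_nonneg_left H.a_cube (by positivity)
    _ = B * (m / R * R * (m ^ 4 * X) ^ (9 / (s + 6))) := by ring
    _ ≤ B ^ 2 * (m ^ 8 * X ^ growthExp s) := by
        refine mul_le_mul (by nlinarith) ?_ (by positivity) (by positivity)
        obtain ⟨ρ, rfl⟩ : ∃ ρ, R = exp ρ := ⟨log R, (exp_log (by linarith)).symm⟩
        obtain ⟨μ, rfl⟩ : ∃ μ, m = exp μ := ⟨log m, (exp_log (by linarith)).symm⟩
        obtain ⟨ξ, rfl⟩ : ∃ ξ, X = exp ξ := ⟨log X, (exp_log (by linarith)).symm⟩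
        rw [one_le_exp_iff] at hR hm hX
        simp only [← exp_mul, ← exp_nat_mul, ← exp_add, ← exp_sub, exp_le_exp]
        push_cast
        nlinarith [mul_le_mul_of_nonneg_left hθ hX, mul_le_mul_of_nonneg_left ha1 hm]

lemma integral_g_mul_d (H : RemainderData s B L R m X a g α ν d) :
    ∫ x in cube L, g x * d x ≤ B ^ 2 * (m ^ 8 * X ^ growthExp s) := by
  have hB := H.one_le_B
  have hm := H.one_le_m
  have hX := H.one_le_X
  have h := setIntegral_cube_mul_le H.cont_g H.cont_d H.g_nonneg H.d_nonneg L
  have h1 := rpow_le_mul_rpow (p := 1 / 2) (setIntegral_cube_nonneg (fun x => by positivity) L)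
    hB (by positivity) (by norm_num) (by norm_num) H.g_sq
  have h2 := rpow_le_mul_rpow (p := 1 / 2) (setIntegral_cube_nonneg (fun x => by positivity) L)
    hB (by positivity) (by norm_num) (by norm_num) H.d_sq
  have hθ : 11 / 12 ≤ growthExp s := le_max_left _ _
  calc ∫ x in cube L, g x * d x
      ≤ (B * X ^ (1 / 2 : ℝ)) * (B * (m ^ 8 * X ^ (5 / 6 : ℝ)) ^ (1 / 2 : ℝ)) := by
        refine h.trans (mul_le_mul h1 h2 ?_ ?_)
        · exact rpow_nonneg (setIntegral_cube_nonneg (fun x => by positivity) L) _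
        · positivity
    _ = B ^ 2 * (X ^ (1 / 2 : ℝ) * (m ^ 8 * X ^ (5 / 6 : ℝ)) ^ (1 / 2 : ℝ)) := by ring
    _ ≤ B ^ 2 * (m ^ 8 * X ^ growthExp s) := by
        refine mul_le_mul_of_nonneg_left ?_ (by positivity)
        obtain ⟨μ, rfl⟩ : ∃ μ, m = exp μ := ⟨log m, (exp_log (by linarith)).symm⟩
        obtain ⟨ξ, rfl⟩ : ∃ ξ, X = exp ξ := ⟨log X, (exp_log (by linarith)).symm⟩
        rw [one_le_exp_iff] at hm hX
        simp only [← exp_mul, ← exp_nat_mul, ← exp_add, exp_le_exp]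
        push_cast
        nlinarith [mul_le_mul_of_nonneg_left hθ hX]

lemma integral_a_mul_g_mul_α (H : RemainderData s B L R m X a g α ν d) (hs : 3 < s) (hs6 : s ≤ 6) :
    ∫ x in cube L, a x * g x * α x ≤ B ^ 4 * (m ^ 8 * X ^ growthExp s) := by
  have hB := H.one_le_B
  have hR := H.one_le_R
  have hm := H.one_le_m
  have hX := H.one_le_X
  have s0 : 0 < s := by linarith
  have hθ : 9 / (s + 6) ≤ growthExp s := le_max_right _ _
  have ha1 : 9 / (s + 6) ≤ 1 := by rw [div_le_one (by linarith)]; linarith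
  have i1 : 1 / s ≤ 1 / 3 := one_div_le_one_div_of_le (by norm_num) hs.le
  have i2 : 1 / 6 ≤ 1 / s := one_div_le_one_div_of_le s0 hs6
  have h := setIntegral_cube_mul_rpow_le (f₁ := fun x => α x ^ s) (f₂ := fun x => g x ^ 2)
    (f₃ := fun x => a x ^ 3) (f₄ := fun x => a x ^ 6) (H.cont_α.rpow_const fun x => Or.inr s0.le)
    (H.cont_g.pow 2) (H.cont_a.pow 3) (H.cont_a.pow 6) (fun x => rpow_nonneg (H.α_nonneg x) s)
    (fun x => by positivity) (fun x => pow_nonneg (H.a_nonneg x) 3) (fun x => by positivity)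
    (p₁ := 1 / s) (p₂ := 1 / 2) (p₃ := 2 / 3 - 2 * (1 / s)) (p₄ := 1 / s - 1 / 6) (by positivity)
    (by norm_num) (by linarith) (by linarith) (by ring) L
  have e : ∀ x, (α x ^ s) ^ (1 / s) * (g x ^ 2) ^ (1 / 2 : ℝ) * (a x ^ 3) ^ (2 / 3 - 2 * (1 / s))
      * (a x ^ 6) ^ (1 / s - 1 / 6) = a x * g x * α x := by
    intro x
    have a0 := H.a_nonneg x
    rw [← rpow_mul (H.α_nonneg x), mul_one_div_cancel s0.ne', rpow_one, ← sqrt_eq_rpow,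
      sqrt_sq (H.g_nonneg x), ← rpow_natCast, ← rpow_natCast, ← rpow_mul a0, ← rpow_mul a0,
      mul_assoc, ← rpow_add_of_nonneg a0 (by push_cast; linarith) (by push_cast; linarith)]
    have : ((3 : ℕ) : ℝ) * (2 / 3 - 2 * (1 / s)) + ((6 : ℕ) : ℝ) * (1 / s - 1 / 6) = 1 := by
      push_cast; ring
    rw [this, rpow_one]; ring
  simp only [e] at h
  have h1 := rpow_le_mul_rpow (p := 1 / s)
    (setIntegral_cube_nonneg (fun x => rpow_nonneg (H.α_nonneg x) s) L)
    hB (by positivity) (by positivity) (by linarith) H.α_rpow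
  have h2 := rpow_le_mul_rpow (p := 1 / 2) (setIntegral_cube_nonneg (fun x => by positivity) L)
    hB (by positivity) (by norm_num) (by norm_num) H.g_sq
  have h3 := rpow_le_mul_rpow (p := 2 / 3 - 2 * (1 / s))
    (setIntegral_cube_nonneg (fun x => pow_nonneg (H.a_nonneg x) 3) L)
    hB (by positivity) (by linarith) (by linarith) H.a_cube
  have h4 := rpow_le_mul_rpow (p := 1 / s - 1 / 6)
    (setIntegral_cube_nonneg (fun x => by positivity) L)
    hB (by positivity) (by linarith) (by linarith) H.a_six
  have p2 : 0 ≤ (∫ x in cube L, g x ^ 2) ^ (1 / 2 : ℝ) :=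
    rpow_nonneg (setIntegral_cube_nonneg (fun x => by positivity) L) _
  have p3 : 0 ≤ (∫ x in cube L, a x ^ 3) ^ (2 / 3 - 2 * (1 / s)) :=
    rpow_nonneg (setIntegral_cube_nonneg (fun x => pow_nonneg (H.a_nonneg x) 3) L) _
  have p4 : 0 ≤ (∫ x in cube L, a x ^ 6) ^ (1 / s - 1 / 6) :=
    rpow_nonneg (setIntegral_cube_nonneg (fun x => by positivity) L) _
  calc ∫ x in cube L, a x * g x * α x
      ≤ (B * ((m ^ 2 / R) ^ s * R ^ (s / 3 + 2)) ^ (1 / s)) * (B * X ^ (1 / 2 : ℝ))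
        * (B * (R * (m ^ 4 * X) ^ (9 / (s + 6))) ^ (2 / 3 - 2 * (1 / s)))
        * (B * ((m ^ 4 * X) ^ 3) ^ (1 / s - 1 / 6)) := by
        refine h.trans ?_
        have q1 := mul_le_mul h1 h2 p2 (by positivity)
        have q2 := mul_le_mul q1 h3 p3 (by positivity)
        exact mul_le_mul q2 h4 p4 (by positivity)
    _ = B ^ 4 * (((m ^ 2 / R) ^ s * R ^ (s / 3 + 2)) ^ (1 / s) * X ^ (1 / 2 : ℝ)
        * (R * (m ^ 4 * X) ^ (9 / (s + 6))) ^ (2 / 3 - 2 * (1 / s))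
        * ((m ^ 4 * X) ^ 3) ^ (1 / s - 1 / 6)) := by ring
    _ ≤ B ^ 4 * (m ^ 8 * X ^ growthExp s) := by
        refine mul_le_mul_of_nonneg_left ?_ (by positivity)
        obtain ⟨ρ, rfl⟩ : ∃ ρ, R = exp ρ := ⟨log R, (exp_log (by linarith)).symm⟩
        obtain ⟨μ, rfl⟩ : ∃ μ, m = exp μ := ⟨log m, (exp_log (by linarith)).symm⟩
        obtain ⟨ξ, rfl⟩ : ∃ ξ, X = exp ξ := ⟨log X, (exp_log (by linarith)).symm⟩
        rw [one_le_exp_iff] at hR hm hX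
        simp only [← exp_mul, ← exp_nat_mul, ← exp_add, ← exp_sub, exp_le_exp]
        push_cast
        have k : 9 / (s + 6) * (1 / 3 + 2 * (1 / s)) = 3 * (1 / s) := by field_simp; ring
        have k1 : s * (1 / s) = 1 := mul_one_div_cancel s0.ne'
        have e1 : (((2 * μ - ρ) * s + ρ * (s / 3 + 2)) * (1 / s) + ξ * (1 / 2)
            + (ρ + (4 * μ + ξ) * (9 / (s + 6))) * (2 / 3 - 2 * (1 / s))
            + 3 * (4 * μ + ξ) * (1 / s - 1 / 6))
            = 2 * μ + 4 * μ * (9 / (s + 6)) + ξ * (9 / (s + 6)) - 2 * μ := by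
          linear_combination (2 * μ - ρ + ρ / 3) * k1 - (4 * μ + ξ) * k
        rw [e1]
        nlinarith [mul_le_mul_of_nonneg_left hθ hX, mul_le_mul_of_nonneg_left ha1 hm]

lemma integral_a_mul_g_mul_ν (H : RemainderData s B L R m X a g α ν d) (hs : 3 < s) :
    ∫ x in cube L, a x * g x * ν x ≤ B ^ 4 * (m ^ 8 * X ^ growthExp s) := by
  have hB := H.one_le_B
  have hR := H.one_le_R
  have hm := H.one_le_m
  have hX := H.one_le_X
  have hθ : 11 / 12 ≤ growthExp s := le_max_left _ _
  have ha1 : 9 / (s + 6) ≤ 1 := by rw [div_le_one (by linarith)]; linarith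
  have h := setIntegral_cube_mul_rpow_le (f₁ := fun x => ν x ^ 4) (f₂ := fun x => g x ^ 2)
    (f₃ := fun x => a x ^ 3) (f₄ := fun x => a x ^ 6) (H.cont_ν.pow 4)
    (H.cont_g.pow 2) (H.cont_a.pow 3) (H.cont_a.pow 6) (fun x => by positivity)
    (fun x => by positivity) (fun x => pow_nonneg (H.a_nonneg x) 3) (fun x => by positivity)
    (p₁ := 1 / 4) (p₂ := 1 / 2) (p₃ := 1 / 6) (p₄ := 1 / 12) (by positivity)
    (by norm_num) (by norm_num) (by norm_num) (by norm_num) L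
  have e : ∀ x, (ν x ^ 4) ^ (1 / 4 : ℝ) * (g x ^ 2) ^ (1 / 2 : ℝ) * (a x ^ 3) ^ (1 / 6 : ℝ)
      * (a x ^ 6) ^ (1 / 12 : ℝ) = a x * g x * ν x := by
    intro x
    have a0 := H.a_nonneg x
    rw [← rpow_natCast (ν x), ← rpow_mul (H.ν_nonneg x), ← sqrt_eq_rpow,
      sqrt_sq (H.g_nonneg x), ← rpow_natCast, ← rpow_natCast, ← rpow_mul a0, ← rpow_mul a0,
      mul_assoc, ← rpow_add_of_nonneg a0 (by push_cast; norm_num) (by push_cast; norm_num)]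
    have : ((3 : ℕ) : ℝ) * (1 / 6) + ((6 : ℕ) : ℝ) * (1 / 12) = 1 := by norm_num
    rw [this, rpow_one]
    have : ((4 : ℕ) : ℝ) * (1 / 4) = 1 := by norm_num
    rw [this, rpow_one]; ring
  simp only [e] at h
  have h1 := rpow_le_mul_rpow (p := 1 / 4) (setIntegral_cube_nonneg (fun x => by positivity) L)
    hB (by positivity) (by norm_num) (by norm_num) H.ν_four
  have h2 := rpow_le_mul_rpow (p := 1 / 2) (setIntegral_cube_nonneg (fun x => by positivity) L)
    hB (by positivity) (by norm_num) (by norm_num) H.g_sq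
  have h3 := rpow_le_mul_rpow (p := 1 / 6)
    (setIntegral_cube_nonneg (fun x => pow_nonneg (H.a_nonneg x) 3) L)
    hB (by positivity) (by norm_num) (by norm_num) H.a_cube
  have h4 := rpow_le_mul_rpow (p := 1 / 12)
    (setIntegral_cube_nonneg (fun x => by positivity) L)
    hB (by positivity) (by norm_num) (by norm_num) H.a_six
  have p2 : 0 ≤ (∫ x in cube L, g x ^ 2) ^ (1 / 2 : ℝ) :=
    rpow_nonneg (setIntegral_cube_nonneg (fun x => by positivity) L) _
  have p3 : 0 ≤ (∫ x in cube L, a x ^ 3) ^ (1 / 6 : ℝ) :=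
    rpow_nonneg (setIntegral_cube_nonneg (fun x => pow_nonneg (H.a_nonneg x) 3) L) _
  have p4 : 0 ≤ (∫ x in cube L, a x ^ 6) ^ (1 / 12 : ℝ) :=
    rpow_nonneg (setIntegral_cube_nonneg (fun x => by positivity) L) _
  calc ∫ x in cube L, a x * g x * ν x
      ≤ (B * (m ^ 8 * (R ^ (-2 / 3 : ℝ) * X ^ (-5 / 3 : ℝ)
          * (m ^ 4 * X) ^ (1 + 2 / 3 * (9 / (s + 6))))) ^ (1 / 4 : ℝ)) * (B * X ^ (1 / 2 : ℝ))
        * (B * (R * (m ^ 4 * X) ^ (9 / (s + 6))) ^ (1 / 6 : ℝ))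
        * (B * ((m ^ 4 * X) ^ 3) ^ (1 / 12 : ℝ)) := by
        refine h.trans ?_
        have q1 := mul_le_mul h1 h2 p2 (by positivity)
        have q2 := mul_le_mul q1 h3 p3 (by positivity)
        exact mul_le_mul q2 h4 p4 (by positivity)
    _ = B ^ 4 * ((m ^ 8 * (R ^ (-2 / 3 : ℝ) * X ^ (-5 / 3 : ℝ)
          * (m ^ 4 * X) ^ (1 + 2 / 3 * (9 / (s + 6))))) ^ (1 / 4 : ℝ) * X ^ (1 / 2 : ℝ)
        * (R * (m ^ 4 * X) ^ (9 / (s + 6))) ^ (1 / 6 : ℝ)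
        * ((m ^ 4 * X) ^ 3) ^ (1 / 12 : ℝ)) := by ring
    _ ≤ B ^ 4 * (m ^ 8 * X ^ growthExp s) := by
        refine mul_le_mul_of_nonneg_left ?_ (by positivity)
        obtain ⟨ρ, rfl⟩ : ∃ ρ, R = exp ρ := ⟨log R, (exp_log (by linarith)).symm⟩
        obtain ⟨μ, rfl⟩ : ∃ μ, m = exp μ := ⟨log m, (exp_log (by linarith)).symm⟩
        obtain ⟨ξ, rfl⟩ : ∃ ξ, X = exp ξ := ⟨log X, (exp_log (by linarith)).symm⟩
        rw [one_le_exp_iff] at hR hm hX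
        simp only [← exp_mul, ← exp_nat_mul, ← exp_add, exp_le_exp]
        push_cast
        nlinarith [mul_le_mul_of_nonneg_left hθ hX, mul_le_mul_of_nonneg_left ha1 hm,
          mul_le_mul_of_nonneg_left ha1 hX]

lemma integral_le (H : RemainderData s B L R m X a g α ν d) (hs : 3 < s) (hs6 : s ≤ 6) :
    ∫ x in cube L, 60 * (m / R * a x * g x + m / R * a x ^ 3 + g x * d x
      + a x * g x * (α x + ν x)) ≤ 300 * B ^ 4 * (m ^ 8 * X ^ growthExp s) := by
  have ca := H.cont_a
  have cg := H.cont_g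
  have cα := H.cont_α
  have cν := H.cont_ν
  have cd := H.cont_d
  have hB := H.one_le_B
  have hY : 0 ≤ m ^ 8 * X ^ growthExp s :=
    mul_nonneg (pow_nonneg (by linarith [H.one_le_m]) 8) (rpow_nonneg (by linarith [H.one_le_X]) _)
  have hB2 : B ^ 2 * (m ^ 8 * X ^ growthExp s) ≤ B ^ 4 * (m ^ 8 * X ^ growthExp s) :=
    mul_le_mul_of_nonneg_right (pow_le_pow_right₀ hB (by norm_num)) hY
  have e : ∫ x in cube L, 60 * (m / R * a x * g x + m / R * a x ^ 3 + g x * d x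
      + a x * g x * (α x + ν x)) = 60 * ((∫ x in cube L, m / R * a x * g x)
        + (∫ x in cube L, m / R * a x ^ 3) + (∫ x in cube L, g x * d x)
        + ((∫ x in cube L, a x * g x * α x) + ∫ x in cube L, a x * g x * ν x)) := by
    rw [integral_const_mul]
    simp only [mul_add]
    rw [integral_add, integral_add, integral_add, integral_add]
    all_goals try exact Continuous.integrableOn_cube (by fun_prop) L
    ring
  rw [e]
  linarith [H.integral_a_mul_g, H.integral_a_cube hs, H.integral_g_mul_d,
    H.integral_a_mul_g_mul_α hs hs6, H.integral_a_mul_g_mul_ν hs]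

end RemainderData

/-- A potential `F` of the vector field `f`, with growth bounds on a cube at scale `R`. -/
structure PotentialBounds (s A R ρ : ℝ) (f : Fin 3 → E3 → ℝ) (F : Fin 3 → Fin 3 → E3 → ℝ) :
    Prop where
  smooth : ∀ i j, Smooth (F i j)
  div_eq : ∀ j x, ∑ i, pd i (F i j) x = f j x
  sq_le : ∀ i j, ∫ x in cube ρ, (F i j x) ^ 2 ≤ A * R ^ (10 / 3 : ℝ)
  rpow_le : ∀ i j, ∫ x in cube ρ, |F i j x| ^ s ≤ A * R ^ (s / 3 + 2)

lemma setIntegral_cube_sum_abs_rpow_le {ι : Type*} [Fintype ι] {f : ι → E3 → ℝ}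
    (hf : ∀ n, Continuous (f n)) {t : ℝ} (ht : 1 ≤ t) {r B : ℝ}
    (h : ∀ n, ∫ x in cube r, |f n x| ^ t ≤ B) :
    ∫ x in cube r, (∑ n, |f n x|) ^ t
      ≤ (Fintype.card ι : ℝ) ^ t * ((Fintype.card ι : ℝ) * B) := by
  have h1 := setIntegral_cube_sum_rpow_le (fun n => (hf n).abs) ht r
  have e : ∀ x, |(∑ n, |f n x|)| = ∑ n, |f n x| := fun x =>
    abs_of_nonneg (Finset.sum_nonneg fun _ _ => abs_nonneg _)
  simp only [e, abs_abs] at h1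
  refine h1.trans (mul_le_mul_of_nonneg_left ?_ (by positivity))
  refine (Finset.sum_le_sum fun n _ => h n).trans ?_
  simp

lemma setIntegral_cube_vecSize_rpow_le {v : Fin 3 → E3 → ℝ} (hv : ∀ j, Smooth (v j)) {t : ℝ}
    (ht : 1 ≤ t) {r B : ℝ} (h : ∀ j, ∫ x in cube r, |v j x| ^ t ≤ B) :
    ∫ x in cube r, vecSize v x ^ t ≤ 3 ^ t * (3 * B) := by
  simpa [vecSize] using setIntegral_cube_sum_abs_rpow_le (fun j => (hv j).continuous) ht h

lemma setIntegral_cube_vecGradSize_sq_le {v : Fin 3 → E3 → ℝ} (hv : ∀ j, Smooth (v j)) {r B : ℝ}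
    (h : ∀ j k, ∫ x in cube r, |pd k (v j) x| ^ (2 : ℝ) ≤ B) :
    ∫ x in cube r, vecGradSize v x ^ 2 ≤ 729 * B := by
  have := setIntegral_cube_sum_abs_rpow_le (f := fun n : Fin 3 × Fin 3 => pd n.2 (v n.1))
    (fun n => ((hv n.1).pd n.2).continuous) (t := 2) (by norm_num) (fun n => h n.1 n.2)
  simp only [Fintype.sum_prod_type, Fintype.card_prod, Fintype.card_fin, rpow_two] at this
  refine this.trans (le_of_eq ?_)
  push_cast
  ring

lemma setIntegral_cube_triple_rpow_le {f g h : E3 → ℝ} (hf : Continuous f) (hg : Continuous g)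
    (hh : Continuous h) (f0 : ∀ x, 0 ≤ f x) (g0 : ∀ x, 0 ≤ g x) (h0 : ∀ x, 0 ≤ h x) {t : ℝ}
    (ht : 1 ≤ t) {r B : ℝ} (bf : ∫ x in cube r, f x ^ t ≤ B) (bg : ∫ x in cube r, g x ^ t ≤ B)
    (bh : ∫ x in cube r, h x ^ t ≤ B) :
    ∫ x in cube r, (f x + g x + h x) ^ t ≤ 3 ^ t * (3 * B) := by
  have := setIntegral_cube_sum_abs_rpow_le (f := ![f, g, h]) (r := r) (B := B)
    (fun n => by fin_cases n <;> assumption) ht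
    (fun n => by
      fin_cases n
      · change ∫ x in cube r, |f x| ^ t ≤ B
        simpa only [abs_of_nonneg (f0 _)] using bf
      · change ∫ x in cube r, |g x| ^ t ≤ B
        simpa only [abs_of_nonneg (g0 _)] using bg
      · change ∫ x in cube r, |h x| ^ t ≤ B
        simpa only [abs_of_nonneg (h0 _)] using bh)
  simpa [Fin.sum_univ_three, abs_of_nonneg, f0, g0, h0] using this

/-- The three Lebesgue bounds for a component of a field with controlled potential. -/
structure ComponentBounds (s B R m X ρ : ℝ) (h : E3 → ℝ) : Prop where
  two : ∫ x in cube ρ, |h x| ^ (2 : ℝ) ≤ B * (m ^ 2 * (R ^ (5 / 3 : ℝ) * X ^ (1 / 2 : ℝ)))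
  three : ∫ x in cube ρ, |h x| ^ (3 : ℝ) ≤ B * (R * (m ^ 4 * X) ^ (9 / (s + 6)))
  six : ∫ x in cube ρ, |h x| ^ (6 : ℝ) ≤ B * (m ^ 4 * X) ^ 3

lemma exists_component_bounds (s A : ℝ) (hs : 3 < s) (hs6 : s ≤ 6) (hA : 1 ≤ A) :
    ∃ C : ℝ, 1 ≤ C ∧ ∀ (R m ρ ρ₁ X : ℝ) (ψ : E3 → ℝ) (f : Fin 3 → E3 → ℝ)
      (F : Fin 3 → Fin 3 → E3 → ℝ), 1 ≤ R → 1 ≤ m → 1 ≤ X → ρ₁ ≤ ρ → SuppSmooth ρ ψ →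
      (∀ x, 0 ≤ ψ x) → (∀ x, ψ x ≤ 1) → (∀ x ∈ cube ρ₁, ψ x = 1) → (∀ i x, |pd i ψ x| ≤ m / R) →
      (∀ j, Smooth (f j)) → PotentialBounds s A R ρ f F →
      (∀ j i, ∫ x in cube ρ, pd i (f j) x ^ 2 ≤ X) →
      ∀ j, ComponentBounds s C R m X ρ₁ (f j) := by
  obtain ⟨C, hC, h⟩ := exists_potential_estimates s A hs hs6 hA
  refine ⟨C, hC, fun R m ρ ρ₁ X ψ f F hR hm hX hρ hψ ψ0 ψ1 ψe ψd hf hF hfX j => ?_⟩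
  obtain ⟨e2, e3, e6⟩ := h R m ρ X ψ (f j) (fun i => F i j)
    { one_le_R := hR, one_le_m := hm, one_le_X := hX, supp := hψ, nonneg := ψ0, le_one := ψ1
      abs_pd_le := ψd, smooth_h := hf j, smooth_F := fun i => hF.smooth i j
      div_eq := hF.div_eq j, sq_le := fun i => hF.sq_le i j, rpow_le := fun i => hF.rpow_le i j
      grad_le := hfX j }
  have cf := (hf j).continuous
  have cψ := hψ.smooth.continuous
  have key : ∀ (n k : ℕ), ∫ x in cube ρ₁, |f j x| ^ n ≤ ∫ x in cube ρ, ψ x ^ k * |f j x| ^ n := by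
    intro n k
    refine (setIntegral_cube_mono (g := fun x => ψ x ^ k * |f j x| ^ n) (by fun_prop)
      (by fun_prop) fun x hx => by rw [ψe x hx, one_pow, one_mul]).trans ?_
    exact setIntegral_cube_mono_radius (by fun_prop)
      (fun x => mul_nonneg (pow_nonneg (ψ0 x) k) (by positivity)) hρ
  refine ⟨?_, ?_, ?_⟩
  · simp only [rpow_ofNat]
    exact (key 2 2).trans (e2.trans (le_of_eq (by ring)))
  · simp only [rpow_ofNat]
    exact (key 3 4).trans (e3.trans (le_of_eq (by ring)))
  · simp only [rpow_ofNat]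
    refine (key 6 12).trans (le_trans (le_of_eq ?_) e6)
    congr 1 with x
    ring

lemma ComponentBounds.four {s B R m X ρ : ℝ} {h : E3 → ℝ} (H : ComponentBounds s B R m X ρ h)
    (hh : Continuous h) (hB : 1 ≤ B) (hR : 1 ≤ R) (hm : 1 ≤ m) (hX : 1 ≤ X) :
    ∫ x in cube ρ, |h x| ^ (4 : ℝ)
      ≤ B ^ 2 * (R ^ (2 / 3 : ℝ) * (m ^ 4 * X) ^ (1 + 2 / 3 * (9 / (s + 6)))) := by
  have h1 := setIntegral_cube_mul_rpow_le (f₁ := fun x => |h x| ^ (3 : ℝ))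
    (f₂ := fun x => |h x| ^ (6 : ℝ)) (f₃ := fun _ => 1) (f₄ := fun _ => 1)
    (hh.abs_rpow (by norm_num)) (hh.abs_rpow (by norm_num)) continuous_const continuous_const
    (fun x => by positivity) (fun x => by positivity) (fun x => by positivity)
    (fun x => by positivity) (p₁ := 2 / 3) (p₂ := 1 / 3) (p₃ := 0) (p₄ := 0) (by norm_num)
    (by norm_num) le_rfl le_rfl (by norm_num) ρ
  have e : ∀ x, (|h x| ^ (3 : ℝ)) ^ (2 / 3 : ℝ) * (|h x| ^ (6 : ℝ)) ^ (1 / 3 : ℝ)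
      = |h x| ^ (4 : ℝ) := fun x => by
    rw [← rpow_mul (abs_nonneg _), ← rpow_mul (abs_nonneg _),
      ← rpow_add_of_nonneg (abs_nonneg _) (by norm_num) (by norm_num)]
    norm_num
  simp only [rpow_zero, mul_one, e] at h1
  have a1 := rpow_le_mul_rpow (p := 2 / 3) (setIntegral_cube_nonneg (fun x => by positivity) ρ)
    hB (by positivity) (by norm_num) (by norm_num) H.three
  have a2 := rpow_le_mul_rpow (p := 1 / 3) (setIntegral_cube_nonneg (fun x => by positivity) ρ)
    hB (by positivity) (by norm_num) (by norm_num) H.six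
  have hΞ : 0 < m ^ 4 * X := by positivity
  calc ∫ x in cube ρ, |h x| ^ (4 : ℝ)
      ≤ (B * (R * (m ^ 4 * X) ^ (9 / (s + 6))) ^ (2 / 3 : ℝ))
          * (B * ((m ^ 4 * X) ^ 3) ^ (1 / 3 : ℝ)) :=
        h1.trans (mul_le_mul a1 a2
          (rpow_nonneg (setIntegral_cube_nonneg (fun x => by positivity) ρ) _) (by positivity))
    _ = _ := by
        rw [mul_rpow (by positivity) (by positivity), ← rpow_mul hΞ.le, ← rpow_natCast (_ * X),
          ← rpow_mul hΞ.le, rpow_add hΞ, mul_comm (9 / (s + 6))]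
        norm_num
        ring

lemma vecGradSize_sq_le (v : Fin 3 → E3 → ℝ) (x : E3) : vecGradSize v x ^ 2 ≤ 9 * vecGradSq v x := by
  have h1 : ∀ j, (∑ i, |pd i (v j) x|) ^ 2 ≤ 3 * ∑ i, pd i (v j) x ^ 2 := fun j => by
    simpa using sq_sum_le_card_mul_sum_sq (s := Finset.univ) (f := fun i => |pd i (v j) x|)
  have h2 := sq_sum_le_card_mul_sum_sq (s := (Finset.univ : Finset (Fin 3)))
    (f := fun j => ∑ i, |pd i (v j) x|)
  have h3 := Finset.sum_le_sum fun j (_ : j ∈ Finset.univ) => h1 j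
  simp only [Finset.card_univ, Fintype.card_fin] at h2
  rw [← Finset.mul_sum] at h3
  unfold vecGradSize vecGradSq
  push_cast at h2
  linarith

lemma vecSize_sq_le (v : Fin 3 → E3 → ℝ) (x : E3) : vecSize v x ^ 2 ≤ 3 * ∑ j, v j x ^ 2 := by
  simpa [vecSize] using sq_sum_le_card_mul_sum_sq (s := Finset.univ) (f := fun j => |v j x|)

/-- The local energy density of a solution. -/
def energyDensity (u w b : Fin 3 → E3 → ℝ) (x : E3) : ℝ :=
  vecGradSq u x + vecGradSq b x + vecGradSq w x + ∑ j, w j x ^ 2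

/-- The local energy on a cube. -/
def energy (u w b : Fin 3 → E3 → ℝ) (r : ℝ) : ℝ := ∫ x in cube r, energyDensity u w b x

section Energy

variable {u w b : Fin 3 → E3 → ℝ}

lemma energyDensity_nonneg (u w b : Fin 3 → E3 → ℝ) (x : E3) : 0 ≤ energyDensity u w b x := by
  have := vecGradSq_nonneg u x
  have := vecGradSq_nonneg b x
  have := vecGradSq_nonneg w x
  have : 0 ≤ ∑ j, w j x ^ 2 := by positivity
  unfold energyDensity
  linarith

lemma continuous_energyDensity (hu : ∀ j, Smooth (u j)) (hw : ∀ j, Smooth (w j))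
    (hb : ∀ j, Smooth (b j)) : Continuous (energyDensity u w b) :=
  (((continuous_vecGradSq hu).add (continuous_vecGradSq hb)).add (continuous_vecGradSq hw)).add
    (continuous_finsetSum _ fun j _ => (hw j).continuous.pow 2)

lemma energy_nonneg (u w b : Fin 3 → E3 → ℝ) (r : ℝ) : 0 ≤ energy u w b r :=
  setIntegral_cube_nonneg (energyDensity_nonneg u w b) r

lemma energy_mono (hu : ∀ j, Smooth (u j)) (hw : ∀ j, Smooth (w j))
    (hb : ∀ j, Smooth (b j)) {r r' : ℝ} (h : r ≤ r') : energy u w b r ≤ energy u w b r' :=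
  setIntegral_cube_mono_radius (continuous_energyDensity hu hw hb) (energyDensity_nonneg u w b) h

lemma sq_pd_le_vecGradSq (v : Fin 3 → E3 → ℝ) (i j : Fin 3) (x : E3) :
    pd i (v j) x ^ 2 ≤ vecGradSq v x :=
  (Finset.single_le_sum (f := fun i => pd i (v j) x ^ 2) (fun _ _ => sq_nonneg _)
    (Finset.mem_univ i)).trans (Finset.single_le_sum (f := fun j => ∑ i, pd i (v j) x ^ 2)
      (fun _ _ => Finset.sum_nonneg fun _ _ => sq_nonneg _) (Finset.mem_univ j))

lemma gradient_le_energy (hu : ∀ j, Smooth (u j)) (hw : ∀ j, Smooth (w j))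
    (hb : ∀ j, Smooth (b j)) (r : ℝ) (j i : Fin 3) :
    (∫ x in cube r, pd i (u j) x ^ 2 ≤ energy u w b r) ∧
    (∫ x in cube r, pd i (w j) x ^ 2 ≤ energy u w b r) ∧
    (∫ x in cube r, pd i (b j) x ^ 2 ≤ energy u w b r) := by
  have ce := continuous_energyDensity hu hw hb
  have n : ∀ x, 0 ≤ ∑ j, w j x ^ 2 := fun x => by positivity
  refine ⟨?_, ?_, ?_⟩
  · exact setIntegral_cube_mono (f := fun x => pd i (u j) x ^ 2)
      (((hu j).pd i).continuous.pow 2) ce fun x _ => by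
      have := sq_pd_le_vecGradSq u i j x
      have := vecGradSq_nonneg b x
      have := vecGradSq_nonneg w x
      have := n x
      unfold energyDensity
      linarith
  · exact setIntegral_cube_mono (f := fun x => pd i (w j) x ^ 2)
      (((hw j).pd i).continuous.pow 2) ce fun x _ => by
      have := sq_pd_le_vecGradSq w i j x
      have := vecGradSq_nonneg b x
      have := vecGradSq_nonneg u x
      have := n x
      unfold energyDensity
      linarith
  · exact setIntegral_cube_mono (f := fun x => pd i (b j) x ^ 2)
      (((hb j).pd i).continuous.pow 2) ce fun x _ => by
      have := sq_pd_le_vecGradSq b i j x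
      have := vecGradSq_nonneg u x
      have := vecGradSq_nonneg w x
      have := n x
      unfold energyDensity
      linarith

lemma integral_gradSize_sq_le (hu : ∀ j, Smooth (u j)) (hw : ∀ j, Smooth (w j))
    (hb : ∀ j, Smooth (b j)) (r : ℝ) :
    ∫ x in cube r, (vecSize w x + vecGradSize u x + vecGradSize b x + vecGradSize w x) ^ 2
      ≤ 36 * energy u w b r := by
  have c1 := continuous_vecSize hw
  have c2 := continuous_vecGradSize hu
  have c3 := continuous_vecGradSize hb
  have c4 := continuous_vecGradSize hw
  have c5 := continuous_energyDensity hu hw hb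
  rw [energy, ← integral_const_mul]
  refine setIntegral_cube_mono (by fun_prop) (by fun_prop) fun x _ => ?_
  have h1 := vecSize_sq_le w x
  have h2 := vecGradSize_sq_le u x
  have h3 := vecGradSize_sq_le b x
  have h4 := vecGradSize_sq_le w x
  have n : 0 ≤ ∑ j, w j x ^ 2 := by positivity
  have : (vecSize w x + vecGradSize u x + vecGradSize b x + vecGradSize w x) ^ 2
      ≤ 4 * (vecSize w x ^ 2 + vecGradSize u x ^ 2 + vecGradSize b x ^ 2 + vecGradSize w x ^ 2) := by
    nlinarith [sq_nonneg (vecSize w x - vecGradSize u x), sq_nonneg (vecSize w x - vecGradSize b x),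
      sq_nonneg (vecSize w x - vecGradSize w x), sq_nonneg (vecGradSize u x - vecGradSize b x),
      sq_nonneg (vecGradSize u x - vecGradSize w x), sq_nonneg (vecGradSize b x - vecGradSize w x)]
  unfold energyDensity
  linarith

end Energy

/-- A corrector for the divergence produced by a cutoff, split as `VA - VN`. -/
structure CorrectorData (s K L R m X : ℝ) (φ : E3 → ℝ) (f : Fin 3 → E3 → ℝ)
    (VA VN : Fin 3 → E3 → ℝ) : Prop where
  supp_A : ∀ i, SuppSmooth L (VA i)
  supp_N : ∀ i, SuppSmooth L (VN i)
  div_eq : ∀ x, ∑ i, pd i (fun y => VA i y - VN i y) x = ∑ j, f j x * pd j φ x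
  A_rpow : ∀ i, ∫ x in cube L, |VA i x| ^ s ≤ K * ((m ^ 2 / R) ^ s * R ^ (s / 3 + 2))
  N_four : ∀ i, ∫ x in cube L, |VN i x| ^ (4 : ℝ) ≤ K * (m ^ 8 * (R ^ (-2 / 3 : ℝ)
    * X ^ (-5 / 3 : ℝ) * (m ^ 4 * X) ^ (1 + 2 / 3 * (9 / (s + 6)))))
  grad_sq : ∀ i k, ∫ x in cube L, |pd k (fun y => VA i y - VN i y) x| ^ (2 : ℝ)
    ≤ K * (m ^ 8 * X ^ (5 / 6 : ℝ))

lemma matEnergy_le_of_forall_le {t r B : ℝ} {F : Fin 3 → Fin 3 → E3 → ℝ}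
    (h : ∀ i j, ∫ x in cube r, |F i j x| ^ t ≤ B) : matEnergy t r F ≤ 9 * B := by
  unfold matEnergy
  refine (Finset.sum_le_sum fun i _ => Finset.sum_le_sum fun j _ => h i j).trans ?_
  simp only [Finset.sum_const, Finset.card_univ, Fintype.card_fin, nsmul_eq_mul]
  push_cast
  linarith

lemma scale_mollified_le {R m X l : ℝ} (hR : 1 ≤ R) (hm : 1 ≤ m) (hX : 1 ≤ X) (hl : 0 < l)
    (hl2 : 1 / l ≤ 2 * m * X ^ (5 / 12 : ℝ) * R ^ (-2 / 3 : ℝ)) :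
    (m ^ 3 / R) ^ 2 * ((1 / l) ^ 2 * R ^ (10 / 3 : ℝ)) ≤ 4 * (m ^ 8 * X ^ (5 / 6 : ℝ)) := by
  calc (m ^ 3 / R) ^ 2 * ((1 / l) ^ 2 * R ^ (10 / 3 : ℝ))
      ≤ (m ^ 3 / R) ^ 2 * ((2 * m * X ^ (5 / 12 : ℝ) * R ^ (-2 / 3 : ℝ)) ^ 2
          * R ^ (10 / 3 : ℝ)) := by gcongr
    _ = 4 * ((m ^ 3 / R) ^ 2 * ((m * X ^ (5 / 12 : ℝ) * R ^ (-2 / 3 : ℝ)) ^ 2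
          * R ^ (10 / 3 : ℝ))) := by ring
    _ ≤ 4 * (m ^ 8 * X ^ (5 / 6 : ℝ)) := by
        refine mul_le_mul_of_nonneg_left ?_ (by norm_num)
        obtain ⟨ρ, rfl⟩ : ∃ ρ, R = exp ρ := ⟨log R, (exp_log (by linarith)).symm⟩
        obtain ⟨μ, rfl⟩ : ∃ μ, m = exp μ := ⟨log m, (exp_log (by linarith)).symm⟩
        obtain ⟨ξ, rfl⟩ : ∃ ξ, X = exp ξ := ⟨log X, (exp_log (by linarith)).symm⟩
        simp only [← exp_mul, ← exp_nat_mul, ← exp_add, ← exp_sub, exp_le_exp]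
        push_cast
        linarith

lemma scale_remainder_four_le {R m X l Y : ℝ} (hR : 1 ≤ R) (hm : 1 ≤ m) (hX : 1 ≤ X) (hl : 0 < l)
    (hl1 : l ≤ R ^ (2 / 3 : ℝ) * X ^ (-5 / 12 : ℝ)) (hY : 0 ≤ Y) :
    (m ^ 2 / R) ^ 4 * (l ^ 4 * (R ^ (2 / 3 : ℝ) * Y))
      ≤ m ^ 8 * (R ^ (-2 / 3 : ℝ) * X ^ (-5 / 3 : ℝ) * Y) := by
  calc (m ^ 2 / R) ^ 4 * (l ^ 4 * (R ^ (2 / 3 : ℝ) * Y))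
      ≤ (m ^ 2 / R) ^ 4 * ((R ^ (2 / 3 : ℝ) * X ^ (-5 / 12 : ℝ)) ^ 4 * (R ^ (2 / 3 : ℝ) * Y)) := by
        gcongr
    _ = (m ^ 2 / R) ^ 4 * ((R ^ (2 / 3 : ℝ) * X ^ (-5 / 12 : ℝ)) ^ 4 * R ^ (2 / 3 : ℝ)) * Y := by
        ring
    _ ≤ m ^ 8 * (R ^ (-2 / 3 : ℝ) * X ^ (-5 / 3 : ℝ)) * Y := by
        refine mul_le_mul_of_nonneg_right ?_ hY
        obtain ⟨ρ, rfl⟩ : ∃ ρ, R = exp ρ := ⟨log R, (exp_log (by linarith)).symm⟩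
        obtain ⟨μ, rfl⟩ : ∃ μ, m = exp μ := ⟨log m, (exp_log (by linarith)).symm⟩
        obtain ⟨ξ, rfl⟩ : ∃ ξ, X = exp ξ := ⟨log X, (exp_log (by linarith)).symm⟩
        simp only [← exp_mul, ← exp_nat_mul, ← exp_add, ← exp_sub, exp_le_exp]
        push_cast
        linarith
    _ = _ := by ring

lemma scale_remainder_grad_le {R m X l : ℝ} (hR : 1 ≤ R) (hm : 1 ≤ m) (hX : 1 ≤ X) (hl : 0 < l)
    (hl1 : l ≤ R ^ (2 / 3 : ℝ) * X ^ (-5 / 12 : ℝ)) :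
    (m ^ 3 / R) ^ 2 * (l ^ 2 * X) ≤ m ^ 8 * X ^ (5 / 6 : ℝ) ∧
    (m ^ 3 / R) ^ 2 * (l ^ 2 * ((1 / R) ^ 2 * (m ^ 2 * (R ^ (5 / 3 : ℝ) * X ^ (1 / 2 : ℝ)))))
      ≤ m ^ 8 * X ^ (5 / 6 : ℝ) := by
  have h1 : (m ^ 3 / R) ^ 2 * (l ^ 2 * X)
      ≤ (m ^ 3 / R) ^ 2 * ((R ^ (2 / 3 : ℝ) * X ^ (-5 / 12 : ℝ)) ^ 2 * X) := by gcongr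
  have h2 : (m ^ 3 / R) ^ 2
        * (l ^ 2 * ((1 / R) ^ 2 * (m ^ 2 * (R ^ (5 / 3 : ℝ) * X ^ (1 / 2 : ℝ)))))
      ≤ (m ^ 3 / R) ^ 2 * ((R ^ (2 / 3 : ℝ) * X ^ (-5 / 12 : ℝ)) ^ 2
        * ((1 / R) ^ 2 * (m ^ 2 * (R ^ (5 / 3 : ℝ) * X ^ (1 / 2 : ℝ))))) := by gcongr
  refine ⟨h1.trans ?_, h2.trans ?_⟩
  all_goals
    obtain ⟨ρ, rfl⟩ : ∃ ρ, R = exp ρ := ⟨log R, (exp_log (by linarith)).symm⟩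
    obtain ⟨μ, rfl⟩ : ∃ μ, m = exp μ := ⟨log m, (exp_log (by linarith)).symm⟩
    obtain ⟨ξ, rfl⟩ : ∃ ξ, X = exp ξ := ⟨log X, (exp_log (by linarith)).symm⟩
    rw [one_le_exp_iff] at hR hm hX
    simp only [one_div, ← exp_neg, ← exp_mul, ← exp_nat_mul, ← exp_add, ← exp_sub, exp_le_exp]
    push_cast
    linarith

lemma exists_correctorData (s A B : ℝ) (hs : 3 < s) (hA : 1 ≤ A) (hB : 1 ≤ B) :
    ∃ K : ℝ, 1 ≤ K ∧ ∀ (R m X l L ρ ρ₁ : ℝ) (φ : E3 → ℝ) (f : Fin 3 → E3 → ℝ)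
      (F : Fin 3 → Fin 3 → E3 → ℝ), 1 ≤ R → 1 ≤ m → 1 ≤ X → 0 < l → l ≤ R → R ≤ L →
      l ≤ R ^ (2 / 3 : ℝ) * X ^ (-5 / 12 : ℝ) →
      1 / l ≤ 2 * m * X ^ (5 / 12 : ℝ) * R ^ (-2 / 3 : ℝ) → L + 3 * l ≤ ρ₁ → ρ₁ ≤ ρ →
      SuppSmooth L φ →
      (∀ i x, |pd i φ x| ≤ m / L) → (∀ i j x, |pd i (pd j φ) x| ≤ m ^ 2 / L ^ 2) →
      (∀ i j k x, |pd i (pd j (pd k φ)) x| ≤ m ^ 3 / L ^ 3) →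
      PotentialBounds s A R ρ f F → (∀ j, Smooth (f j)) → (∀ x, ∑ j, pd j (f j) x = 0) →
      (∀ j, ComponentBounds s B R m X ρ₁ (f j)) →
      (∀ j k, ∫ x in cube ρ₁, pd k (f j) x ^ 2 ≤ X) →
      ∃ VA VN, CorrectorData s K L R m X φ f VA VN := by
  obtain ⟨C, hC, h⟩ := exists_corrector s (by linarith)
  refine ⟨400 * C * A * B ^ 2, ?_, ?_⟩
  · have : 1 ≤ C * A := by nlinarith
    have : 1 ≤ C * A * B ^ 2 := by nlinarith
    linarith
  intro R m X l L ρ ρ₁ φ f F hR hm hX hl hlR hRL hl1 hl2 hLρ hρ hφ p1 p2 p3 hF hf hdiv hc hg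
  obtain ⟨VA, VN, sA, sN, hd, hb⟩ := h L ρ₁ m l φ F f (by linarith) hm hl hLρ hφ p1 p2 p3 hF.smooth
    hf hF.div_eq hdiv
  have hL : 0 < L := by linarith
  have C0 : 0 ≤ C := by linarith
  have A0 : 0 ≤ A := by linarith
  have hB2 : 1 ≤ B ^ 2 := one_le_pow₀ hB
  have hCAB : C * A ≤ C * A * B ^ 2 := le_mul_of_one_le_right (by positivity) hB2
  have hCB : C * B ^ 2 ≤ C * A * B ^ 2 := by
    refine mul_le_mul_of_nonneg_right ?_ (by positivity)
    exact le_mul_of_one_le_right C0 hA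
  have hCB' : C * B ≤ C * B ^ 2 := by
    refine mul_le_mul_of_nonneg_left ?_ C0
    nlinarith
  have hCC : C ≤ C * B := le_mul_of_one_le_right C0 hB
  have bs : matEnergy s ρ₁ F ≤ 9 * (A * R ^ (s / 3 + 2)) := matEnergy_le_of_forall_le fun i j =>
    (setIntegral_cube_mono_radius ((hF.smooth i j).continuous.abs_rpow (by linarith))
      (fun x => by positivity) hρ).trans (hF.rpow_le i j)
  have b2 : matEnergy 2 ρ₁ F ≤ 9 * (A * R ^ (10 / 3 : ℝ)) := matEnergy_le_of_forall_le fun i j => by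
    refine (setIntegral_cube_mono_radius ((hF.smooth i j).continuous.abs_rpow (by norm_num))
      (fun x => by positivity) hρ).trans ?_
    simpa only [rpow_two, sq_abs] using hF.sq_le i j
  have b4 : ∑ j, ∫ x in cube ρ₁, |f j x| ^ (4 : ℝ)
      ≤ 3 * (B ^ 2 * (R ^ (2 / 3 : ℝ) * (m ^ 4 * X) ^ (1 + 2 / 3 * (9 / (s + 6))))) := by
    refine (Finset.sum_le_sum fun j _ => (hc j).four (hf j).continuous hB hR hm hX).trans ?_
    simp
  have b2' : ∑ j, ∫ x in cube ρ₁, |f j x| ^ (2 : ℝ)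
      ≤ 3 * (B * (m ^ 2 * (R ^ (5 / 3 : ℝ) * X ^ (1 / 2 : ℝ)))) := by
    refine (Finset.sum_le_sum fun j _ => (hc j).two).trans ?_
    simp
  have bg : ∑ j, ∑ k, ∫ x in cube ρ₁, |pd k (f j) x| ^ (2 : ℝ) ≤ 9 * X := by
    simp only [rpow_two, sq_abs]
    refine (Finset.sum_le_sum fun j _ => Finset.sum_le_sum fun k _ => hg j k).trans ?_
    simp only [Finset.sum_const, Finset.card_univ, Fintype.card_fin, nsmul_eq_mul]
    push_cast
    linarith
  have n2 : 0 ≤ ∑ j, ∫ x in cube ρ₁, |f j x| ^ (2 : ℝ) :=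
    Finset.sum_nonneg fun j _ => setIntegral_cube_abs_rpow_nonneg _ _ _
  have n4 : 0 ≤ ∑ j, ∫ x in cube ρ₁, |f j x| ^ (4 : ℝ) :=
    Finset.sum_nonneg fun j _ => setIntegral_cube_abs_rpow_nonneg _ _ _
  have ng : 0 ≤ ∑ j, ∑ k, ∫ x in cube ρ₁, |pd k (f j) x| ^ (2 : ℝ) :=
    Finset.sum_nonneg fun j _ => Finset.sum_nonneg fun k _ =>
      setIntegral_cube_abs_rpow_nonneg _ _ _
  have nm2 := matEnergy_nonneg 2 ρ₁ F
  have nms := matEnergy_nonneg s ρ₁ F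
  have s0 : 0 ≤ s := by linarith
  set Z := m ^ 8 * X ^ (5 / 6 : ℝ) with hZ
  have Z0 : 0 ≤ Z := by positivity
  have gA : ∀ i k, ∫ x in cube L, |pd k (VA i) x| ^ (2 : ℝ) ≤ 72 * (C * A) * Z := fun i k => by
    have e := (hb i).2.1 k
    simp only [rpow_two] at e ⊢
    have hlL : 1 / L ≤ 1 / l := by gcongr; linarith
    calc _ ≤ _ := e
      _ ≤ C * (m ^ 3 / R) ^ 2 * (((1 / l) ^ 2 + (1 / l) ^ 2) * (9 * (A * R ^ (10 / 3 : ℝ)))) := by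
          gcongr
      _ = 18 * (C * A) * ((m ^ 3 / R) ^ 2 * ((1 / l) ^ 2 * R ^ (10 / 3 : ℝ))) := by ring
      _ ≤ 18 * (C * A) * (4 * Z) := by
          exact mul_le_mul_of_nonneg_left (scale_mollified_le hR hm hX hl hl2) (by positivity)
      _ = _ := by ring
  have gN : ∀ i k, ∫ x in cube L, |pd k (VN i) x| ^ (2 : ℝ) ≤ 12 * (C * B) * Z := fun i k => by
    have e := (hb i).2.2.2 k
    simp only [rpow_two] at e b2' bg n2 ng ⊢
    obtain ⟨q1, q2⟩ := scale_remainder_grad_le hR hm hX hl hl1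
    calc _ ≤ _ := e
      _ ≤ C * (m ^ 3 / R) ^ 2 * (l ^ 2 * (9 * X
          + (1 / R) ^ 2 * (3 * (B * (m ^ 2 * (R ^ (5 / 3 : ℝ) * X ^ (1 / 2 : ℝ))))))) := by
          gcongr
      _ = 9 * C * ((m ^ 3 / R) ^ 2 * (l ^ 2 * X)) + 3 * (C * B) * ((m ^ 3 / R) ^ 2
          * (l ^ 2 * ((1 / R) ^ 2 * (m ^ 2 * (R ^ (5 / 3 : ℝ) * X ^ (1 / 2 : ℝ)))))) := by ring
      _ ≤ 9 * (C * B) * Z + 3 * (C * B) * Z := by gcongr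
      _ = _ := by ring
  refine ⟨VA, VN, sA, sN, fun x => ?_, fun i => ?_, fun i => ?_, fun i k => ?_⟩
  · rw [← hd x, ← Finset.sum_sub_distrib]
    exact Finset.sum_congr rfl fun i _ => pd_sub (sA i).smooth (sN i).smooth i x
  · calc _ ≤ _ := (hb i).1
      _ ≤ C * (m ^ 2 / R) ^ s * (9 * (A * R ^ (s / 3 + 2))) := by gcongr
      _ = 9 * (C * A) * ((m ^ 2 / R) ^ s * R ^ (s / 3 + 2)) := by ring
      _ ≤ 400 * C * A * B ^ 2 * ((m ^ 2 / R) ^ s * R ^ (s / 3 + 2)) := by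
          refine mul_le_mul_of_nonneg_right ?_ (by positivity)
          have : 0 ≤ C * A := by positivity
          linarith
  · have e := (hb i).2.2.1
    simp only [rpow_ofNat] at e b4 n4 ⊢
    set Y := (m ^ 4 * X) ^ (1 + 2 / 3 * (9 / (s + 6))) with hY
    have Y0 : 0 ≤ Y := by positivity
    calc _ ≤ _ := e
      _ ≤ C * (m ^ 2 / R) ^ 4 * (l ^ 4 * (3 * (B ^ 2 * (R ^ (2 / 3 : ℝ) * Y)))) := by gcongr
      _ = 3 * (C * B ^ 2) * ((m ^ 2 / R) ^ 4 * (l ^ 4 * (R ^ (2 / 3 : ℝ) * Y))) := by ring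
      _ ≤ 3 * (C * B ^ 2) * (m ^ 8 * (R ^ (-2 / 3 : ℝ) * X ^ (-5 / 3 : ℝ) * Y)) := by
          exact mul_le_mul_of_nonneg_left (scale_remainder_four_le hR hm hX hl hl1 Y0)
            (by positivity)
      _ ≤ 400 * C * A * B ^ 2 * (m ^ 8 * (R ^ (-2 / 3 : ℝ) * X ^ (-5 / 3 : ℝ) * Y)) := by
          refine mul_le_mul_of_nonneg_right ?_ (by positivity)
          have : 0 ≤ C * B ^ 2 := by positivity
          linarith
  · have e : ∀ x, pd k (fun y => VA i y - VN i y) x = pd k (VA i) x - pd k (VN i) x :=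
      fun x => pd_sub (sA i).smooth (sN i).smooth k x
    simp only [e]
    refine (setIntegral_cube_sub_rpow_le ((sA i).pd k).smooth.continuous
      ((sN i).pd k).smooth.continuous (by norm_num) L).trans ?_
    have q1 := gA i k
    have q2 := gN i k
    have q : (72 * (C * A) + 12 * (C * B)) * Z ≤ 84 * (C * A * B ^ 2) * Z := by
      refine mul_le_mul_of_nonneg_right ?_ Z0
      linarith
    have : 0 ≤ C * A * B ^ 2 * Z := by positivity
    norm_num only [rpow_two] at q1 q2 ⊢
    nlinarith

section

variable {u w b VA VN : Fin 3 → E3 → ℝ} {s B K L R m X ρ : ℝ} {φ : E3 → ℝ}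

lemma setIntegral_cube_fields_rpow_le (hu : ∀ j, Smooth (u j)) (hw : ∀ j, Smooth (w j))
    (hb : ∀ j, Smooth (b j)) {t : ℝ} (ht : 1 ≤ t) {r Y : ℝ}
    (bu : ∀ j, ∫ x in cube r, |u j x| ^ t ≤ Y) (bw : ∀ j, ∫ x in cube r, |w j x| ^ t ≤ Y)
    (bb : ∀ j, ∫ x in cube r, |b j x| ^ t ≤ Y) :
    ∫ x in cube r, (vecSize u x + vecSize b x + vecSize w x) ^ t
      ≤ 3 ^ t * (3 * (3 ^ t * (3 * Y))) :=
  setIntegral_cube_triple_rpow_le (continuous_vecSize hu) (continuous_vecSize hb)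
    (continuous_vecSize hw) (vecSize_nonneg u) (vecSize_nonneg b) (vecSize_nonneg w) ht
    (setIntegral_cube_vecSize_rpow_le hu ht bu) (setIntegral_cube_vecSize_rpow_le hb ht bb)
    (setIntegral_cube_vecSize_rpow_le hw ht bw)

lemma ComponentBounds.mono {h : E3 → ℝ} (H : ComponentBounds s B R m X ρ h) (hh : Continuous h)
    (hL : L ≤ ρ) : ComponentBounds s B R m X L h where
  two := (setIntegral_cube_mono_radius (hh.abs_rpow (by norm_num)) (fun x => by positivity)
    hL).trans H.two
  three := (setIntegral_cube_mono_radius (hh.abs_rpow (by norm_num)) (fun x => by positivity)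
    hL).trans H.three
  six := (setIntegral_cube_mono_radius (hh.abs_rpow (by norm_num)) (fun x => by positivity)
    hL).trans H.six

lemma CorrectorData.remainderData (H : CorrectorData s K L R m X φ u VA VN)
    (hu : ∀ j, Smooth (u j)) (hw : ∀ j, Smooth (w j)) (hb : ∀ j, Smooth (b j))
    (hs : 3 < s) (hs6 : s ≤ 6) (hB : 1 ≤ B) (hK : 1 ≤ K) (hR : 1 ≤ R) (hm : 1 ≤ m) (hX : 1 ≤ X)
    (bu : ∀ j, ComponentBounds s B R m X L (u j)) (bw : ∀ j, ComponentBounds s B R m X L (w j))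
    (bb : ∀ j, ComponentBounds s B R m X L (b j)) (hE : energy u w b L ≤ X) :
    RemainderData s (9 ^ 7 * (B * K)) L R m X (fun x => vecSize u x + vecSize b x + vecSize w x)
      (fun x => vecSize w x + vecGradSize u x + vecGradSize b x + vecGradSize w x)
      (vecSize VA) (vecSize VN) (vecGradSize fun i x => VA i x - VN i x) := by
  have sA := fun i => (H.supp_A i).smooth
  have sN := fun i => (H.supp_N i).smooth
  have sv : ∀ i, Smooth (fun x => VA i x - VN i x) := fun i => (sA i).sub (sN i)
  have B0 : 0 ≤ B := by linarith
  have K0 : 0 ≤ K := by linarith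
  have hBK : B ≤ B * K := le_mul_of_one_le_right B0 hK
  have hKB : K ≤ B * K := le_mul_of_one_le_left K0 hB
  have h1 : 1 ≤ B * K := hB.trans hBK
  have n1 := vecSize_nonneg u
  have n2 := vecSize_nonneg b
  have n3 := vecSize_nonneg w
  have n4 := vecGradSize_nonneg u
  have n5 := vecGradSize_nonneg b
  have n6 := vecGradSize_nonneg w
  refine
    { one_le_B := by linarith
      one_le_R := hR
      one_le_m := hm
      one_le_X := hX
      cont_a := ((continuous_vecSize hu).add (continuous_vecSize hb)).add (continuous_vecSize hw)
      cont_g := (((continuous_vecSize hw).add (continuous_vecGradSize hu)).add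
        (continuous_vecGradSize hb)).add (continuous_vecGradSize hw)
      cont_α := continuous_vecSize sA
      cont_ν := continuous_vecSize sN
      cont_d := continuous_vecGradSize sv
      a_nonneg := fun x => add_nonneg (add_nonneg (n1 x) (n2 x)) (n3 x)
      g_nonneg := fun x => add_nonneg (add_nonneg (add_nonneg (n3 x) (n4 x)) (n5 x)) (n6 x)
      α_nonneg := vecSize_nonneg VA
      ν_nonneg := vecSize_nonneg VN
      d_nonneg := vecGradSize_nonneg _
      a_sq := ?_
      a_cube := ?_
      a_six := ?_
      g_sq := ?_
      d_sq := ?_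
      α_rpow := ?_
      ν_four := ?_ }
  · have := setIntegral_cube_fields_rpow_le hu hw hb (by norm_num) (fun j => (bu j).two)
      (fun j => (bw j).two) (fun j => (bb j).two)
    simp only [rpow_ofNat] at this
    refine this.trans ?_
    have p : 0 ≤ m ^ 2 * (R ^ (5 / 3 : ℝ) * X ^ (1 / 2 : ℝ)) := by positivity
    have := mul_le_mul_of_nonneg_right hBK p
    have : 0 ≤ B * K * (m ^ 2 * (R ^ (5 / 3 : ℝ) * X ^ (1 / 2 : ℝ))) := by positivity
    norm_num only at *
    linarith
  · have := setIntegral_cube_fields_rpow_le hu hw hb (by norm_num) (fun j => (bu j).three)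
      (fun j => (bw j).three) (fun j => (bb j).three)
    simp only [rpow_ofNat] at this
    refine this.trans ?_
    have p : 0 ≤ R * (m ^ 4 * X) ^ (9 / (s + 6)) := by positivity
    have := mul_le_mul_of_nonneg_right hBK p
    have : 0 ≤ B * K * (R * (m ^ 4 * X) ^ (9 / (s + 6))) := by positivity
    norm_num only at *
    linarith
  · have := setIntegral_cube_fields_rpow_le hu hw hb (by norm_num) (fun j => (bu j).six)
      (fun j => (bw j).six) (fun j => (bb j).six)
    simp only [rpow_ofNat] at this
    refine this.trans ?_
    have p : 0 ≤ (m ^ 4 * X) ^ 3 := by positivity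
    have := mul_le_mul_of_nonneg_right hBK p
    have : 0 ≤ B * K * (m ^ 4 * X) ^ 3 := by positivity
    norm_num only at *
    linarith
  · refine (integral_gradSize_sq_le hu hw hb L).trans ?_
    have := mul_le_mul_of_nonneg_right h1 (by linarith : 0 ≤ X)
    linarith
  · refine (setIntegral_cube_vecGradSize_sq_le sv H.grad_sq).trans ?_
    have p : 0 ≤ m ^ 8 * X ^ (5 / 6 : ℝ) := by positivity
    have := mul_le_mul_of_nonneg_right hKB p
    have : 0 ≤ B * K * (m ^ 8 * X ^ (5 / 6 : ℝ)) := by positivity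
    linarith
  · refine (setIntegral_cube_vecSize_rpow_le sA (by linarith) H.A_rpow).trans ?_
    have h36 : (3 : ℝ) ^ s ≤ 729 := by
      calc (3 : ℝ) ^ s ≤ 3 ^ (6 : ℝ) := rpow_le_rpow_of_exponent_le (by norm_num) hs6
        _ = 729 := by norm_num
    have p : 0 ≤ (m ^ 2 / R) ^ s * R ^ (s / 3 + 2) := by positivity
    have q := mul_le_mul_of_nonneg_right hKB p
    have : 0 ≤ K * ((m ^ 2 / R) ^ s * R ^ (s / 3 + 2)) := by positivity
    refine (mul_le_mul_of_nonneg_right h36 (by positivity)).trans ?_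
    linarith
  · have := setIntegral_cube_vecSize_rpow_le sN (by norm_num) H.N_four
    simp only [rpow_ofNat] at this
    refine this.trans ?_
    have p : 0 ≤ m ^ 8 * (R ^ (-2 / 3 : ℝ) * X ^ (-5 / 3 : ℝ)
        * (m ^ 4 * X) ^ (1 + 2 / 3 * (9 / (s + 6)))) := by positivity
    have := mul_le_mul_of_nonneg_right hKB p
    have := mul_nonneg (mul_nonneg B0 K0) p
    linarith

lemma vecSize_sub_le (VA VN : Fin 3 → E3 → ℝ) (x : E3) :
    vecSize (fun i y => VA i y - VN i y) x ≤ vecSize VA x + vecSize VN x := by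
  unfold vecSize
  rw [← Finset.sum_add_distrib]
  exact Finset.sum_le_sum fun i _ => abs_sub _ _

/-- The energy growth estimate, given a cutoff, a corrector and Lebesgue bounds. -/
lemma MMPComponents.energy_le_of_remainderData {P : E3 → ℝ} (S : MMPComponents u w b P)
    (hφ : SuppSmooth L φ) (h0 : ∀ x, 0 ≤ φ x) (hD : ∀ i x, |pd i φ x| ≤ m / R)
    (H : CorrectorData s K L R m X φ u VA VN) (hs : 3 < s) (hs6 : s ≤ 6) {C r : ℝ}
    (hφ1 : ∀ x ∈ cube r, φ x = 1) (hr : r ≤ L)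
    (HR : RemainderData s C L R m X (fun x => vecSize u x + vecSize b x + vecSize w x)
      (fun x => vecSize w x + vecGradSize u x + vecGradSize b x + vecGradSize w x)
      (vecSize VA) (vecSize VN) (vecGradSize fun i x => VA i x - VN i x)) :
    energy u w b r ≤ 900 * C ^ 4 * (m ^ 8 * X ^ growthExp s) := by
  have hu := S.smooth_u
  have hw := S.smooth_w
  have hb := S.smooth_b
  have sv : ∀ i, SuppSmooth L (fun x => VA i x - VN i x) := fun i => (H.supp_A i).sub (H.supp_N i)
  have c1 := continuous_vecSize hu
  have c2 := continuous_vecSize hw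
  have c3 := continuous_vecSize hb
  have c4 := continuous_vecGradSize hu
  have c5 := continuous_vecGradSize hw
  have c6 := continuous_vecGradSize hb
  have c7 := continuous_vecGradSq hu
  have c8 := continuous_vecGradSq hw
  have c9 := continuous_vecGradSq hb
  have c10 := continuous_vecSize fun i => (sv i).smooth
  have c11 := continuous_vecGradSize fun i => (sv i).smooth
  have c12 := HR.cont_α
  have c13 := HR.cont_ν
  have cφ := hφ.smooth.continuous
  have cw : ∀ j, Continuous (w j) := fun j => (hw j).continuous
  have e1 : energy u w b r ≤ 3 * ∫ x in cube L, φ x * (1 / 3 * vecGradSq u x + vecGradSq b x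
      + vecGradSq w x + 1 / 2 * ∑ j, w j x ^ 2) := by
    rw [← integral_const_mul]
    refine le_trans ?_ (setIntegral_cube_mono_radius (by fun_prop) (fun x => ?_) hr)
    · refine setIntegral_cube_mono (continuous_energyDensity hu hw hb) (by fun_prop) fun x hx => ?_
      have := vecGradSq_nonneg u x
      have := vecGradSq_nonneg b x
      have := vecGradSq_nonneg w x
      have : 0 ≤ ∑ j, w j x ^ 2 := by positivity
      rw [hφ1 x hx]
      unfold energyDensity
      linarith
    · have := vecGradSq_nonneg u x
      have := vecGradSq_nonneg b x
      have := vecGradSq_nonneg w x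
      have := h0 x
      positivity
  have e2 := S.energy_le hφ h0 hD sv H.div_eq
  refine e1.trans ((mul_le_mul_of_nonneg_left (e2.trans ((?_ : _ ≤ _).trans
    (HR.integral_le hs hs6))) (by norm_num)).trans (le_of_eq (by ring)))
  refine setIntegral_cube_mono (by fun_prop) (by fun_prop) fun x _ => ?_
  have := mul_le_mul_of_nonneg_left (vecSize_sub_le VA VN x)
    (mul_nonneg (HR.a_nonneg x) (HR.g_nonneg x))
  simp only [mul_assoc] at this ⊢
  linarith

end

/-- Admissible mollification scale. -/
lemma mollification_scale {R M X : ℝ} (hR : 1 ≤ R) (hM : 1 ≤ M) (hX : 1 ≤ X) :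
    ∃ l : ℝ, 0 < l ∧ 16 * l ≤ R / M ∧ l ≤ R ^ (2 / 3 : ℝ) * X ^ (-5 / 12 : ℝ) ∧
      1 / l = 16 * M * X ^ (5 / 12 : ℝ) * R ^ (-2 / 3 : ℝ) := by
  have R0 : 0 < R := by linarith
  have X0 : 0 < X := by linarith
  have M0 : 0 < M := by linarith
  have hp : 0 < R ^ (2 / 3 : ℝ) * X ^ (-5 / 12 : ℝ) := by positivity
  have hX1 : X ^ (-5 / 12 : ℝ) ≤ 1 := rpow_le_one_of_one_le_of_nonpos hX (by norm_num)
  have hR1 : R ^ (2 / 3 : ℝ) ≤ R := by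
    simpa using rpow_le_rpow_of_exponent_le hR (by norm_num : (2 / 3 : ℝ) ≤ 1)
  have hpR : R ^ (2 / 3 : ℝ) * X ^ (-5 / 12 : ℝ) ≤ R := by
    calc _ ≤ R * 1 := mul_le_mul hR1 hX1 (by positivity) R0.le
      _ = R := mul_one R
  refine ⟨R ^ (2 / 3 : ℝ) * X ^ (-5 / 12 : ℝ) / (16 * M), by positivity, ?_, ?_, ?_⟩
  · calc 16 * (R ^ (2 / 3 : ℝ) * X ^ (-5 / 12 : ℝ) / (16 * M))
        = (R ^ (2 / 3 : ℝ) * X ^ (-5 / 12 : ℝ)) / M := by field_simp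
      _ ≤ R / M := by gcongr
  · exact div_le_self hp.le (by linarith)
  · rw [one_div_div, neg_div, neg_div, rpow_neg X0.le, rpow_neg R0.le]
    field_simp

lemma exists_energy_growth (s A : ℝ) (hs : 3 < s) (hs6 : s ≤ 6) (hA : 1 ≤ A) :
    ∃ C : ℝ, 1 ≤ C ∧ ∀ (u w b : Fin 3 → E3 → ℝ) (P : E3 → ℝ)
      (Fu Fw Fb : Fin 3 → Fin 3 → E3 → ℝ) (R r ρ : ℝ), MMPComponents u w b P →
      1 ≤ R → R ≤ r → r < ρ → ρ ≤ 2 * R → PotentialBounds s A R ρ u Fu →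
      PotentialBounds s A R ρ w Fw → PotentialBounds s A R ρ b Fb →
      energy u w b r ≤ C * ((R / (ρ - r)) ^ 8 * (1 + energy u w b ρ) ^ growthExp s) := by
  obtain ⟨B, hB, hcomp⟩ := exists_component_bounds s A hs hs6 hA
  obtain ⟨K, hK, hcorr⟩ := exists_correctorData s A B hs hA hB
  obtain ⟨c, hc, hcut⟩ := exists_cutoff
  refine ⟨900 * (9 ^ 7 * (B * K)) ^ 4 * (8 * c) ^ 8, ?_, ?_⟩
  · have h1 : 1 ≤ B * K := one_le_mul_of_one_le_of_one_le hB hK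
    have h2 : 1 ≤ (9 ^ 7 * (B * K)) ^ 4 := one_le_pow₀ (by linarith)
    have h3 : 1 ≤ (8 * c) ^ 8 := one_le_pow₀ (by linarith)
    have h4 := one_le_mul_of_one_le_of_one_le h2 h3
    linarith
  intro u w b P Fu Fw Fb R r ρ S hR hRr hrρ hρR pu pw pb
  have hu := S.smooth_u
  have hw := S.smooth_w
  have hb := S.smooth_b
  set δ := ρ - r with hδ
  have δ0 : 0 < δ := by linarith
  have R0 : 0 < R := by linarith
  set M := R / δ with hM
  have hM1 : 1 ≤ M := by rw [hM, le_div_iff₀ δ0]; linarith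
  have hRM : R / M = δ := by rw [hM]; field_simp
  have hMR : M / R = 1 / δ := by rw [hM]; field_simp
  set X := 1 + energy u w b ρ with hX
  have hX1 : 1 ≤ X := by linarith [energy_nonneg u w b ρ]
  set m := 8 * c * M with hm
  have hcM : 1 ≤ c * M := one_le_mul_of_one_le_of_one_le hc hM1
  have hm1 : 1 ≤ m := by linarith
  have hmδ : m / R = 8 * c / δ := by rw [hm, mul_div_assoc, hMR]; ring
  have hge := fun ρ' (h : ρ' ≤ ρ) => energy_mono hu hw hb h
  have hg : ∀ j i, _ := gradient_le_energy hu hw hb ρ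
  obtain ⟨ψ, sψ, ψ0, ψ1, ψe, ψz, ψd, -, -⟩ := hcut (r + δ / 2) ρ (by linarith) (by linarith)
  have ψd' : ∀ i x, |pd i ψ x| ≤ m / R := fun i x => by
    refine (ψd i x).trans ?_
    rw [hmδ, show ρ - (r + δ / 2) = δ / 2 by linarith, div_div_eq_mul_div]
    exact div_le_div_of_nonneg_right (by linarith) δ0.le
  have ψs : SuppSmooth ρ ψ := ⟨sψ, ψz⟩
  have bu := hcomp R m ρ (r + δ / 2) X ψ u Fu hR hm1 hX1 (by linarith) ψs ψ0 ψ1 ψe ψd' hu pu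
    fun j i => (hg j i).1.trans (by linarith)
  have bw := hcomp R m ρ (r + δ / 2) X ψ w Fw hR hm1 hX1 (by linarith) ψs ψ0 ψ1 ψe ψd' hw pw
    fun j i => (hg j i).2.1.trans (by linarith)
  have bb := hcomp R m ρ (r + δ / 2) X ψ b Fb hR hm1 hX1 (by linarith) ψs ψ0 ψ1 ψe ψd' hb pb
    fun j i => (hg j i).2.2.trans (by linarith)
  obtain ⟨φ, sφ, φ0, φ1, φe, φz, φd1, φd2, φd3⟩ := hcut r (r + δ / 4) (by linarith) (by linarith)
  set L := r + δ / 4 with hL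
  have hLr : L - r = δ / 4 := by linarith
  have hL0 : 0 < L := by linarith
  have hLR : L ≤ 2 * R := by linarith
  have φs : SuppSmooth L φ := ⟨sφ, φz⟩
  have hmL : 4 * c / δ ≤ m / L := by
    have : m / (2 * R) ≤ m / L := by gcongr
    refine le_trans (le_of_eq ?_) this
    rw [mul_comm 2 R, ← div_div, hmδ]
    ring
  have k0 : 0 ≤ 4 * c / δ := by positivity
  have d1 : ∀ i x, |pd i φ x| ≤ m / L := fun i x => by
    refine (φd1 i x).trans (le_trans (le_of_eq ?_) hmL)
    rw [hLr]
    field_simp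
  have d1' : ∀ i x, |pd i φ x| ≤ m / R := fun i x => by
    refine (d1 i x).trans ?_
    gcongr
    linarith
  have d2 : ∀ i j x, |pd i (pd j φ) x| ≤ m ^ 2 / L ^ 2 := fun i j x => by
    refine (φd2 i j x).trans ?_
    rw [hLr, ← div_pow]
    refine le_trans ?_ (pow_le_pow_left₀ k0 hmL 2)
    calc c / (δ / 4) ^ 2 = 16 * c / δ ^ 2 := by field_simp; norm_num
      _ ≤ 16 * c ^ 2 / δ ^ 2 := by gcongr; nlinarith
      _ = (4 * c / δ) ^ 2 := by rw [div_pow]; ring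
  have d3 : ∀ i j k x, |pd i (pd j (pd k φ)) x| ≤ m ^ 3 / L ^ 3 := fun i j k x => by
    refine (φd3 i j k x).trans ?_
    rw [hLr, ← div_pow]
    refine le_trans ?_ (pow_le_pow_left₀ k0 hmL 3)
    calc c / (δ / 4) ^ 3 = 64 * c / δ ^ 3 := by field_simp; norm_num
      _ ≤ 64 * c ^ 3 / δ ^ 3 := by
          gcongr
          exact le_self_pow₀ hc (by norm_num)
      _ = (4 * c / δ) ^ 3 := by rw [div_pow]; ring
  obtain ⟨l, l0, l1, l2, l3⟩ := mollification_scale hR hM1 hX1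
  rw [hRM] at l1
  have cu := fun j => (hu j).continuous
  obtain ⟨VA, VN, H⟩ := hcorr R m X l L ρ (r + δ / 2) φ u Fu hR hm1 hX1 l0 (by linarith)
    (by linarith) l2 (by
      rw [l3]
      refine mul_le_mul_of_nonneg_right (mul_le_mul_of_nonneg_right ?_ (by positivity))
        (by positivity)
      rw [hm]
      nlinarith) (by linarith) (by linarith) φs d1 d2 d3 pu hu S.div_u bu (fun j k =>
        (setIntegral_cube_mono_radius (f := fun x => pd k (u j) x ^ 2)
          (((hu j).pd k).continuous.pow 2) (fun x => sq_nonneg _) (by linarith)).trans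
          ((hg j k).1.trans (by linarith)))
  have hLρ : L ≤ r + δ / 2 := by linarith
  have HR := H.remainderData hu hw hb hs hs6 hB hK hR hm1 hX1
    (fun j => (bu j).mono (hu j).continuous hLρ) (fun j => (bw j).mono (hw j).continuous hLρ)
    (fun j => (bb j).mono (hb j).continuous hLρ)
    ((hge L (by linarith)).trans (by linarith))
  refine (S.energy_le_of_remainderData φs φ0 d1' H hs hs6 φe (by linarith) HR).trans
    (le_of_eq ?_)
  rw [hm]
  ring

lemma growthExp_lt_one {s : ℝ} (hs : 3 < s) : growthExp s < 1 := by
  refine max_lt (by norm_num) ?_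
  rw [div_lt_one (by linarith)]
  linarith

lemma growthExp_pos (s : ℝ) : 0 < growthExp s := lt_of_lt_of_le (by norm_num) (le_max_left _ _)

/-- Iteration lemma for a sublinear growth estimate with polynomial loss. -/
lemma le_of_sublinear_growth {θ C : ℝ} (hθ0 : 0 < θ) (hθ1 : θ < 1) (hC : 1 ≤ C) {G : ℝ → ℝ}
    {R : ℝ} (hR : 0 < R) (hG : ∀ r, 1 ≤ G r) (hmono : Monotone G)
    (h : ∀ r ρ, R ≤ r → r < ρ → ρ ≤ 2 * R → G r ≤ C * ((R / (ρ - r)) ^ 8 * G ρ ^ θ)) :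
    G R ≤ (C * 2 ^ (8 + 8 / (1 - θ))) ^ (1 / (1 - θ)) := by
  set κ := 8 / (1 - θ) with hκ
  have hθ : 0 < 1 - θ := by linarith
  have κ0 : 0 < κ := by positivity
  have κe : 8 + κ * θ = κ := by rw [hκ]; field_simp; ring
  set D := C * 2 ^ (8 + κ) with hD
  have D0 : 0 < D := by positivity
  let W : ℝ → ℝ := fun r => ((2 * R - r) / R) ^ κ * G r
  have W0 : ∀ r ∈ Set.Ico R (2 * R), 0 ≤ W r := fun r hr => by
    have h1 : 0 ≤ 2 * R - r := by linarith [hr.2]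
    have h2 := hG r
    have : 0 ≤ G r := by linarith
    positivity
  have hbdd : BddAbove (W '' Set.Ico R (2 * R)) := by
    refine ⟨G (2 * R), ?_⟩
    rintro _ ⟨r, hr, rfl⟩
    have h1 : 0 ≤ 2 * R - r := by linarith [hr.2]
    have h2 : (2 * R - r) / R ≤ 1 := by rw [div_le_one hR]; linarith [hr.1]
    have h3 : ((2 * R - r) / R) ^ κ ≤ 1 := rpow_le_one (by positivity) h2 κ0.le
    calc W r ≤ 1 * G r := mul_le_mul_of_nonneg_right h3 (by linarith [hG r])
      _ ≤ G (2 * R) := by rw [one_mul]; exact hmono hr.2.le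
  set T := sSup (W '' Set.Ico R (2 * R)) with hT
  have hWT : ∀ r ∈ Set.Ico R (2 * R), W r ≤ T := fun r hr => le_csSup hbdd ⟨r, hr, rfl⟩
  have hRm : R ∈ Set.Ico R (2 * R) := ⟨le_rfl, by linarith⟩
  have hWR : W R = G R := by
    simp only [W]
    rw [show (2 * R - R) / R = 1 by field_simp; norm_num, one_rpow, one_mul]
  have hGT : G R ≤ T := hWR ▸ hWT R hRm
  have T1 : 1 ≤ T := (hG R).trans hGT
  have T0 : 0 < T := by linarith
  have hTle : T ≤ D * T ^ θ := by
    refine csSup_le ⟨_, R, hRm, rfl⟩ ?_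
    rintro _ ⟨r, hr, rfl⟩
    set q := (2 * R - r) / R with hq
    have h1 : 0 < 2 * R - r := by linarith [hr.2]
    have q0 : 0 < q := by positivity
    set ρ := r + (2 * R - r) / 2 with hρ
    have hρm : ρ ∈ Set.Ico R (2 * R) := ⟨by linarith [hr.1], by linarith⟩
    have e1 : R / (ρ - r) = 2 / q := by
      rw [hq, show ρ - r = (2 * R - r) / 2 by linarith]; field_simp
    have e2 : (2 * R - ρ) / R = q / 2 := by
      rw [hq, show 2 * R - ρ = (2 * R - r) / 2 by linarith]; ring
    have g1 := h r ρ hr.1 (by linarith) hρm.2.le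
    have g2 := hWT ρ hρm
    have Gρ : 0 ≤ G ρ := by linarith [hG ρ]
    simp only [W, e2] at g2
    have g3 : G ρ ≤ T * (2 / q) ^ κ := by
      calc G ρ = ((q / 2) ^ κ * G ρ) * (2 / q) ^ κ := by
            rw [mul_right_comm, ← mul_rpow (by positivity) (by positivity)]
            rw [show q / 2 * (2 / q) = 1 by field_simp, one_rpow, one_mul]
        _ ≤ T * (2 / q) ^ κ := by gcongr
    calc W r = q ^ κ * G r := rfl
      _ ≤ q ^ κ * (C * ((2 / q) ^ 8 * (T * (2 / q) ^ κ) ^ θ)) := by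
          rw [e1] at g1
          refine mul_le_mul_of_nonneg_left (g1.trans ?_) (by positivity)
          gcongr
      _ = C * T ^ θ * (q ^ κ * ((2 / q) ^ (8 : ℝ) * (2 / q) ^ (κ * θ))) := by
          rw [mul_rpow T0.le (by positivity), ← rpow_mul (by positivity), rpow_ofNat]
          ring
      _ = C * T ^ θ * 2 ^ κ := by
          rw [← rpow_add (by positivity), κe, ← mul_rpow q0.le (by positivity)]
          rw [show q * (2 / q) = 2 by field_simp]
      _ ≤ C * T ^ θ * 2 ^ (8 + κ) := by
          gcongr
          · norm_num
          · linarith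
      _ = D * T ^ θ := by rw [hD]; ring
  have h1 : T ^ (1 - θ) ≤ D := by
    rw [rpow_sub T0, rpow_one, div_le_iff₀ (by positivity)]
    exact hTle
  calc G R ≤ T := hGT
    _ = (T ^ (1 - θ)) ^ (1 / (1 - θ)) := by
        rw [← rpow_mul T0.le, mul_one_div_cancel hθ.ne', rpow_one]
    _ ≤ D ^ (1 / (1 - θ)) := rpow_le_rpow (by positivity) h1 (by positivity)

/-- Uniform energy bound on all large cubes. -/
lemma exists_energy_bound (s A : ℝ) (hs : 3 < s) (hs6 : s ≤ 6) (hA : 1 ≤ A) :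
    ∃ C : ℝ, ∀ (u w b : Fin 3 → E3 → ℝ) (P : E3 → ℝ)
      (Fu Fw Fb : Fin 3 → Fin 3 → E3 → ℝ) (R : ℝ), MMPComponents u w b P →
      1 ≤ R → PotentialBounds s A R (2 * R) u Fu → PotentialBounds s A R (2 * R) w Fw →
      PotentialBounds s A R (2 * R) b Fb → energy u w b R ≤ C := by
  obtain ⟨C, hC, h⟩ := exists_energy_growth s A hs hs6 hA
  refine ⟨((C + 1) * 2 ^ (8 + 8 / (1 - growthExp s))) ^ (1 / (1 - growthExp s)), ?_⟩
  intro u w b P Fu Fw Fb R S hR pu pw pb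
  have sub : ∀ {f F ρ}, ρ ≤ 2 * R → PotentialBounds s A R (2 * R) f F →
      PotentialBounds s A R ρ f F := fun {f F ρ} hρ p =>
    { smooth := p.smooth
      div_eq := p.div_eq
      sq_le := fun i j => (setIntegral_cube_mono_radius (f := fun x => F i j x ^ 2)
        ((p.smooth i j).continuous.pow 2) (fun x => sq_nonneg _) hρ).trans (p.sq_le i j)
      rpow_le := fun i j => (setIntegral_cube_mono_radius
        ((p.smooth i j).continuous.abs_rpow (by linarith)) (fun x => by positivity) hρ).trans
        (p.rpow_le i j) }
  have key := le_of_sublinear_growth (θ := growthExp s) (C := C + 1)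
    (G := fun r => 1 + energy u w b r) (R := R) (growthExp_pos s) (growthExp_lt_one hs)
    (by linarith) (by linarith) (fun r => by linarith [energy_nonneg u w b r])
    (fun r r' hr => by
      have := energy_mono (S.smooth_u) S.smooth_w S.smooth_b hr
      simpa using this) ?_
  · linarith
  · intro r ρ hr hρ hρ2
    have h1 := h u w b P Fu Fw Fb R r ρ S hR hr hρ hρ2 (sub hρ2 pu) (sub hρ2 pw) (sub hρ2 pb)
    have hM : 1 ≤ R / (ρ - r) := by rw [le_div_iff₀ (by linarith)]; linarith
    have h2 : 1 ≤ (R / (ρ - r)) ^ 8 * (1 + energy u w b ρ) ^ growthExp s :=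
      one_le_mul_of_one_le_of_one_le (one_le_pow₀ hM)
        (one_le_rpow (by linarith [energy_nonneg u w b ρ]) (growthExp_pos s).le)
    linarith

lemma IsMMPSolution.components {u w b : E3 → E3} {P : E3 → ℝ} (S : IsMMPSolution u w b P) :
    MMPComponents (fun j x => u x j) (fun j x => w x j) (fun j x => b x j) P where
  smooth_u := Smooth.coord S.smooth_u
  smooth_w := Smooth.coord S.smooth_w
  smooth_b := Smooth.coord S.smooth_b
  smooth_P := S.smooth_P
  eq_u := fun x j => by
    have e := S.eq_u x j
    fin_cases j <;> exact e
  eq_w := fun x j => by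
    have e := S.eq_w x j
    fin_cases j <;> exact e
  eq_b := S.eq_b
  div_u := S.div_u
  div_b := S.div_b

lemma gradSq_eq_vecGradSq (v : E3 → E3) : gradSq v = vecGradSq fun j x => v x j := rfl

lemma volume_ball3 {r : ℝ} (hr : 0 ≤ r) :
    (volume (ball3 r)).toReal = r ^ 3 * (volume (ball3 1)).toReal := by
  unfold ball3
  rw [Measure.addHaar_ball _ _ hr, ENNReal.toReal_mul, ENNReal.toReal_ofReal (by positivity)]
  simp

lemma abs_le_frob (A : Fin 3 → Fin 3 → ℝ) (i j : Fin 3) : |A i j| ≤ frob A := by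
  refine abs_le_sqrt ?_
  exact (Finset.single_le_sum (f := fun j => A i j ^ 2) (fun _ _ => sq_nonneg _)
    (Finset.mem_univ j)).trans (Finset.single_le_sum (f := fun i => ∑ j, A i j ^ 2)
      (fun _ _ => Finset.sum_nonneg fun _ _ => sq_nonneg _) (Finset.mem_univ i))

lemma frob_nonneg (A : Fin 3 → Fin 3 → ℝ) : 0 ≤ frob A := sqrt_nonneg _

lemma meanOsc_nonneg (Φ : E3 → Fin 3 → Fin 3 → ℝ) (s r : ℝ) : 0 ≤ meanOsc Φ s r :=
  rpow_nonneg (mul_nonneg (by positivity) (integral_nonneg fun _ =>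
    rpow_nonneg (frob_nonneg _) _)) _

lemma cube_subset_ball3 {R : ℝ} (hR : 0 < R) : cube (2 * R) ⊆ ball3 (5 * R) := fun x hx => by
  have := norm_le_of_mem_cube hx
  rw [ball3, mem_ball_zero_iff]
  linarith

lemma volume_ball3_pos {r : ℝ} (hr : 0 < r) : 0 < (volume (ball3 r)).toReal :=
  ENNReal.toReal_pos (measure_ball_pos _ _ hr).ne' measure_ball_lt_top.ne

/-- The mean oscillation hypothesis controls the normalised potential on cubes. -/
lemma setIntegral_cube_abs_sub_mavg_rpow_le {Φ : E3 → Fin 3 → Fin 3 → ℝ}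
    (hΦ : ∀ i j, Continuous fun x => Φ x i j) {s Y R : ℝ} (hs : 0 < s) (hR : 0 < R)
    (h : meanOsc Φ s (5 * R) ≤ Y) (i j : Fin 3) :
    ∫ x in cube (2 * R), |Φ x i j - mavg Φ (5 * R) i j| ^ s
      ≤ (volume (ball3 (5 * R))).toReal * Y ^ s := by
  have hV : 0 < (volume (ball3 (5 * R))).toReal := volume_ball3_pos (by linarith)
  have cf : Continuous fun x => (frob fun i j => Φ x i j - mavg Φ (5 * R) i j) ^ s := by
    refine Continuous.rpow_const ?_ fun _ => Or.inr hs.le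
    unfold frob
    fun_prop
  have i1 : IntegrableOn (fun x => (frob fun i j => Φ x i j - mavg Φ (5 * R) i j) ^ s)
      (ball3 (5 * R)) :=
    (cf.continuousOn.integrableOn_compact (isCompact_closedBall (0 : E3) (5 * R))).mono_set
      ball_subset_closedBall
  have h1 : ∫ x in cube (2 * R), |Φ x i j - mavg Φ (5 * R) i j| ^ s
      ≤ ∫ x in ball3 (5 * R), (frob fun i j => Φ x i j - mavg Φ (5 * R) i j) ^ s := by
    refine (setIntegral_cube_mono (Continuous.abs_rpow (by fun_prop) hs.le) cf
      fun x _ => ?_).trans (setIntegral_mono_set i1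
        (ae_of_all _ fun x => rpow_nonneg (frob_nonneg _) _)
        (LE.le.eventuallyLE (cube_subset_ball3 hR)))
    exact rpow_le_rpow (abs_nonneg _)
      (abs_le_frob (fun i j => Φ x i j - mavg Φ (5 * R) i j) i j) hs.le
  refine h1.trans ?_
  have hI : 0 ≤ ∫ x in ball3 (5 * R), (frob fun i j => Φ x i j - mavg Φ (5 * R) i j) ^ s :=
    integral_nonneg fun _ => rpow_nonneg (frob_nonneg _) _
  have h2 := rpow_le_rpow (meanOsc_nonneg Φ s _) h hs.le
  unfold meanOsc at h2
  rw [← rpow_mul (by positivity), one_div_mul_cancel hs.ne', rpow_one, inv_mul_le_iff₀ hV] at h2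
  exact h2

lemma sq_le_rpow_add {s t : ℝ} (hs : 2 ≤ s) {lam : ℝ} (hl : 0 < lam) :
    t ^ 2 ≤ lam ^ (2 - s) * |t| ^ s + lam ^ 2 := by
  rcases le_total |t| lam with h | h
  · have h1 : t ^ 2 ≤ lam ^ 2 := by
      rw [← sq_abs]
      exact pow_le_pow_left₀ (abs_nonneg t) h 2
    have : 0 ≤ lam ^ (2 - s) * |t| ^ s := by positivity
    linarith
  · have ht : 0 < |t| := hl.trans_le h
    have h1 : |t| ^ (2 - s) ≤ lam ^ (2 - s) :=
      rpow_le_rpow_of_nonpos hl h (by linarith)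
    calc t ^ 2 = |t| ^ (2 - s) * |t| ^ s := by
          rw [← rpow_add ht, sub_add_cancel, rpow_two, sq_abs]
      _ ≤ lam ^ (2 - s) * |t| ^ s := by gcongr
      _ ≤ _ := by linarith [sq_nonneg lam]

lemma exists_potentialBounds (s C₀ : ℝ) (hs : 3 < s) (hs6 : s ≤ 6) (hC : 0 < C₀) :
    ∃ A : ℝ, 1 ≤ A ∧ ∀ (Φ : E3 → Fin 3 → Fin 3 → ℝ) (f : E3 → E3) (R : ℝ), 1 ≤ R →
      (∀ i j, ContDiff ℝ (⊤ : ℕ∞) fun x => Φ x i j) → (∀ x j, mdiv Φ x j = f x j) →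
      meanOsc Φ s (5 * R) ≤ C₀ * (5 * R) ^ ((1 : ℝ) / 3 - 1 / s) →
      ∃ F, PotentialBounds s A R (2 * R) (fun j x => f x j) F := by
  set V := (volume (ball3 1)).toReal with hV
  have V0 : 0 < V := volume_ball3_pos one_pos
  set A₁ := V * C₀ ^ s * 5 ^ (s / 3 + 2) with hA₁
  have A₁0 : 0 < A₁ := by positivity
  refine ⟨1 + A₁ + 125 * V, by linarith, fun Φ f R hR hΦ hf hosc => ?_⟩
  have s0 : 0 < s := by linarith
  have R0 : 0 < R := by linarith
  have hV5 : (volume (ball3 (5 * R))).toReal = 125 * R ^ 3 * V := by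
    rw [volume_ball3 (by linarith)]
    ring
  have bs : ∀ i j, ∫ x in cube (2 * R), |Φ x i j - mavg Φ (5 * R) i j| ^ s
      ≤ A₁ * R ^ (s / 3 + 2) := fun i j => by
    refine (setIntegral_cube_abs_sub_mavg_rpow_le (fun i j => (hΦ i j).continuous) s0 R0 hosc
      i j).trans (le_of_eq ?_)
    rw [volume_ball3 (by linarith), mul_rpow hC.le (by positivity), ← rpow_mul (by positivity),
      show ((1 : ℝ) / 3 - 1 / s) * s = s / 3 + 2 - (3 : ℕ) by field_simp; push_cast; ring,
      rpow_sub_natCast (by positivity), mul_rpow (by norm_num) R0.le]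
    rw [← hV, hA₁]
    generalize (5 : ℝ) ^ (s / 3 + 2) = p
    field_simp
  refine ⟨fun i j x => Φ x i j - mavg Φ (5 * R) i j, ?_, ?_, ?_, ?_⟩
  · exact fun i j => (hΦ i j).sub contDiff_const
  · intro j x
    rw [← hf x j]
    refine Finset.sum_congr rfl fun i _ => ?_
    rw [pd_sub (hΦ i j) contDiff_const, pd_const, sub_zero]
  · intro i j
    have cΦ := (hΦ i j).continuous
    have ca : Continuous fun x => |Φ x i j - mavg Φ (5 * R) i j| ^ s :=
      Continuous.abs_rpow (by fun_prop) s0.le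
    have l0 : 0 < R ^ (1 / 6 : ℝ) := by positivity
    have hcube : ∫ _ in cube (2 * R), (1 : ℝ) ≤ 125 * R ^ 3 * V := by
      rw [setIntegral_const, smul_eq_mul, mul_one, ← hV5]
      exact ENNReal.toReal_mono measure_ball_lt_top.ne (measure_mono (cube_subset_ball3 R0))
    have e1 : (R ^ (1 / 6 : ℝ)) ^ (2 - s) * R ^ (s / 3 + 2) ≤ R ^ (10 / 3 : ℝ) := by
      rw [← rpow_mul R0.le, ← rpow_add R0]
      exact rpow_le_rpow_of_exponent_le hR (by linarith)
    have e2 : (R ^ (1 / 6 : ℝ)) ^ 2 * R ^ 3 = R ^ (10 / 3 : ℝ) := by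
      rw [← rpow_mul_natCast R0.le, ← rpow_natCast R 3, ← rpow_add R0]
      norm_num
    calc ∫ x in cube (2 * R), (Φ x i j - mavg Φ (5 * R) i j) ^ 2
        ≤ ∫ x in cube (2 * R), ((R ^ (1 / 6 : ℝ)) ^ (2 - s)
            * |Φ x i j - mavg Φ (5 * R) i j| ^ s + (R ^ (1 / 6 : ℝ)) ^ 2 * 1) := by
          refine setIntegral_cube_mono (by fun_prop) (by fun_prop) fun x _ => ?_
          rw [mul_one]
          exact sq_le_rpow_add (by linarith) l0
      _ = (R ^ (1 / 6 : ℝ)) ^ (2 - s) * (∫ x in cube (2 * R), |Φ x i j - mavg Φ (5 * R) i j| ^ s)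
            + (R ^ (1 / 6 : ℝ)) ^ 2 * ∫ _ in cube (2 * R), (1 : ℝ) := by
          have c₂ : Continuous fun _ : E3 => (R ^ (1 / 6 : ℝ)) ^ 2 * (1 : ℝ) := continuous_const
          rw [integral_add ((ca.const_mul _).integrableOn_cube _) (c₂.integrableOn_cube _),
            integral_const_mul, integral_const_mul]
      _ ≤ (R ^ (1 / 6 : ℝ)) ^ (2 - s) * (A₁ * R ^ (s / 3 + 2))
            + (R ^ (1 / 6 : ℝ)) ^ 2 * (125 * R ^ 3 * V) := by
          gcongr
          exact bs i j
      _ = A₁ * ((R ^ (1 / 6 : ℝ)) ^ (2 - s) * R ^ (s / 3 + 2))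
            + 125 * V * ((R ^ (1 / 6 : ℝ)) ^ 2 * R ^ 3) := by ring
      _ ≤ A₁ * R ^ (10 / 3 : ℝ) + 125 * V * R ^ (10 / 3 : ℝ) := by
          rw [e2]
          gcongr
      _ ≤ (1 + A₁ + 125 * V) * R ^ (10 / 3 : ℝ) := by
          have : 0 ≤ R ^ (10 / 3 : ℝ) := by positivity
          linarith
  · intro i j
    refine (bs i j).trans (mul_le_mul_of_nonneg_right ?_ (by positivity))
    linarith

lemma aecover_cube : AECover (volume : Measure E3) atTop fun n : ℕ => cube (n + 1 : ℝ) where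
  ae_eventually_mem := ae_of_all _ fun x => by
    filter_upwards [eventually_ge_atTop ⌈‖x‖⌉₊] with n hn i
    have h1 : ‖x i‖ ≤ ‖x‖ := PiLp.norm_apply_le x i
    have h2 := Nat.ceil_le.1 hn
    rw [norm_eq_abs] at h1
    linarith
  measurableSet := fun n => measurableSet_cube _

/-- Finiteness of the total Dirichlet integral under the potential growth hypothesis. -/
theorem dirichlet_integral_finite
    (u w b : E3 → E3) (P : E3 → ℝ) (hsol : IsMMPSolution u w b P)
    (Φ Ψ Υ : E3 → Fin 3 → Fin 3 → ℝ)
    (hΦ : ∀ i j, ContDiff ℝ (⊤ : ℕ∞) (fun x => Φ x i j))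
    (hΨ : ∀ i j, ContDiff ℝ (⊤ : ℕ∞) (fun x => Ψ x i j))
    (hΥ : ∀ i j, ContDiff ℝ (⊤ : ℕ∞) (fun x => Υ x i j))
    (hΦu : ∀ (x : E3) (j : Fin 3), mdiv Φ x j = u x j)
    (hΨb : ∀ (x : E3) (j : Fin 3), mdiv Ψ x j = b x j)
    (hΥw : ∀ (x : E3) (j : Fin 3), mdiv Υ x j = w x j)
    (s : ℝ) (hs1 : 3 < s) (hs2 : s ≤ 6)
    (C₀ : ℝ) (hC₀ : 0 < C₀)
    (hosc : ∀ r : ℝ, 1 < r →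
      meanOsc Φ s r + meanOsc Ψ s r + meanOsc Υ s r ≤ C₀ * r ^ ((1:ℝ)/3 - 1/s))
    : (∫⁻ x : E3, ENNReal.ofReal (gradSq u x + gradSq b x + gradSq w x)) < ⊤ := by
  obtain ⟨A, hA, hpot⟩ := exists_potentialBounds s C₀ hs1 hs2 hC₀
  obtain ⟨C, hC⟩ := exists_energy_bound s A hs1 hs2 hA
  have S := hsol.components
  have cu := continuous_vecGradSq S.smooth_u
  have cw := continuous_vecGradSq S.smooth_w
  have cb := continuous_vecGradSq S.smooth_b
  have ce := continuous_energyDensity S.smooth_u S.smooth_w S.smooth_b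
  have key : ∀ R : ℝ, 1 ≤ R →
      energy (fun j x => u x j) (fun j x => w x j) (fun j x => b x j) R ≤ C := fun R hR => by
    have h := hosc (5 * R) (by linarith)
    have p1 := meanOsc_nonneg Φ s (5 * R)
    have p2 := meanOsc_nonneg Ψ s (5 * R)
    have p3 := meanOsc_nonneg Υ s (5 * R)
    obtain ⟨Fu, pu⟩ := hpot Φ u R hR hΦ hΦu (by linarith)
    obtain ⟨Fw, pw⟩ := hpot Υ w R hR hΥ hΥw (by linarith)
    obtain ⟨Fb, pb⟩ := hpot Ψ b R hR hΨ hΨb (by linarith)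
    exact hC _ _ _ P Fu Fw Fb R S hR pu pw pb
  simp only [gradSq_eq_vecGradSq]
  have cc := (cu.add cb).add cw
  refine (aecover_cube.integrable_of_integral_bounded_of_nonneg_ae C
    (fun n => cc.integrableOn_cube _) (ae_of_all _ fun x => ?_)
    (Eventually.of_forall fun n => ?_)).lintegral_lt_top
  · exact add_nonneg (add_nonneg (vecGradSq_nonneg _ x) (vecGradSq_nonneg _ x))
      (vecGradSq_nonneg _ x)
  · refine (setIntegral_cube_mono cc ce fun x _ => ?_).trans (key (n + 1) ?_)
    · exact le_add_of_nonneg_right (Finset.sum_nonneg fun j _ => sq_nonneg _)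
    · have : (0 : ℝ) ≤ n := Nat.cast_nonneg n
      linarith
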